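/- Let C ⊆ ℝ^n be a compact semialgebraic set and let f ∈ ℝ[x_1,…,x_n] be a polynomial that is non-negative and not identically zero on C. Then the function I(s) = ∫_C f(x)^s dμ(x) (Lebesgue measure) is holomorphic on the half-plane Re(s) > 0 and extends to a meromorphic function on all of ℂ whose poles are contained in the set {−r/N : r = 1, 2, 3, …} for some fixed positive integer N (depending on f and C), and every pole has order at most n. Moreover the value of the extension at s = 0 equals μ(C). -/

import Mathlib

open MeasureTheory Complex

noncomputable section

/-- A subset of `ℝ^n` is *semialgebraic* if it is a finite union of finite intersections
of sets of the form `{x | f x > 0}` or `{x | f x = 0}`, where the `f` are polynomials in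
`n` variables with real coefficients. -/
def IsSemialgebraic {n : ℕ} (C : Set (Fin n → ℝ)) : Prop :=
  ∃ (k : ℕ) (l : Fin k → ℕ) (p : (i : Fin k) → Fin (l i) → MvPolynomial (Fin n) ℝ)
    (b : (i : Fin k) → Fin (l i) → Bool),
    C = ⋃ i, ⋂ j,
      (if b i j then {x | MvPolynomial.eval x (p i j) = 0}
       else {x | 0 < MvPolynomial.eval x (p i j)})

set_option linter.all false

section
open Filter Topology in
theorem germ_domain {E : Type*} [NormedAddCommGroup E] [NormedSpace ℝ E] {f g : E → ℝ} {x : E}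
    (hf : AnalyticAt ℝ f x) (hg : AnalyticAt ℝ g x)
    (h : ∀ᶠ y in 𝓝 x, f y * g y = 0) : f =ᶠ[𝓝 x] 0 ∨ g =ᶠ[𝓝 x] 0 := by
  have h1 := hf.eventually_analyticAt.and (hg.eventually_analyticAt.and h)
  obtain ⟨r, hr, hb⟩ := Metric.eventually_nhds_iff_ball.1 h1
  by_cases hz : ∀ y ∈ Metric.ball x r, f y = 0
  · left
    filter_upwards [Metric.ball_mem_nhds x hr] with y hy using hz y hy
  · push Not at hz
    obtain ⟨y, hy, hfy⟩ := hz
    right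
    have hg' : AnalyticOnNhd ℝ g (Metric.ball x r) := fun z hz => (hb z hz).2.1
    have : g =ᶠ[𝓝 y] 0 := by
      have c := (hb y hy).1.continuousAt.eventually_ne hfy
      filter_upwards [c, Metric.isOpen_ball.mem_nhds hy] with z hz hz'
      have := (hb z hz').2.2
      simpa [hz] using this
    have := hg'.eqOn_zero_of_preconnected_of_eventuallyEq_zero
      (convex_ball x r).isPreconnected hy this
    filter_upwards [Metric.ball_mem_nhds x hr] with z hz using this hz

theorem telescope_multilinear {E : Type*} [NormedAddCommGroup E] [NormedSpace ℝ E] {m : ℕ}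
    (p : ContinuousMultilinearMap ℝ (fun _ : Fin (m+1) => E) ℝ) (x y e : E) (c : ℝ)
    (h : x = y + c • e) :
    p (fun _ => x) - p (fun _ => y) =
      c * ∑ i : Fin (m+1), p (i.insertNth e (fun l => if l.castSucc < i then x else y)) := by
  let T : ℕ → ℝ := fun k => p (fun l => if l.1 < k then x else y)
  have h1 : p (fun _ => x) - p (fun _ => y) = T (m+1) - T 0 := by
    simp [T, fun l : Fin (m+1) => Nat.lt_succ_iff.1 l.2]
  rw [h1, ← Finset.sum_range_sub, Finset.sum_range, Finset.mul_sum]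
  refine Finset.sum_congr rfl fun i _ => ?_
  let v : Fin (m+1) → E := fun l => if l.1 < i.1 then x else y
  have e1 : (fun l : Fin (m+1) => if l.1 < i.1+1 then x else y) = Function.update v i x := by
    funext l
    by_cases hl : l = i
    · subst hl; simp
    · have : l.1 ≠ i.1 := fun h => hl (Fin.ext h)
      rw [Function.update_of_ne hl]
      simp only [v]
      congr 1
      exact propext ⟨fun _ => by omega, fun _ => by omega⟩
  have e2 : v = Function.update v i y := by
    rw [eq_comm, Function.update_eq_self_iff]; simp [v]
  have e3 : (i.insertNth e (fun l => if l.castSucc < i then x else y) : Fin (m+1) → E)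
      = Function.update v i e := by
    funext l
    refine Fin.succAboveCases i ?_ ?_ l
    · simp
    · intro j
      rw [Fin.insertNth_apply_succAbove, Function.update_of_ne (Fin.succAbove_ne i j)]
      simp only [v]
      congr 1
      apply propext
      by_cases hj : j.castSucc < i
      · rw [Fin.succAbove_of_castSucc_lt _ _ hj]; simp [Fin.lt_def]
      · rw [Fin.succAbove_of_le_castSucc _ _ (not_lt.1 hj)]
        simp only [Fin.lt_def, Fin.val_castSucc, Fin.val_succ] at *
        omega
  show p _ - p v = _
  rw [e1, e3]
  conv_lhs => rw [e2]
  simp only [Function.update_idem]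
  rw [h, p.map_update_add, p.map_update_smul]
  simp

def divSeries {E : Type*} [NormedAddCommGroup E] [NormedSpace ℝ E]
    (p : FormalMultilinearSeries ℝ E ℝ) (P : E →L[ℝ] E) (e : E) : FormalMultilinearSeries ℝ E ℝ :=
  fun m => ∑ i : Fin (m+1), ((p (m+1)).curryMid i e).compContinuousLinearMap
    (fun l => if l.castSucc < i then ContinuousLinearMap.id ℝ E else P)

open Filter Topology ENNReal NNReal in
theorem germ_div_aux {E : Type*} [NormedAddCommGroup E] [NormedSpace ℝ E] [CompleteSpace E]
    {f : E → ℝ} (hf : AnalyticAt ℝ f 0)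
    (P : E →L[ℝ] E) (hP : ‖P‖ ≤ 1) (e : E) (he : ‖e‖ ≤ 1) (ℓ : E → ℝ)
    (hℓ : ∀ x, x = P x + ℓ x • e) :
    ∃ g : E → ℝ, AnalyticAt ℝ g 0 ∧ ∀ᶠ x in 𝓝 0, f x = f (P x) + ℓ x * g x := by
  obtain ⟨p, hp⟩ := hf
  obtain ⟨r, hr⟩ := hp
  set q := divSeries p P e
  obtain ⟨ρ, hρ0, hρ⟩ := ENNReal.lt_iff_exists_nnreal_btwn.1 hr.r_pos
  have hρ0' : 0 < ρ := by exact_mod_cast hρ0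
  obtain ⟨C, hC, hCb⟩ := p.norm_mul_pow_le_of_lt_radius (hρ.trans_le hr.r_le)
  have hq : ∀ m, ‖q m‖ ≤ (m+1) * ‖p (m+1)‖ := by
    intro m
    refine (norm_sum_le _ _).trans ?_
    have : ∀ i ∈ (Finset.univ : Finset (Fin (m+1))), ‖((p (m+1)).curryMid i e).compContinuousLinearMap
      (fun l => if l.castSucc < i then ContinuousLinearMap.id ℝ E else P)‖ ≤ ‖p (m+1)‖ := by
      intro i _
      refine (ContinuousMultilinearMap.norm_compContinuousLinearMap_le _ _).trans ?_
      have h1 : ‖(p (m+1)).curryMid i e‖ ≤ ‖p (m+1)‖ := by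
        refine (ContinuousLinearMap.le_opNorm _ _).trans ?_
        rw [ContinuousMultilinearMap.norm_curryMid]
        exact mul_le_of_le_one_right (norm_nonneg _) he
      have h2 : ∏ l : Fin m, ‖(if l.castSucc < i then ContinuousLinearMap.id ℝ E else P)‖ ≤ 1 := by
        refine Finset.prod_le_one (fun _ _ => norm_nonneg _) fun l _ => ?_
        split_ifs
        · exact ContinuousLinearMap.norm_id_le
        · exact hP
      calc _ ≤ ‖p (m+1)‖ * 1 := mul_le_mul h1 h2 (Finset.prod_nonneg fun _ _ => norm_nonneg _) (norm_nonneg _)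
        _ = _ := mul_one _
    refine (Finset.sum_le_card_nsmul _ _ _ this).trans ?_
    simp
  have hrad : 0 < q.radius := by
    refine lt_of_lt_of_le ?_ (q.le_radius_of_bound (r := ρ/2) (C / ρ * 2) ?_)
    · have : 0 < ρ/2 := by positivity
      exact_mod_cast this
    · intro m
      have h3 : ((m:ℝ)+1) ≤ 2 * 2^m := by
        have : m + 1 ≤ 2 * 2^m := by
          have := (Nat.lt_two_pow_self (n := m)); omega
        exact_mod_cast this
      have h4 := hCb (m+1)
      have hρr : (0:ℝ) < ρ := hρ0'
      calc ‖q m‖ * (↑(ρ/2) : ℝ)^m ≤ ((m+1) * ‖p (m+1)‖) * (ρ/2:ℝ)^m := by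
            push_cast
            gcongr
            exact hq m
        _ ≤ ((2 * 2^m) * ‖p (m+1)‖) * (ρ/2:ℝ)^m := by gcongr
        _ = 2 * (‖p (m+1)‖ * ρ^(m+1)) / ρ := by
            rw [div_pow]; field_simp; ring
        _ ≤ 2 * C / ρ := by gcongr
        _ = C / ρ * 2 := by ring
  have hs := q.hasFPowerSeriesOnBall hrad
  refine ⟨q.sum, hs.analyticAt, ?_⟩
  have hmem : ∀ᶠ x in 𝓝 (0:E), x ∈ Metric.eball (0:E) r :=
    Metric.eball_mem_nhds _ hr.r_pos
  have hmem3 : ∀ᶠ x in 𝓝 (0:E), P x ∈ Metric.eball (0:E) r := by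
    have : Tendsto P (𝓝 0) (𝓝 0) := by simpa using P.continuous.tendsto 0
    exact this.eventually hmem
  have hmem2 : ∀ᶠ x in 𝓝 (0:E), x ∈ Metric.eball (0:E) q.radius :=
    Metric.eball_mem_nhds _ hrad
  filter_upwards [hmem, hmem3, hmem2] with x h1 h3 h2
  have a1 := hr.hasSum h1
  have a3 := hr.hasSum h3
  have a2 := (hs.hasSum h2).mul_left (ℓ x)
  simp only [zero_add] at a1 a2 a3
  have a4 := a1.sub a3
  rw [← hasSum_nat_add_iff' 1] at a4
  have : (fun m => p (m+1) (fun _ => x) - p (m+1) (fun _ => P x)) = fun m => ℓ x * q m (fun _ => x) := by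
    funext m
    rw [telescope_multilinear (p (m+1)) x (P x) e (ℓ x) (hℓ x)]
    simp only [q, divSeries, sum_apply,
      ContinuousMultilinearMap.compContinuousLinearMap_apply, ContinuousMultilinearMap.curryMid_apply]
    congr 2
    funext i
    congr 2
    funext l
    split_ifs <;> rfl
  rw [this] at a4
  have h0 : p 0 (fun _ => x) = p 0 (fun _ => P x) := by
    congr 1; funext l; exact l.elim0
  have := a2.unique a4
  simp [h0] at this
  linarith
end

section
open Filter Topology

theorem germ_div {n : ℕ} (i : Fin n) {f : (Fin n → ℝ) → ℝ} (hf : AnalyticAt ℝ f 0) :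
    ∃ g : (Fin n → ℝ) → ℝ, AnalyticAt ℝ g 0 ∧
      ∀ᶠ x in 𝓝 0, f x = f (Function.update x i 0) + x i * g x := by
  let P : (Fin n → ℝ) →L[ℝ] (Fin n → ℝ) :=
    ContinuousLinearMap.pi fun j => if j = i then 0 else ContinuousLinearMap.proj j
  have hPx : ∀ x, P x = Function.update x i 0 := by
    intro x; funext j
    by_cases h : j = i
    · subst h; simp [P]
    · simp [P, h]
  have := germ_div_aux hf P ?_ (Pi.single i 1) ?_ (fun x => x i) ?_
  · simpa only [hPx] using this
  · refine ContinuousLinearMap.opNorm_le_bound _ zero_le_one fun x => ?_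
    rw [one_mul, pi_norm_le_iff_of_nonneg (norm_nonneg _)]
    intro j
    by_cases h : j = i
    · subst h; simp [hPx]
    · simpa [hPx, h] using norm_le_pi_norm x j
  · rw [pi_norm_le_iff_of_nonneg zero_le_one]
    intro j
    by_cases h : j = i
    · subst h; simp
    · simp [h]
  · intro x; funext j
    by_cases h : j = i
    · subst h; simp [hPx]
    · simp [hPx, h]

theorem an_coord {n : ℕ} (i : Fin n) (p : Fin n → ℝ) : AnalyticAt ℝ (fun x : Fin n → ℝ => x i) p :=
  (ContinuousLinearMap.proj (R := ℝ) (φ := fun _ : Fin n => ℝ) i).analyticAt p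

theorem an_update {n : ℕ} (i : Fin n) {p : Fin n → ℝ} {u : (Fin n → ℝ) → ℝ}
    (hu : AnalyticAt ℝ u p) : AnalyticAt ℝ (fun x => Function.update x i (u x)) p := by
  rw [analyticAt_pi_iff]
  intro j
  by_cases h : j = i
  · subst h; simpa using hu
  · simpa [h] using an_coord j p

def mono {n : ℕ} (a : Fin n → ℕ) (x : Fin n → ℝ) : ℝ := ∏ i, x i ^ a i

theorem an_mono {n : ℕ} (a : Fin n → ℕ) (p : Fin n → ℝ) : AnalyticAt ℝ (mono a) p := by
  have := Finset.univ.analyticAt_fun_prod (f := fun i (x : Fin n → ℝ) => x i ^ a i) (c := p)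
    (𝕜 := ℝ) (fun i _ => (an_coord i p).pow _)
  exact this

theorem mono_add {n : ℕ} (a b : Fin n → ℕ) (x : Fin n → ℝ) : mono (a + b) x = mono a x * mono b x := by
  simp [mono, pow_add, Finset.prod_mul_distrib]

theorem mono_zero {n : ℕ} (x : Fin n → ℝ) : mono 0 x = 1 := by simp [mono]

theorem mono_smul {n : ℕ} (k : ℕ) (a : Fin n → ℕ) (x : Fin n → ℝ) : mono (k • a) x = mono a x ^ k := by
  simp [mono, pow_mul', Finset.prod_pow]

theorem mono_single {n : ℕ} (i : Fin n) (k : ℕ) (x : Fin n → ℝ) : mono (Pi.single i k) x = x i ^ k := by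
  rw [mono, Finset.prod_eq_single i]
  · simp
  · intro b _ hb; simp [hb]
  · simp

theorem mono_ne {n : ℕ} (a : Fin n → ℕ) (x : Fin n → ℝ) (h : ∀ i, a i ≠ 0 → x i ≠ 0) : mono a x ≠ 0 := by
  rw [mono, Finset.prod_ne_zero_iff]
  intro i _
  by_cases ha : a i = 0
  · simp [ha]
  · exact pow_ne_zero _ (h i ha)

theorem mono_eq_zero {n : ℕ} (a : Fin n → ℕ) (x : Fin n → ℝ) (i : Fin n) (ha : a i ≠ 0) (hx : x i = 0) :
    mono a x = 0 := by
  rw [mono]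
  exact Finset.prod_eq_zero (Finset.mem_univ i) (by simp [hx, ha])

def NC {n : ℕ} (F : (Fin n → ℝ) → ℝ) : Prop :=
  ∃ (a : Fin n → ℕ) (u : (Fin n → ℝ) → ℝ), AnalyticAt ℝ u 0 ∧ u 0 ≠ 0 ∧
    F =ᶠ[𝓝 0] fun x => mono a x * u x

variable {n : ℕ}

theorem NC.congr {F G : (Fin n → ℝ) → ℝ} (h : NC F) (e : G =ᶠ[𝓝 0] F) : NC G := by
  obtain ⟨a, u, hu, h0, h⟩ := h
  exact ⟨a, u, hu, h0, e.trans h⟩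

theorem NC.analytic {F : (Fin n → ℝ) → ℝ} (h : NC F) : AnalyticAt ℝ F 0 := by
  obtain ⟨a, u, hu, h0, h⟩ := h
  exact ((an_mono a 0).mul hu).congr h.symm

theorem NC.mul {F G : (Fin n → ℝ) → ℝ} (hF : NC F) (hG : NC G) : NC (fun x => F x * G x) := by
  obtain ⟨a, u, hu, h0, h⟩ := hF
  obtain ⟨b, v, hv, k0, k⟩ := hG
  refine ⟨a + b, fun x => u x * v x, hu.mul hv, mul_ne_zero h0 k0, ?_⟩
  filter_upwards [h, k] with x h k
  rw [h, k, mono_add]; ring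

theorem NC.unit {F : (Fin n → ℝ) → ℝ} (hF : AnalyticAt ℝ F 0) (h : F 0 ≠ 0) : NC F :=
  ⟨0, F, hF, h, by simp only [mono_zero, one_mul]; rfl⟩

theorem NC.ofmono (a : Fin n → ℕ) : NC (mono a) :=
  ⟨a, fun _ => 1, analyticAt_const, one_ne_zero, by simp only [mul_one]; rfl⟩

theorem NC.coord (i : Fin n) : NC (fun x : Fin n → ℝ => x i) := by
  have := NC.ofmono (Pi.single i 1)
  refine this.congr (Eventually.of_forall fun x => ?_)
  simp [mono_single]

theorem NC.pow {F : (Fin n → ℝ) → ℝ} (hF : NC F) (k : ℕ) : NC (fun x => F x ^ k) := by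
  induction k with
  | zero => simpa using NC.unit (analyticAt_const (v := (1:ℝ))) one_ne_zero
  | succ k ih => simpa only [pow_succ] using ih.mul hF

theorem tendsto_pt (Z : Set (Fin n)) [DecidablePred (· ∈ Z)] :
    Tendsto (fun (t : ℝ) (i : Fin n) => if i ∈ Z then 0 else t) (𝓝[>] 0) (𝓝 0) := by
  rw [tendsto_pi_nhds]
  intro i
  by_cases h : i ∈ Z
  · simp [h]
  · simpa [h] using (tendsto_nhdsWithin_of_tendsto_nhds tendsto_id : Tendsto (fun i : ℝ => i) (𝓝[>] (0:ℝ)) (𝓝 0))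

/-- points on coordinate subspaces near the origin -/
theorem exists_pt (Z : Set (Fin n)) {p : (Fin n → ℝ) → Prop} (h : ∀ᶠ x in 𝓝 0, p x) :
    ∃ x, p x ∧ (∀ i ∈ Z, x i = 0) ∧ (∀ i ∉ Z, 0 < x i) := by
  classical
  have h1 := (tendsto_pt Z).eventually h
  obtain ⟨t, ht, ht0⟩ := (h1.and self_mem_nhdsWithin).exists
  exact ⟨_, ht, fun i hi => by simp [hi], fun i hi => by simpa [hi] using ht0⟩

theorem NC.ne {F : (Fin n → ℝ) → ℝ} (hF : NC F) : ¬ F =ᶠ[𝓝 0] 0 := by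
  intro hz
  obtain ⟨a, u, hu, h0, h⟩ := hF
  obtain ⟨x, ⟨⟨h1, h2⟩, h3⟩, -, h4⟩ := exists_pt (∅ : Set (Fin n)) ((hz.and h).and (hu.continuousAt.eventually_ne h0))
  rw [h2] at h1
  exact mul_ne_zero (mono_ne a x fun i _ => (h4 i (by simp)).ne') h3 h1

theorem tendsto_upd0 (i : Fin n) :
    Tendsto (fun x : Fin n → ℝ => Function.update x i 0) (𝓝 0) (𝓝 0) := by
  have : Continuous (fun x : Fin n → ℝ => Function.update x i 0) := by fun_prop
  simpa using this.tendsto 0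

theorem coord_ne (i : Fin n) : ¬ (fun x : Fin n → ℝ => x i) =ᶠ[𝓝 0] 0 := (NC.coord i).ne

theorem germ_cancel {X A B : (Fin n → ℝ) → ℝ} (hX : AnalyticAt ℝ X 0) (hA : AnalyticAt ℝ A 0)
    (hB : AnalyticAt ℝ B 0) (hX0 : ¬ X =ᶠ[𝓝 0] 0) (h : ∀ᶠ x in 𝓝 0, X x * A x = X x * B x) :
    A =ᶠ[𝓝 0] B := by
  rcases germ_domain (g := fun x => A x - B x) hX (hA.sub hB) (by
    filter_upwards [h] with x hx; rw [mul_sub, hx, sub_self]) with h1 | h1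
  · exact absurd h1 hX0
  · filter_upwards [h1] with x hx
    simpa [sub_eq_zero] using hx

theorem NC.factor {L H F : (Fin n → ℝ) → ℝ} (hL : AnalyticAt ℝ L 0) (hH : AnalyticAt ℝ H 0)
    (hF : NC F) (h : ∀ᶠ x in 𝓝 0, L x * H x = F x) : NC L := by
  obtain ⟨a, u, hu, h0, hF⟩ := hF
  have h' : ∀ᶠ x in 𝓝 0, L x * H x = mono a x * u x := by
    filter_upwards [h, hF] with x h1 h2; rw [h1, h2]
  clear h hF F
  induction hk : ∑ i, a i generalizing a L H with
  | zero =>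
    have ha : a = 0 := by
      funext i
      exact (Finset.sum_eq_zero_iff.1 hk) i (Finset.mem_univ i)
    subst ha
    have := h'.self_of_nhds
    rw [mono_zero, one_mul] at this
    exact NC.unit hL (fun h => h0 (by rw [← this, h, zero_mul]))
  | succ k ih =>
    obtain ⟨i, hi⟩ : ∃ i, a i ≠ 0 := by
      by_contra hc
      push Not at hc
      simp [hc] at hk
    obtain ⟨b, rfl⟩ : ∃ b : Fin n → ℕ, a = b + Pi.single i 1 := by
      refine ⟨a - Pi.single i 1, ?_⟩
      funext j
      by_cases hj : j = i
      · subst hj; simp; omega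
      · simp [hj]
    have hb : ∑ j, b j = k := by
      have : ∑ j, (b + Pi.single i 1 : Fin n → ℕ) j = ∑ j, b j + 1 := by
        simp [Finset.sum_add_distrib]
      omega
    have hz : ∀ᶠ x in 𝓝 (0 : Fin n → ℝ), L (Function.update x i 0) * H (Function.update x i 0) = 0 := by
      filter_upwards [(tendsto_upd0 i).eventually h'] with x hx
      rw [hx, mono_eq_zero _ _ i (by simpa using hi) (by simp), zero_mul]
    have anu : AnalyticAt ℝ (fun x : Fin n → ℝ => Function.update x i 0) 0 :=
      an_update i analyticAt_const
    have hu0 : Function.update (0 : Fin n → ℝ) i 0 = 0 := by simp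
    have key := germ_domain (f := fun x => L (Function.update x i 0))
      (g := fun x => H (Function.update x i 0)) (x := 0)
      (AnalyticAt.fun_comp (by rw [hu0]; exact hL) anu) (AnalyticAt.fun_comp (by rw [hu0]; exact hH) anu) hz
    rcases key with key | key
    · obtain ⟨L1, hL1, e⟩ := germ_div i hL
      have e' : L =ᶠ[𝓝 0] fun x => x i * L1 x := by
        filter_upwards [e, key] with x h1 h2
        rw [h1]
        simp only [Pi.zero_apply] at h2
        rw [h2, zero_add]
      have : NC L1 := by
        refine ih hL1 hH b ?_ hb
        refine germ_cancel (an_coord i 0) (hL1.mul hH) ((an_mono b 0).mul hu) (coord_ne i) ?_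
        filter_upwards [e', h'] with x h1 h2
        rw [h1, mono_add, mono_single] at h2
        linarith
      exact ((NC.coord i).mul this).congr e'
    · obtain ⟨H1, hH1, e⟩ := germ_div i hH
      have e' : H =ᶠ[𝓝 0] fun x => x i * H1 x := by
        filter_upwards [e, key] with x h1 h2
        rw [h1]
        simp only [Pi.zero_apply] at h2
        rw [h2, zero_add]
      refine ih hL hH1 b ?_ hb
      refine germ_cancel (an_coord i 0) (hL.mul hH1) ((an_mono b 0).mul hu) (coord_ne i) ?_
      filter_upwards [e', h'] with x h1 h2
      rw [h1, mono_add, mono_single] at h2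
      linarith

/-- `L` divides a power of `F` -/
def Dv (F L : (Fin n → ℝ) → ℝ) : Prop :=
  AnalyticAt ℝ L 0 ∧ ∃ (k : ℕ) (H : (Fin n → ℝ) → ℝ), AnalyticAt ℝ H 0 ∧ ∀ᶠ x in 𝓝 0, L x * H x = F x ^ k

theorem Dv.nc {F L : (Fin n → ℝ) → ℝ} (h : Dv F L) (hF : NC F) : NC L := by
  obtain ⟨hL, k, H, hH, e⟩ := h
  exact NC.factor hL hH (hF.pow k) e

theorem Dv.comp {F L X : (Fin n → ℝ) → ℝ} {Ψ : (Fin n → ℝ) → (Fin n → ℝ)} (h : Dv F L)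
    (hF : AnalyticAt ℝ F 0)
    (hX : AnalyticAt ℝ X 0) (hΨ : AnalyticAt ℝ Ψ 0) (h0 : Ψ 0 = 0) (m : ℕ) :
    Dv (fun x => X x * F (Ψ x)) (fun x => X x ^ m * L (Ψ x)) := by
  obtain ⟨hL, k, H, hH, e⟩ := h
  have c : ∀ {G : (Fin n → ℝ) → ℝ}, AnalyticAt ℝ G 0 → AnalyticAt ℝ (fun x => G (Ψ x)) 0 := fun hG =>
    AnalyticAt.fun_comp (by rw [h0]; exact hG) hΨ
  refine ⟨(hX.pow m).mul (c hL), k + m, fun x => X x ^ k * H (Ψ x) * F (Ψ x) ^ m,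
    ((hX.pow k).mul (c hH)).mul ((c hF).pow m), ?_⟩
  have : Tendsto Ψ (𝓝 0) (𝓝 0) := by simpa [h0] using hΨ.continuousAt.tendsto
  filter_upwards [this.eventually e] with x hx
  rw [mul_pow, pow_add (F (Ψ x)), ← hx, pow_add]; ring

theorem Dv.of_mul {F L H : (Fin n → ℝ) → ℝ} (hL : AnalyticAt ℝ L 0) (hH : AnalyticAt ℝ H 0)
    (e : ∀ x, L x * H x = F x) : Dv F L :=
  ⟨hL, 1, H, hH, Eventually.of_forall fun x => by simp [e]⟩

def bl (i j : Fin n) (t : ℝ) (x : Fin n → ℝ) : Fin n → ℝ := Function.update x i ((x i + t) * x j)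
def pw (i : Fin n) (ε : ℝ) (k : ℕ) (x : Fin n → ℝ) : Fin n → ℝ := Function.update x i (ε * x i ^ k)
def sh (i : Fin n) (c : (Fin n → ℝ) → ℝ) (x : Fin n → ℝ) : Fin n → ℝ := Function.update x i (x i + c x)

theorem bl_zero (i j : Fin n) (t : ℝ) : bl i j t 0 = 0 := by simp [bl]
theorem pw_zero (i : Fin n) (ε : ℝ) (k : ℕ) (hk : 0 < k) : pw i ε k 0 = 0 := by simp [pw, hk.ne']
theorem sh_zero (i : Fin n) (c : (Fin n → ℝ) → ℝ) (hc : c 0 = 0) : sh i c 0 = 0 := by simp [sh, hc]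
theorem an_bl (i j : Fin n) (t : ℝ) (p) : AnalyticAt ℝ (bl i j t) p :=
  an_update i (((an_coord i p).add analyticAt_const).mul (an_coord j p))
theorem an_pw (i : Fin n) (ε : ℝ) (k : ℕ) (p) : AnalyticAt ℝ (pw i ε k) p :=
  an_update i (analyticAt_const.mul ((an_coord i p).pow k))
theorem an_sh (i : Fin n) {c : (Fin n → ℝ) → ℝ} {p} (hc : AnalyticAt ℝ c p) : AnalyticAt ℝ (sh i c) p :=
  an_update i ((an_coord i p).add hc)

theorem tendsto_zero_of_an {m k : ℕ} {Ψ : (Fin m → ℝ) → (Fin k → ℝ)} (h : AnalyticAt ℝ Ψ 0) (h0 : Ψ 0 = 0) :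
    Tendsto Ψ (𝓝 0) (𝓝 0) := by simpa [h0] using h.continuousAt.tendsto

theorem an_comp0 {m k : ℕ} {Ψ : (Fin m → ℝ) → (Fin k → ℝ)} {G : (Fin k → ℝ) → ℝ}
    (hG : AnalyticAt ℝ G 0) (h : AnalyticAt ℝ Ψ 0) (h0 : Ψ 0 = 0) :
    AnalyticAt ℝ (fun x => G (Ψ x)) 0 := AnalyticAt.fun_comp (by rw [h0]; exact hG) h

inductive Mon : ((Fin n → ℝ) → ℝ) → Prop
  | nc (F : (Fin n → ℝ) → ℝ) (h : NC F) : Mon F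
  | blow (F : (Fin n → ℝ) → ℝ) (i j : Fin n) (hij : i ≠ j)
      (h1 : ∀ t, Mon (fun x => x j * F (bl i j t x)))
      (h2 : Mon (fun x => x i * F (bl j i 0 x))) : Mon F
  | pow (F : (Fin n → ℝ) → ℝ) (i : Fin n) (k : ℕ) (hk : 0 < k)
      (h1 : Mon (fun x => x i * F (pw i 1 (2 * k) x)))
      (h2 : Mon (fun x => x i * F (pw i (-1) (2 * k) x))) : Mon F
  | shear (F : (Fin n → ℝ) → ℝ) (i : Fin n) (c : (Fin n → ℝ) → ℝ) (hc : AnalyticAt ℝ c 0)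
      (hc0 : c 0 = 0) (hci : ∀ x v, c (Function.update x i v) = c x)
      (h : Mon (fun x => F (sh i c x))) : Mon F

theorem Mon.congr {F G : (Fin n → ℝ) → ℝ} (h : Mon F) (e : G =ᶠ[𝓝 0] F) : Mon G := by
  induction h generalizing G with
  | nc F h => exact .nc _ (h.congr e)
  | blow F i j hij h1 h2 ih1 ih2 =>
    refine .blow G i j hij (fun t => ih1 t ?_) (ih2 ?_)
    · filter_upwards [(tendsto_zero_of_an (an_bl i j t 0) (bl_zero i j t)).eventually e] with x hx
      rw [hx]
    · filter_upwards [(tendsto_zero_of_an (an_bl j i 0 0) (bl_zero j i 0)).eventually e] with x hx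
      rw [hx]
  | pow F i k hk h1 h2 ih1 ih2 =>
    refine .pow G i k hk (ih1 ?_) (ih2 ?_)
    · filter_upwards [(tendsto_zero_of_an (an_pw i 1 (2*k) 0) (pw_zero i 1 (2*k) (by omega))).eventually e] with x hx
      rw [hx]
    · filter_upwards [(tendsto_zero_of_an (an_pw i (-1) (2*k) 0) (pw_zero i (-1) (2*k) (by omega))).eventually e] with x hx
      rw [hx]
  | shear F i c hc hc0 hci h ih =>
    refine .shear G i c hc hc0 hci (ih ?_)
    filter_upwards [(tendsto_zero_of_an (an_sh i hc) (sh_zero i c hc0)).eventually e] with x hx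
    rw [hx]

/-- comparability of exponents -/
theorem NC.comparable {A B : (Fin n → ℝ) → ℝ} {a b : Fin n → ℕ} {u v : (Fin n → ℝ) → ℝ}
    (hu : AnalyticAt ℝ u 0) (hu0 : u 0 ≠ 0) (hv : AnalyticAt ℝ v 0) (hv0 : v 0 ≠ 0)
    (hA : A =ᶠ[𝓝 0] fun x => mono a x * u x) (hB : B =ᶠ[𝓝 0] fun x => mono b x * v x)
    (h : (fun x => A x - B x) =ᶠ[𝓝 0] 0 ∨ NC (fun x => A x - B x)) : a ≤ b ∨ b ≤ a := by
  by_contra hcon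
  push Not at hcon
  obtain ⟨h1, h2⟩ := hcon
  simp only [Pi.le_def, not_forall, not_le] at h1 h2
  obtain ⟨i, hi⟩ := h1
  obtain ⟨j, hj⟩ := h2
  set m : Fin n → ℕ := fun k => min (a k) (b k)
  set a' : Fin n → ℕ := fun k => a k - m k
  set b' : Fin n → ℕ := fun k => b k - m k
  have ea : a = m + a' := by funext k; simp [a', m]
  have eb : b = m + b' := by funext k; simp [b', m]
  have hai : a' i ≠ 0 := by simp only [a', m]; omega
  have hbi : b' i = 0 := by simp only [b', m]; omega
  have hbj : b' j ≠ 0 := by simp only [b', m]; omega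
  have haj : a' j = 0 := by simp only [a', m]; omega
  have dis : ∀ k, b' k ≠ 0 → a' k = 0 := by intro k; simp only [a', b', m]; omega
  set R : (Fin n → ℝ) → ℝ := fun x => mono a' x * u x - mono b' x * v x with hR
  have anR : AnalyticAt ℝ R 0 := ((an_mono a' 0).mul hu).sub ((an_mono b' 0).mul hv)
  have eR : ∀ᶠ x in 𝓝 0, R x * mono m x = A x - B x := by
    filter_upwards [hA, hB] with x h1 h2
    rw [h1, h2, ea, eb, mono_add, mono_add, hR]; ring
  have une := hu.continuousAt.eventually_ne hu0
  have vne := hv.continuousAt.eventually_ne hv0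
  have contra1 : ∀ Z : Set (Fin n), i ∈ Z → (∀ k ∈ Z, b' k = 0) → (∃ᶠ x in 𝓝 (0 : Fin n → ℝ), ∀ k ∈ Z, x k = 0) → 
      (∀ᶠ x in 𝓝 (0 : Fin n → ℝ), (∀ k ∈ Z, x k = 0) → R x = 0) → False := by
    intro Z hiZ hbZ _ hz
    obtain ⟨x, ⟨hx, hx2⟩, hZ, hnZ⟩ := exists_pt Z (hz.and vne)
    have := hx hZ
    rw [hR] at this
    simp only [mono_eq_zero a' x i hai (hZ i hiZ), zero_mul, zero_sub, neg_eq_zero] at this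
    refine mul_ne_zero (mono_ne b' x fun k hk => ?_) hx2 this
    exact (hnZ k (fun hkZ => hk (hbZ k hkZ))).ne'
  have contra2 : ∀ Z : Set (Fin n), j ∈ Z → (∀ k ∈ Z, a' k = 0) →
      (∀ᶠ x in 𝓝 (0 : Fin n → ℝ), (∀ k ∈ Z, x k = 0) → R x = 0) → False := by
    intro Z hiZ hbZ hz
    obtain ⟨x, ⟨hx, hx2⟩, hZ, hnZ⟩ := exists_pt Z (hz.and une)
    have := hx hZ
    rw [hR] at this
    simp only [mono_eq_zero b' x j hbj (hZ j hiZ), zero_mul, sub_zero] at this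
    refine mul_ne_zero (mono_ne a' x fun k hk => ?_) hx2 this
    exact (hnZ k (fun hkZ => hk (hbZ k hkZ))).ne'
  have fr : ∀ Z : Set (Fin n), ∃ᶠ x in 𝓝 (0 : Fin n → ℝ), ∀ k ∈ Z, x k = 0 := fun Z =>
    frequently_iff.2 fun {U} hU => ⟨0, mem_of_mem_nhds hU, fun _ _ => rfl⟩
  rcases h with h | h
  · have : R =ᶠ[𝓝 0] 0 := by
      refine germ_cancel (an_mono m 0) anR analyticAt_const (NC.ofmono m).ne ?_
      filter_upwards [eR, h] with x h1 h2
      simp only [Pi.zero_apply] at h2 ⊢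
      rw [mul_zero, mul_comm, h1, h2]
    refine contra1 {i} rfl (by simpa using hbi) (fr _) ?_
    filter_upwards [this] with x hx _ using hx
  · have hNC : NC R := NC.factor anR (an_mono m 0) h eR
    obtain ⟨c, w, hw, hw0, e⟩ := hNC
    obtain ⟨l, hl⟩ : ∃ l, c l ≠ 0 := by
      by_contra hc
      push Not at hc
      have hc : c = 0 := funext hc
      have := e.self_of_nhds
      simp only [hc, mono_zero, one_mul, hR, mono_eq_zero a' 0 i hai rfl, mono_eq_zero b' 0 j hbj rfl] at this
      simp at this
      exact hw0 this.symm
    have hz : ∀ᶠ x in 𝓝 (0 : Fin n → ℝ), x l = 0 → R x = 0 := by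
      filter_upwards [e] with x hx hxl
      rw [hx, mono_eq_zero c x l hl hxl, zero_mul]
    by_cases hbl : b' l = 0
    · refine contra1 {l, i} (by simp) (by rintro k (rfl | rfl) <;> assumption) (fr _) ?_
      filter_upwards [hz] with x hx h using hx (h l (by simp))
    · refine contra2 {l, j} (by simp) (by rintro k (rfl | rfl); exacts [dis _ hbl, haj]) ?_
      filter_upwards [hz] with x hx h using hx (h l (by simp))
end

section
open Filter Topology

theorem taylor1 {g V : ℝ → ℝ} {d : ℕ} {a : ℕ → ℝ} (hV : AnalyticAt ℝ V 0)
    (e : g =ᶠ[𝓝 0] fun y => ∑ j ∈ Finset.range d, a j * y ^ j + y ^ d * V y) {k : ℕ} (hk : k < d) :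
    iteratedDeriv k g 0 = k.factorial * a k := by
  rw [e.iteratedDeriv_eq k]
  have h1 : AnalyticAt ℝ (fun y : ℝ => ∑ j ∈ Finset.range d, a j * y ^ j) 0 := by
    refine Finset.analyticAt_fun_sum _ fun i hi ↦ ?_
    fun_prop
  have h2 : AnalyticAt ℝ (fun y : ℝ => y ^ d * V y) 0 := by fun_prop
  rw [iteratedDeriv_fun_add h1.contDiffAt h2.contDiffAt]
  have h3 : iteratedDeriv k (fun y : ℝ => y ^ d * V y) 0 = 0 := by
    refine (natCast_le_analyticOrderAt_iff_iteratedDeriv_eq_zero h2).1 ?_ k hk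
    rw [natCast_le_analyticOrderAt h2]
    exact ⟨V, hV, Eventually.of_forall fun z => by simp⟩
  rw [h3, add_zero]
  rw [iteratedDeriv_fun_sum (fun i _ => AnalyticAt.contDiffAt (by fun_prop))]
  rw [Finset.sum_eq_single k]
  · have hp : ContDiffAt ℝ k (fun y : ℝ => y ^ k) 0 := by fun_prop
    rw [iteratedDeriv_const_mul (a k) hp, iteratedDeriv_fun_pow_zero]; simp [mul_comm]
  · intro b _ hb
    have hp : ContDiffAt ℝ k (fun y : ℝ => y ^ b) 0 := by fun_prop
    rw [iteratedDeriv_const_mul (a b) hp, iteratedDeriv_fun_pow_zero]; simp [hb.symm]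
  · intro h; exact absurd (Finset.mem_range.2 hk) h

theorem taylor1_top {g V : ℝ → ℝ} {d : ℕ} {a : ℕ → ℝ} (hV : AnalyticAt ℝ V 0)
    (e : g =ᶠ[𝓝 0] fun y => ∑ j ∈ Finset.range d, a j * y ^ j + y ^ d * V y) :
    iteratedDeriv d g 0 = d.factorial * V 0 := by
  obtain ⟨W, hW, e2⟩ := hV.exists_eventuallyEq_sum_add_pow_mul 1
  have := taylor1 (g := g) (d := d + 1) (a := fun j => if j = d then V 0 else a j) (V := W) hW ?_ (Nat.lt_succ_self d)
  · simpa using this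
  · filter_upwards [e, e2] with y h1 h2
    rw [h1, Finset.sum_range_succ]
    simp only [Finset.range_one, Finset.sum_singleton] at h2
    rw [h2]
    have : ∑ j ∈ Finset.range d, (if j = d then V 0 else a j) * y ^ j = ∑ j ∈ Finset.range d, a j * y ^ j :=
      Finset.sum_congr rfl fun j hj => by rw [if_neg (Finset.mem_range.1 hj).ne]
    rw [this]
    simp
    ring

variable {n : ℕ}

def DD (G : (Fin (n+1) → ℝ) → ℝ) (x : Fin (n+1) → ℝ) : ℝ := lineDeriv ℝ G x (Pi.single 0 1)

theorem cons_add (y t : ℝ) (x : Fin n → ℝ) :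
    (Fin.cons y x : Fin (n+1) → ℝ) + t • (Pi.single 0 1) = Fin.cons (y + t) x := by
  funext i
  refine Fin.cases ?_ (fun i => ?_) i <;> simp

theorem DD_cons (G : (Fin (n+1) → ℝ) → ℝ) (y : ℝ) (x : Fin n → ℝ) :
    DD G (Fin.cons y x) = deriv (fun y => G (Fin.cons y x)) y := by
  rw [DD, lineDeriv]
  simp only [cons_add]
  have := deriv_comp_const_add (f := fun y => G (Fin.cons y x)) y 0
  simpa using this

theorem DD_iter_cons (G : (Fin (n+1) → ℝ) → ℝ) (k : ℕ) (y : ℝ) (x : Fin n → ℝ) :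
    DD^[k] G (Fin.cons y x) = iteratedDeriv k (fun y => G (Fin.cons y x)) y := by
  induction k generalizing y with
  | zero => simp
  | succ k ih =>
    rw [Function.iterate_succ_apply', DD_cons, iteratedDeriv_succ]
    simp only [ih]

theorem an_DD {G : (Fin (n+1) → ℝ) → ℝ} (hG : AnalyticAt ℝ G 0) : AnalyticAt ℝ (DD G) 0 := by
  have h1 : AnalyticAt ℝ (fun x => fderiv ℝ G x (Pi.single 0 1)) 0 :=
    (ContinuousLinearMap.analyticAt ((ContinuousLinearMap.apply ℝ ℝ (Pi.single 0 1 : Fin (n+1) → ℝ))) _).comp hG.fderiv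
  refine h1.congr ?_
  filter_upwards [hG.eventually_analyticAt] with x hx
  rw [DD, hx.differentiableAt.lineDeriv_eq_fderiv]

theorem an_DD_iter {G : (Fin (n+1) → ℝ) → ℝ} (hG : AnalyticAt ℝ G 0) (k : ℕ) : AnalyticAt ℝ (DD^[k] G) 0 := by
  induction k with
  | zero => exact hG
  | succ k ih => rw [Function.iterate_succ_apply']; exact an_DD ih

theorem sh_cons (c : (Fin n → ℝ) → ℝ) (y : ℝ) (x : Fin n → ℝ) :
    sh 0 (fun z => c (Fin.tail z)) (Fin.cons y x : Fin (n+1) → ℝ) = Fin.cons (y + c x) x := by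
  simp [sh, Fin.update_cons_zero]

theorem DD_sh (G : (Fin (n+1) → ℝ) → ℝ) (c : (Fin n → ℝ) → ℝ) (k : ℕ) (y : ℝ) (x : Fin n → ℝ) :
    DD^[k] (fun z => G (sh 0 (fun z => c (Fin.tail z)) z)) (Fin.cons y x) = DD^[k] G (Fin.cons (y + c x) x) := by
  rw [DD_iter_cons, DD_iter_cons]
  simp only [sh_cons]
  have := iteratedDeriv_comp_add_const k (fun y => G (Fin.cons y x)) (c x) 
  exact congrFun this y

theorem an_tail (p : Fin (n+1) → ℝ) : AnalyticAt ℝ (fun x : Fin (n+1) → ℝ => (Fin.tail x : Fin n → ℝ)) p := by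
  rw [analyticAt_pi_iff]
  intro i
  exact an_coord i.succ p

theorem tail_zero : (Fin.tail (0 : Fin (n+1) → ℝ) : Fin n → ℝ) = 0 := rfl

theorem an_cons {y : (Fin n → ℝ) → ℝ} {p} (h : AnalyticAt ℝ y p) :
    AnalyticAt ℝ (fun x : Fin n → ℝ => (Fin.cons (y x) x : Fin (n+1) → ℝ)) p := by
  rw [analyticAt_pi_iff]
  intro i
  refine Fin.cases ?_ (fun i => ?_) i
  · simpa using h
  · simpa using an_coord i p

theorem cons_zero_zero : (Fin.cons 0 0 : Fin (n+1) → ℝ) = 0 := by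
  funext i
  refine Fin.cases ?_ (fun i => ?_) i <;> simp

theorem ift {E : (Fin (n+1) → ℝ) → ℝ} (hE : AnalyticAt ℝ E 0) (h0 : E 0 = 0) (h1 : DD E 0 ≠ 0) :
    ∃ c : (Fin n → ℝ) → ℝ, AnalyticAt ℝ c 0 ∧ c 0 = 0 ∧ ∀ᶠ x in 𝓝 0, E (Fin.cons (c x) x) = 0 := by
  let Φ : (Fin n → ℝ) × ℝ → (Fin (n+1) → ℝ) := fun p => Fin.cons p.2 p.1
  have hΦ : AnalyticAt ℝ Φ 0 := by
    rw [analyticAt_pi_iff]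
    intro i
    refine Fin.cases ?_ (fun i => ?_) i
    · exact analyticAt_snd
    · exact ((ContinuousLinearMap.proj (R := ℝ) (φ := fun _ : Fin n => ℝ) i).analyticAt _).comp analyticAt_fst
  have hΦ0 : Φ 0 = 0 := cons_zero_zero
  have hf : AnalyticAt ℝ (fun p => E (Φ p)) 0 := AnalyticAt.fun_comp (by rw [hΦ0]; exact hE) hΦ
  have cdf : ContDiffAt ℝ (⊤ : WithTop ℕ∞) (fun p => E (Φ p)) 0 := hf.contDiffAt
  have hd : (fderiv ℝ (fun p => E (Φ p)) 0) (0, 1) = DD E 0 := by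
    rw [← hf.differentiableAt.lineDeriv_eq_fderiv, ← cons_zero_zero, DD_cons, lineDeriv]
    simp [Φ]
  have inv : (fderiv ℝ (fun p => E (Φ p)) 0 ∘L .inr ℝ (Fin n → ℝ) ℝ).IsInvertible := by
    refine ⟨ContinuousLinearEquiv.unitsEquivAut ℝ (Units.mk0 _ h1), ?_⟩
    ext
    simp [hd]
  refine ⟨cdf.implicitFunction (by simp) inv, ?_, ?_, ?_⟩
  · exact (cdf.contDiffAt_implicitFunction (by simp) inv).analyticAt
  · exact cdf.implicitFunction_apply_self (by simp) inv
  · have := cdf.eventually_apply_implicitFunction (by simp) inv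
    simp only [hΦ0, h0] at this
    exact this

theorem expand {G : (Fin (n+1) → ℝ) → ℝ} (hG : AnalyticAt ℝ G 0) (d : ℕ) :
    ∃ (c : ℕ → (Fin n → ℝ) → ℝ) (U : (Fin (n+1) → ℝ) → ℝ), (∀ j, AnalyticAt ℝ (c j) 0) ∧ AnalyticAt ℝ U 0 ∧
      G =ᶠ[𝓝 0] fun x => ∑ j ∈ Finset.range d, c j (Fin.tail x) * x 0 ^ j + x 0 ^ d * U x := by
  induction d with
  | zero => exact ⟨fun _ _ => 0, G, fun _ => analyticAt_const, hG, by simp⟩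
  | succ d ih =>
    obtain ⟨c, U, hc, hU, e⟩ := ih
    obtain ⟨V, hV, e2⟩ := germ_div 0 hU
    refine ⟨fun j => if j = d then fun x => U (Fin.cons 0 x) else c j, V, fun j => ?_, hV, ?_⟩
    · by_cases h : j = d
      · simp only [h, if_true]
        exact an_comp0 hU (an_cons analyticAt_const) cons_zero_zero
      · simp only [h, if_false]; exact hc j
    · filter_upwards [e, e2] with x h1 h2
      rw [h1, h2, Finset.sum_range_succ]
      have : ∑ j ∈ Finset.range d, (if j = d then fun x => U (Fin.cons 0 x) else c j) (Fin.tail x) * x 0 ^ j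
        = ∑ j ∈ Finset.range d, c j (Fin.tail x) * x 0 ^ j :=
        Finset.sum_congr rfl fun j hj => by rw [if_neg (Finset.mem_range.1 hj).ne]
      rw [this]
      have : Function.update x 0 0 = Fin.cons 0 (Fin.tail x) := by
        conv_lhs => rw [← Fin.cons_self_tail x]
        rw [Fin.update_cons_zero]
      rw [this]
      simp only [if_true]
      ring

theorem tendsto_cons_line : Tendsto (fun y : ℝ => (Fin.cons y 0 : Fin (n+1) → ℝ)) (𝓝 0) (𝓝 0) := by
  rw [tendsto_pi_nhds]
  intro i
  refine Fin.cases ?_ (fun i => ?_) i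
  · exact tendsto_id
  · exact tendsto_const_nhds

theorem an_cons_line (x : Fin n → ℝ) (p : ℝ) : AnalyticAt ℝ (fun y : ℝ => (Fin.cons y x : Fin (n+1) → ℝ)) p := by
  rw [analyticAt_pi_iff]
  intro i
  refine Fin.cases ?_ (fun i => ?_) i
  · exact analyticAt_id
  · exact analyticAt_const

theorem expand_coeff {G U : (Fin (n+1) → ℝ) → ℝ} {c : ℕ → (Fin n → ℝ) → ℝ} {d : ℕ} (hU : AnalyticAt ℝ U 0)
    (e : G =ᶠ[𝓝 0] fun x => ∑ j ∈ Finset.range d, c j (Fin.tail x) * x 0 ^ j + x 0 ^ d * U x) :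
    (∀ᶠ x in 𝓝 0, ∀ k < d, DD^[k] G (Fin.cons 0 x) = k.factorial * c k x) ∧ DD^[d] G 0 = d.factorial * U 0 := by
  have key : ∀ᶠ x in 𝓝 (0 : Fin n → ℝ), AnalyticAt ℝ (fun y => U (Fin.cons y x)) 0 ∧
      (fun y => G (Fin.cons y x)) =ᶠ[𝓝 0] fun y => ∑ j ∈ Finset.range d, c j x * y ^ j + y ^ d * U (Fin.cons y x) := by
    have t : Tendsto (fun x : Fin n → ℝ => (Fin.cons 0 x : Fin (n+1) → ℝ)) (𝓝 0) (𝓝 0) :=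
      tendsto_zero_of_an (an_cons analyticAt_const) cons_zero_zero
    filter_upwards [t.eventually hU.eventually_analyticAt, t.eventually e.eventually_nhds] with x h1 h2
    refine ⟨AnalyticAt.fun_comp h1 (an_cons_line x 0), ?_⟩
    have := (an_cons_line x 0).continuousAt.tendsto.eventually h2
    filter_upwards [this] with y hy
    simpa using hy
  constructor
  · filter_upwards [key] with x hx k hk
    rw [DD_iter_cons]
    exact taylor1 hx.1 hx.2 hk
  · have := key.self_of_nhds
    rw [← cons_zero_zero, DD_iter_cons, taylor1_top this.1 this.2]
end

section
open Filter Topology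
variable {n : ℕ}

theorem NC.comp_tail {F : (Fin n → ℝ) → ℝ} (h : NC F) : NC (fun x : Fin (n+1) → ℝ => F (Fin.tail x)) := by
  obtain ⟨a, u, hu, h0, e⟩ := h
  refine ⟨Fin.cons 0 a, fun x => u (Fin.tail x), an_comp0 hu (an_tail 0) tail_zero, h0, ?_⟩
  filter_upwards [(tendsto_zero_of_an (an_tail 0) tail_zero).eventually e] with x hx
  rw [hx]
  simp [mono, Fin.prod_univ_succ, Fin.tail]

theorem mono_pos_zero (a : Fin n → ℕ) (i : Fin n) (h : a i ≠ 0) : mono a 0 = 0 := mono_eq_zero a 0 i h rfl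

theorem mono_upd_mul (a : Fin n → ℕ) (i : Fin n) (z : ℝ) (x : Fin n → ℝ) :
    mono a (Function.update x i (x i * z)) = mono a x * z ^ a i := by
  rw [mono, mono, ← Finset.mul_prod_erase _ _ (Finset.mem_univ i), ← Finset.mul_prod_erase _ _ (Finset.mem_univ i)]
  simp only [Function.update_self, mul_pow]
  rw [Finset.prod_congr rfl (g := fun k => x k ^ a k)]
  · ring
  · intro k hk; rw [Function.update_of_ne (Finset.ne_of_mem_erase hk)]

theorem mono_pw (a : Fin n → ℕ) (i : Fin n) (ε : ℝ) (K : ℕ) (x : Fin n → ℝ) :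
    mono a (pw i ε K x) = ε ^ a i * mono (Function.update a i (K * a i)) x := by
  rw [mono, mono, ← Finset.mul_prod_erase _ _ (Finset.mem_univ i), ← Finset.mul_prod_erase _ _ (Finset.mem_univ i)]
  simp only [pw, Function.update_self, mul_pow]
  rw [Finset.prod_congr rfl (g := fun k => x k ^ Function.update a i (K * a i) k)]
  · ring
  · intro k hk; rw [Function.update_of_ne (Finset.ne_of_mem_erase hk), Function.update_of_ne (Finset.ne_of_mem_erase hk)]

/-- Target -/
def Tg (d : ℕ) (S : Finset ℕ) (M : (Fin n → ℝ) → ℝ) (c : ℕ → (Fin n → ℝ) → ℝ) (U : (Fin (n+1) → ℝ) → ℝ)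
    (x : Fin (n+1) → ℝ) : ℝ := M (Fin.tail x) * (∑ j ∈ S, c j (Fin.tail x) * x 0 ^ j + x 0 ^ d * U x)

def Bd (n d : ℕ) : Prop := ∀ (M : (Fin n → ℝ) → ℝ) (G : (Fin (n+1) → ℝ) → ℝ), AnalyticAt ℝ M 0 → ¬ M =ᶠ[𝓝 0] 0 →
  AnalyticAt ℝ G 0 → DD^[d] G 0 ≠ 0 → Mon (fun x => M (Fin.tail x) * G x)

theorem tail_bl (i j : Fin n) (t : ℝ) (x : Fin (n+1) → ℝ) :
    (Fin.tail (bl i.succ j.succ t x) : Fin n → ℝ) = bl i j t (Fin.tail x) := by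
  simp only [bl, Fin.tail_update_succ]; rfl
theorem tail_pw (i : Fin n) (ε : ℝ) (k : ℕ) (x : Fin (n+1) → ℝ) :
    (Fin.tail (pw i.succ ε k x) : Fin n → ℝ) = pw i ε k (Fin.tail x) := by
  simp only [pw, Fin.tail_update_succ]; rfl
theorem tail_sh (i : Fin n) (c : (Fin n → ℝ) → ℝ) (x : Fin (n+1) → ℝ) :
    (Fin.tail (sh i.succ (fun z => c (Fin.tail z)) x) : Fin n → ℝ) = sh i c (Fin.tail x) := by
  simp only [sh, Fin.tail_update_succ]; rfl
theorem bl_at0 (i : Fin n) (j : Fin (n+1)) (t : ℝ) (x : Fin (n+1) → ℝ) : bl i.succ j t x 0 = x 0 := by simp [bl, Fin.succ_ne_zero, (Fin.succ_ne_zero i).symm]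
theorem pw_at0 (i : Fin n) (ε : ℝ) (k : ℕ) (x : Fin (n+1) → ℝ) : pw i.succ ε k x 0 = x 0 := by simp [pw, (Fin.succ_ne_zero i).symm]
theorem sh_at0 (i : Fin n) (c) (x : Fin (n+1) → ℝ) : sh i.succ c x 0 = x 0 := by simp [sh, (Fin.succ_ne_zero i).symm]

theorem sum_line {d : ℕ} {S : Finset ℕ} (hS : ∀ j ∈ S, j < d) (f g : ℕ → ℝ) :
    ∑ j ∈ S, f j * g j = ∑ j ∈ Finset.range d, (if j ∈ S then f j else 0) * g j := by
  simp only [ite_mul, zero_mul]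
  rw [← Finset.sum_filter]
  refine Finset.sum_congr ?_ fun _ _ => rfl
  ext j
  simp only [Finset.mem_filter, Finset.mem_range]
  exact ⟨fun h => ⟨hS j h, h⟩, fun h => h.2⟩

theorem toric_line {d : ℕ} {S : Finset ℕ} (hS : ∀ j ∈ S, j + 1 < d) (A : ℕ → ℝ) (t U : ℝ) (hd : 0 < d) :
    iteratedDeriv (d - 1) (fun y : ℝ => ∑ j ∈ S, A j * (y + t) ^ j + (y + t) ^ d * U) 0 = d.factorial * t * U := by
  have e := iteratedDeriv_comp_add_const (d - 1) (fun y : ℝ => ∑ j ∈ S, A j * y ^ j + y ^ d * U) t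
  rw [show (fun y : ℝ => ∑ j ∈ S, A j * (y + t) ^ j + (y + t) ^ d * U) = fun z => (fun y : ℝ => ∑ j ∈ S, A j * y ^ j + y ^ d * U) (z + t) from rfl, e]
  simp only [zero_add]
  have c1 : ∀ (a : ℝ) (j : ℕ), ContDiffAt ℝ ((d-1 : ℕ) : WithTop ℕ∞) (fun y : ℝ => a * y ^ j) t := by intros; fun_prop
  have c0 : ∀ (j : ℕ), ContDiffAt ℝ ((d-1 : ℕ) : WithTop ℕ∞) (fun y : ℝ => y ^ j) t := by intros; fun_prop
  have h1 : ContDiffAt ℝ ((d-1 : ℕ) : WithTop ℕ∞) (fun y : ℝ => ∑ j ∈ S, A j * y ^ j) t :=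
    ContDiffAt.sum fun j _ => c1 _ _
  have h2 : ContDiffAt ℝ ((d-1 : ℕ) : WithTop ℕ∞) (fun y : ℝ => U * y ^ d) t := c1 _ _
  simp only [mul_comm _ U]
  rw [iteratedDeriv_fun_add h1 h2, iteratedDeriv_fun_sum (fun j _ => c1 _ _)]
  rw [iteratedDeriv_const_mul U (c0 d), Finset.sum_eq_zero]
  · have : iteratedDeriv (d-1) (fun y : ℝ => y ^ d) t = d.factorial * t := by
      rw [show (fun y : ℝ => y ^ d) = (fun y => y ^ d) from rfl, iteratedDeriv_pow]
      have h3 : d - (d - 1) = 1 := by omega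
      rw [h3, pow_one]
      have : d.descFactorial (d-1) = d.factorial := by
        rw [Nat.descFactorial_eq_div (by omega), h3]; simp
      rw [this]
    rw [this]; ring
  · intro j hj
    rw [iteratedDeriv_const_mul _ (c0 j), iteratedDeriv_pow]
    rw [Nat.descFactorial_eq_zero_iff_lt.2 (by have := hS j hj; omega)]
    simp

/-- germ of sum-type functions are analytic -/
theorem an_G {d : ℕ} {S : Finset ℕ} {c : ℕ → (Fin n → ℝ) → ℝ} {U : (Fin (n+1) → ℝ) → ℝ}
    (hc : ∀ j ∈ S, AnalyticAt ℝ (c j) 0) (hU : AnalyticAt ℝ U 0) (t : ℝ) :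
    AnalyticAt ℝ (fun x : Fin (n+1) → ℝ => ∑ j ∈ S, c j (Fin.tail x) * (x 0 + t) ^ j + (x 0 + t) ^ d * U x) 0 := by
  have h0 : AnalyticAt ℝ (fun x : Fin (n+1) → ℝ => x 0 + t) 0 := (an_coord 0 0).add analyticAt_const
  refine AnalyticAt.add (Finset.analyticAt_fun_sum _ fun j hj => ?_) ((h0.pow d).mul hU)
  exact (an_comp0 (hc j hj) (an_tail 0) tail_zero).mul (h0.pow j)
end

section
open Filter Topology
variable {n : ℕ}

/-- the last chart -/
theorem last_chart {d : ℕ} {S : Finset ℕ} (hS : ∀ j ∈ S, j < d) {M : (Fin n → ℝ) → ℝ} (hM : NC M)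
    {u : ℕ → (Fin n → ℝ) → ℝ} (hu : ∀ j ∈ S, AnalyticAt ℝ (u j) 0) {U : (Fin (n+1) → ℝ) → ℝ}
    (hU : AnalyticAt ℝ U 0) (hU0 : U 0 ≠ 0) (β : ℕ → Fin n → ℕ) (i : Fin n)
    (hβ : ∀ j ∈ S, d ≤ j + β j i) :
    NC (fun x => x 0 * Tg d S M (fun j x => mono (β j) x * u j x) U (bl i.succ 0 0 x)) := by
  have tl : ∀ x : Fin (n+1) → ℝ, (Fin.tail (bl i.succ 0 0 x) : Fin n → ℝ) =
      Function.update (Fin.tail x) i (Fin.tail x i * x 0) := by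
    intro x; simp only [bl, Fin.tail_update_succ, add_zero]; rfl
  have anT : AnalyticAt ℝ (fun x : Fin (n+1) → ℝ => (Fin.tail (bl i.succ 0 0 x) : Fin n → ℝ)) 0 := 
    AnalyticAt.fun_comp (an_tail _) (an_bl _ _ _ _)
  have T0 : (Fin.tail (bl i.succ 0 0 (0 : Fin (n+1) → ℝ)) : Fin n → ℝ) = 0 := by rw [bl_zero]; rfl
  set V : (Fin (n+1) → ℝ) → ℝ := fun x => ∑ j ∈ S, x 0 ^ (j + β j i - d) * mono (β j) (Fin.tail x) *
      u j (Fin.tail (bl i.succ 0 0 x)) + U (bl i.succ 0 0 x) with hV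
  have anV : AnalyticAt ℝ V 0 := by
    refine AnalyticAt.add (Finset.analyticAt_fun_sum _ fun j hj => ?_) (an_comp0 hU (an_bl _ _ _ _) (bl_zero _ _ _))
    refine (((an_coord 0 0).pow _).mul (an_comp0 (an_mono _ _) (an_tail _) tail_zero)).mul ?_
    exact an_comp0 (hu j hj) anT T0
  have V0 : V 0 ≠ 0 := by
    rw [hV]
    simp only [bl_zero]
    rw [Finset.sum_eq_zero, zero_add]
    · exact hU0
    · intro j hj
      rw [tail_zero, mono_pos_zero (β j) i (by have := hS j hj; have := hβ j hj; omega)]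
      simp
  obtain ⟨a, w, hw, hw0, e⟩ := hM
  have hM' : NC (fun x : Fin (n+1) → ℝ => M (Fin.tail (bl i.succ 0 0 x))) := by
    have h1 : NC (fun x : Fin (n+1) → ℝ => mono a (Fin.tail x) * x 0 ^ a i * w (Fin.tail (bl i.succ 0 0 x))) := by
      refine ((NC.comp_tail (NC.ofmono a)).mul ((NC.coord 0).pow _)).mul (NC.unit (an_comp0 hw anT T0) (by rw [T0]; exact hw0))
    refine h1.congr ?_
    filter_upwards [(tendsto_zero_of_an anT T0).eventually e] with x hx
    rw [hx]
    congr 1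
    rw [tl, mono_upd_mul]
  refine (((NC.coord 0).mul hM').mul (((NC.coord 0).pow d).mul (NC.unit anV V0))).congr (Eventually.of_forall fun x => ?_)
  simp only [Tg, hV, bl_at0]
  rw [mul_assoc]
  congr 2
  rw [mul_add, Finset.mul_sum]
  congr 1
  refine Finset.sum_congr rfl fun j hj => ?_
  nth_rewrite 1 [tl]
  rw [mono_upd_mul]
  have := hβ j hj
  obtain ⟨k, hk⟩ := Nat.exists_eq_add_of_le this
  rw [hk, Nat.add_sub_cancel_left]
  have e1 : x 0 ^ d * x 0 ^ k = x 0 ^ j * x 0 ^ β j i := by rw [← pow_add, ← pow_add, hk]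
  linear_combination (-mono (β j) (Fin.tail x) * u j (Fin.tail (bl i.succ 0 0 x))) * e1

theorem tail_bl0 (i : Fin n) (t : ℝ) (x : Fin (n+1) → ℝ) : (Fin.tail (bl 0 i.succ t x) : Fin n → ℝ) = Fin.tail x := by
  simp only [bl, Fin.tail_update_zero]

theorem bl0_line (i : Fin n) (t y : ℝ) : bl 0 i.succ t (Fin.cons y 0 : Fin (n+1) → ℝ) = 0 := by
  rw [bl, Fin.update_cons_zero]; simp [cons_zero_zero]

theorem toric {d : ℕ} (hB : ∀ e < d, Bd n e) {S : Finset ℕ} (hS : ∀ j ∈ S, j + 1 < d) {j0 : ℕ} (hj0 : j0 ∈ S)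
    (u : ℕ → (Fin n → ℝ) → ℝ) (hu : ∀ j ∈ S, AnalyticAt ℝ (u j) 0) (hu0 : ∀ j ∈ S, u j 0 ≠ 0)
    (δ : ℕ → Fin n → ℕ) (hδ : δ j0 = 0) (α : Fin n → ℕ) :
    ∀ (M : (Fin n → ℝ) → ℝ) (hM : NC M) (U : (Fin (n+1) → ℝ) → ℝ)
    (hU : AnalyticAt ℝ U 0) (hU0 : U 0 ≠ 0), 
    Mon (Tg d S M (fun j x => mono ((d - j) • α + δ j) x * u j x) U) := by
  have hd : 1 < d := by have := hS j0 hj0; omega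
  induction hk : ∑ i, α i generalizing α with
  | zero =>
    intro M hM U hU hU0
    have ha : α = 0 := by
      funext i
      exact (Finset.sum_eq_zero_iff.1 hk) i (Finset.mem_univ i)
    subst ha
    have an : ∀ j ∈ S, AnalyticAt ℝ (fun x => mono ((d - j) • 0 + δ j) x * u j x) 0 := fun j hj =>
      (an_mono _ _).mul (hu j hj)
    refine hB j0 (by have := hS j0 hj0; omega) M _ hM.analytic hM.ne (by simpa using an_G an hU 0) ?_
    have := (expand_coeff (G := fun x => ∑ j ∈ S, mono ((d - j) • 0 + δ j) (Fin.tail x) * u j (Fin.tail x) * x 0 ^ j + x 0 ^ d * U x) (c := fun j x => if j ∈ S then mono ((d - j) • 0 + δ j) x * u j x else 0) (d := d) hU (Eventually.of_forall fun x => ?_)).1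
    rotate_left
    · simp only
      rw [sum_line (d := d) (fun j hj => by have := hS j hj; omega)]
    have := this.self_of_nhds j0 (by have := hS j0 hj0; omega)
    rw [cons_zero_zero] at this
    rw [this, if_pos hj0, hδ]
    simp only [smul_zero, add_zero, mono_zero, one_mul]
    exact mul_ne_zero (by positivity) (hu0 j0 hj0)
  | succ k ih =>
    intro M hM U hU hU0
    obtain ⟨i, hi⟩ : ∃ i, α i ≠ 0 := by
      by_contra hc
      push Not at hc
      simp [hc] at hk
    obtain ⟨b, rfl⟩ : ∃ b : Fin n → ℕ, α = b + Pi.single i 1 := by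
      refine ⟨α - Pi.single i 1, ?_⟩
      funext j
      by_cases hj : j = i
      · subst hj; simp; omega
      · simp [hj]
    have hb : ∑ j, b j = k := by
      have : ∑ j, (b + Pi.single i 1 : Fin n → ℕ) j = ∑ j, b j + 1 := by
        simp [Finset.sum_add_distrib]
      omega
    have hM' : NC (fun x => M x * x i ^ (d + 1)) := hM.mul ((NC.coord i).pow _)
    have hbt : ∀ t (x : Fin (n+1) → ℝ), x i.succ * Tg d S M (fun j x => mono ((d - j) • (b + Pi.single i 1) + δ j) x * u j x) U (bl 0 i.succ t x)
        = (fun x => M x * x i ^ (d + 1)) (Fin.tail x) * (∑ j ∈ S, mono ((d - j) • b + δ j) (Fin.tail x) * u j (Fin.tail x) * (x 0 + t) ^ j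
          + (x 0 + t) ^ d * U (bl 0 i.succ t x)) := by
      intro t x
      simp only [Tg, tail_bl0]
      have e0 : bl 0 i.succ t x 0 = (x 0 + t) * x i.succ := by simp [bl]
      have ei : Fin.tail x i = x i.succ := rfl
      rw [e0, ei, pow_succ, mul_add, mul_add, mul_add]
      congr 1
      · rw [Finset.mul_sum, Finset.mul_sum, Finset.mul_sum]
        refine Finset.sum_congr rfl fun j hj => ?_
        have hjd : d = (d - j) + j := by have := hS j hj; omega
        have : mono ((d - j) • (b + Pi.single i 1) + δ j) (Fin.tail x) = mono ((d - j) • b + δ j) (Fin.tail x) * x i.succ ^ (d - j) := by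
          rw [smul_add, mono_add, mono_add, mono_add, mono_smul (d - j) (Pi.single i 1), mono_single, pow_one, ei]; ring
        rw [this, mul_pow]
        nth_rewrite 3 [hjd]
        rw [pow_add]; ring
      · rw [mul_pow]; ring
    refine .blow _ 0 i.succ (Fin.succ_ne_zero i).symm (fun t => ?_) (.nc _ ?_)
    · by_cases ht : t = 0
      · have := ih b hb _ hM' (fun x => U (bl 0 i.succ 0 x)) (an_comp0 hU (an_bl _ _ _ _) (bl_zero _ _ _)) (by rw [bl_zero]; exact hU0)
        refine this.congr (Eventually.of_forall fun x => ?_)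
        have := hbt t x
        subst ht
        simp only at this ⊢
        rw [this]
        simp only [Tg, add_zero]
      · have := hB (d - 1) (by omega) _ (fun x => (∑ j ∈ S, (fun j x => mono ((d - j) • b + δ j) x * u j x) j (Fin.tail x) * (x 0 + t) ^ j
          + (x 0 + t) ^ d * U (bl 0 i.succ t x))) hM'.analytic hM'.ne 
          (an_G (fun j hj => (an_mono _ _).mul (hu j hj)) (an_comp0 hU (an_bl _ _ _ _) (bl_zero _ _ _)) t) ?_
        · exact this.congr (Eventually.of_forall fun x => hbt t x)
        · rw [← cons_zero_zero, DD_iter_cons]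
          simp only [Fin.tail_cons, Fin.cons_zero, bl0_line]
          rw [toric_line hS _ _ _ (by omega)]
          exact mul_ne_zero (mul_ne_zero (by positivity) ht) hU0
    · refine last_chart (fun j hj => by have := hS j hj; omega) hM hu hU hU0 (fun j => ((d - j) • (b + Pi.single i 1) + δ j)) i ?_
      intro j hj
      simp only [Pi.add_apply, Pi.smul_apply, Pi.single_eq_same, smul_eq_mul]
      have := hS j hj
      have : d - j ≤ (d - j) * (b i + 1) := Nat.le_mul_of_pos_right _ (by omega)
      omega

theorem NC.comp_pw {M : (Fin n → ℝ) → ℝ} (hM : NC M) (i : Fin n) (ε : ℝ) (hε : ε ≠ 0) (K : ℕ) (hK : 0 < K) :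
    NC (fun x => M (pw i ε K x)) := by
  obtain ⟨a, w, hw, hw0, e⟩ := hM
  refine ⟨Function.update a i (K * a i), fun x => ε ^ a i * w (pw i ε K x), 
    analyticAt_const.mul (an_comp0 hw (an_pw _ _ _ _) (pw_zero _ _ _ hK)), ?_, ?_⟩
  · show ε ^ a i * w (pw i ε K 0) ≠ 0
    rw [pw_zero _ _ _ hK]; exact mul_ne_zero (pow_ne_zero _ hε) hw0
  · filter_upwards [(tendsto_zero_of_an (an_pw i ε K 0) (pw_zero _ _ _ hK)).eventually e] with x hx
    rw [hx, mono_pw]; ring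

theorem powAll (d : ℕ) (S : Finset ℕ) (K : ℕ) (hK : 0 < K) (T : Finset (Fin n)) :
    ∀ (γ : ℕ → Fin n → ℕ) (M : (Fin n → ℝ) → ℝ) (u : ℕ → (Fin n → ℝ) → ℝ) (U : (Fin (n+1) → ℝ) → ℝ),
    NC M → (∀ j ∈ S, AnalyticAt ℝ (u j) 0 ∧ u j 0 ≠ 0) → AnalyticAt ℝ U 0 → U 0 ≠ 0 →
    (∀ (M : (Fin n → ℝ) → ℝ) (u : ℕ → (Fin n → ℝ) → ℝ) (U : (Fin (n+1) → ℝ) → ℝ),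
      NC M → (∀ j ∈ S, AnalyticAt ℝ (u j) 0 ∧ u j 0 ≠ 0) → AnalyticAt ℝ U 0 → U 0 ≠ 0 →
      Mon (Tg d S M (fun j x => mono (fun i => if i ∈ T then 2 * K * γ j i else γ j i) x * u j x) U)) →
    Mon (Tg d S M (fun j x => mono (γ j) x * u j x) U) := by
  induction T using Finset.induction_on with
  | empty =>
    intro γ M u U hM hu hU hU0 h
    simpa using h M u U hM hu hU hU0
  | insert i T hi ih =>
    intro γ M u U hM hu hU hU0 h
    have main : ∀ ε : ℝ, ε ≠ 0 → Mon (fun x => x i.succ * Tg d S M (fun j x => mono (γ j) x * u j x) U (pw i.succ ε (2*K) x)) := by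
      intro ε hε
      have hK' : 0 < 2 * K := by omega
      have := ih (fun j => Function.update (γ j) i (2 * K * γ j i)) (fun x => x i * M (pw i ε (2*K) x))
        (fun j x => ε ^ γ j i * u j (pw i ε (2*K) x)) (fun x => U (pw i.succ ε (2*K) x))
        ((NC.coord i).mul (hM.comp_pw i ε hε _ hK')) (fun j hj => ⟨analyticAt_const.mul (an_comp0 (hu j hj).1 (an_pw _ _ _ _) (pw_zero _ _ _ hK')), ?_⟩)
        (an_comp0 hU (an_pw _ _ _ _) (pw_zero _ _ _ hK')) (by rw [pw_zero _ _ _ hK']; exact hU0) ?_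
      · refine this.congr (Eventually.of_forall fun x => ?_)
        simp only [Tg, tail_pw, pw_at0]
        rw [← mul_assoc]
        congr 1
        congr 1
        refine Finset.sum_congr rfl fun j hj => ?_
        rw [mono_pw]; ring
      · rw [pw_zero _ _ _ hK']; exact mul_ne_zero (pow_ne_zero _ hε) (hu j hj).2
      · intro M u U hM hu hU hU0
        have := h M u U hM hu hU hU0
        convert this using 7 with j x
        rename_i i'
        by_cases h1 : i' = i
        · subst h1; simp [hi]
        · simp [h1]
    exact .pow _ i.succ K hK (main 1 one_ne_zero) (main (-1) (by norm_num))
end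

section
open Filter Topology
variable {n : ℕ}

theorem leaf_mon {d : ℕ} (hB : ∀ e < d, Bd n e) {S : Finset ℕ} (hS : ∀ j ∈ S, j + 1 < d)
    {M : (Fin n → ℝ) → ℝ} (hM : NC M) {c : ℕ → (Fin n → ℝ) → ℝ} (hc : ∀ j ∈ S, NC (c j))
    (hcc : ∀ i ∈ S, ∀ j ∈ S, (fun x => c i x ^ (d.factorial / (d - i)) - c j x ^ (d.factorial / (d - j))) =ᶠ[𝓝 0] 0 ∨
      NC (fun x => c i x ^ (d.factorial / (d - i)) - c j x ^ (d.factorial / (d - j))))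
    {U : (Fin (n+1) → ℝ) → ℝ} (hU : AnalyticAt ℝ U 0) (hU0 : U 0 ≠ 0) : Mon (Tg d S M c U) := by
  rcases S.eq_empty_or_nonempty with rfl | hne
  · refine .nc _ ?_
    refine ((hM.comp_tail).mul (((NC.coord 0).pow d).mul (NC.unit hU hU0))).congr (Eventually.of_forall fun x => ?_)
    simp [Tg]
  have : ∀ j, ∃ (γ : Fin n → ℕ) (u : (Fin n → ℝ) → ℝ), j ∈ S → (AnalyticAt ℝ u 0 ∧ u 0 ≠ 0 ∧
    c j =ᶠ[𝓝 0] fun x => mono γ x * u x) := by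
    intro j
    by_cases hj : j ∈ S
    · obtain ⟨a, u, h⟩ := hc j hj
      exact ⟨a, u, fun _ => h⟩
    · exact ⟨0, 0, fun h => absurd h hj⟩
  choose γ u h using this
  set e : ℕ → ℕ := fun j => d.factorial / (d - j) with he
  have comp : ∀ i ∈ S, ∀ j ∈ S, e i • γ i ≤ e j • γ j ∨ e j • γ j ≤ e i • γ i := by
    intro i hi j hj
    obtain ⟨a1, a2, a3⟩ := h i hi
    obtain ⟨b1, b2, b3⟩ := h j hj
    refine NC.comparable (A := fun x => c i x ^ e i) (B := fun x => c j x ^ e j) (a1.pow (e i)) (pow_ne_zero _ a2) (b1.pow (e j)) (pow_ne_zero _ b2) ?_ ?_ (hcc i hi j hj)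
    · filter_upwards [a3] with x hx
      rw [hx, mul_pow, mono_smul]; rfl
    · filter_upwards [b3] with x hx
      rw [hx, mul_pow, mono_smul]; rfl
  obtain ⟨j0, hj0, hmin⟩ := S.exists_min_image (fun j => ∑ i, (e j • γ j) i) hne
  have hle : ∀ j ∈ S, e j0 • γ j0 ≤ e j • γ j := by
    intro j hj
    rcases comp j0 hj0 j hj with h1 | h1
    · exact h1
    · have h2 := hmin j hj
      have h3 : ∀ i ∈ Finset.univ, (e j • γ j) i ≤ (e j0 • γ j0) i := fun i _ => h1 i
      have h4 := (Finset.sum_eq_sum_iff_of_le h3).1 (le_antisymm (Finset.sum_le_sum h3) h2)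
      intro i
      exact (h4 i (Finset.mem_univ i)).ge
  have main : Mon (Tg d S M (fun j x => mono (γ j) x * u j x) U) := by
    refine powAll d S d.factorial (Nat.factorial_pos d) Finset.univ γ M u U hM (fun j hj => ⟨(h j hj).1, (h j hj).2.1⟩) hU hU0 ?_
    intro M u U hM hu hU hU0
    have := toric hB hS hj0 u (fun j hj => (hu j hj).1) (fun j hj => (hu j hj).2)
      (fun j => (d - j) • (2 • (e j • γ j - e j0 • γ j0))) (by simp) (2 • (e j0 • γ j0)) M hM U hU hU0
    refine this.congr (Eventually.of_forall fun x => ?_)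
    simp only [Tg]
    congr 2
    refine Finset.sum_congr rfl fun j hj => ?_
    congr 3
    funext i
    simp only [Finset.mem_univ, if_true, Pi.add_apply, Pi.smul_apply, Pi.sub_apply, smul_eq_mul]
    have h1 := hle j hj i
    simp only [Pi.smul_apply, smul_eq_mul] at h1
    have h2 : (d - j) * e j = d.factorial := by
      have := hS j hj
      exact Nat.mul_div_cancel' (Nat.dvd_factorial (by omega) (by omega))
    obtain ⟨k, hk⟩ := Nat.exists_eq_add_of_le h1
    rw [hk, Nat.add_sub_cancel_left, ← h2]
    calc 2 * ((d - j) * e j) * γ j i = 2 * (d - j) * (e j * γ j i) := by ring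
      _ = _ := by rw [hk]; ring
  refine main.congr ?_
  have : ∀ᶠ x in 𝓝 (0 : Fin n → ℝ), ∀ j ∈ S, c j x = mono (γ j) x * u j x := by
    rw [Filter.eventually_all_finset]
    exact fun j hj => (h j hj).2.2
  filter_upwards [(tendsto_zero_of_an (an_tail 0) tail_zero).eventually this] with x hx
  simp only [Tg]
  congr 2
  exact Finset.sum_congr rfl fun j hj => by rw [hx j hj]

def Adm (d : ℕ) (S : Finset ℕ) (C M : (Fin n → ℝ) → ℝ) (c : ℕ → (Fin n → ℝ) → ℝ) : Prop :=
  AnalyticAt ℝ C 0 ∧ Dv C M ∧ (∀ j ∈ S, Dv C (c j)) ∧ ∀ i ∈ S, ∀ j ∈ S,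
    (fun x => c i x ^ (d.factorial / (d - i)) - c j x ^ (d.factorial / (d - j))) =ᶠ[𝓝 0] 0 ∨
      Dv C (fun x => c i x ^ (d.factorial / (d - i)) - c j x ^ (d.factorial / (d - j)))

theorem Adm.comp {d : ℕ} {S : Finset ℕ} {C M : (Fin n → ℝ) → ℝ} {c : ℕ → (Fin n → ℝ) → ℝ} (h : Adm d S C M c)
    {X : (Fin n → ℝ) → ℝ} {Ψ : (Fin n → ℝ) → (Fin n → ℝ)}
    (hX : AnalyticAt ℝ X 0) (hΨ : AnalyticAt ℝ Ψ 0) (h0 : Ψ 0 = 0) :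
    Adm d S (fun x => X x * C (Ψ x)) (fun x => X x * M (Ψ x)) (fun j x => c j (Ψ x)) := by
  obtain ⟨h1, h2, h3, h4⟩ := h
  refine ⟨hX.mul (an_comp0 h1 hΨ h0), by simpa using h2.comp h1 hX hΨ h0 1, fun j hj => by simpa using (h3 j hj).comp h1 hX hΨ h0 0, fun i hi j hj => ?_⟩
  rcases h4 i hi j hj with h | h
  · left
    exact (tendsto_zero_of_an hΨ h0).eventually h
  · right
    simpa using h.comp h1 hX hΨ h0 0

theorem lift_mon {d : ℕ} (hB : ∀ e < d, Bd n e) {S : Finset ℕ} (hS : ∀ j ∈ S, j + 1 < d) {C : (Fin n → ℝ) → ℝ} (hC : Mon C) :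
    ∀ {M : (Fin n → ℝ) → ℝ} {c : ℕ → (Fin n → ℝ) → ℝ} {U : (Fin (n+1) → ℝ) → ℝ}, Adm d S C M c → 
    AnalyticAt ℝ U 0 → U 0 ≠ 0 → Mon (Tg d S M c U) := by
  induction hC with
  | nc C hC =>
    intro M c U ⟨h1, h2, h3, h4⟩ hU hU0
    exact leaf_mon hB hS (h2.nc hC) (fun j hj => (h3 j hj).nc hC) (fun i hi j hj => (h4 i hi j hj).imp id fun h => h.nc hC) hU hU0
  | blow C i j hij h1 h2 ih1 ih2 =>
    intro M c U hA hU hU0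
    refine .blow _ i.succ j.succ (by simpa using hij) (fun t => ?_) ?_
    · refine (ih1 t (hA.comp (an_coord j 0) (an_bl i j t 0) (bl_zero _ _ _)) (an_comp0 hU (an_bl i.succ j.succ t 0) (bl_zero _ _ _)) (by rw [bl_zero]; exact hU0)).congr
        (Eventually.of_forall fun x => ?_)
      simp only [Tg, tail_bl, bl_at0, mul_assoc, Fin.tail]
    · refine (ih2 (hA.comp (an_coord i 0) (an_bl j i 0 0) (bl_zero _ _ _)) (an_comp0 hU (an_bl j.succ i.succ 0 0) (bl_zero _ _ _)) (by rw [bl_zero]; exact hU0)).congr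
        (Eventually.of_forall fun x => ?_)
      simp only [Tg, tail_bl, bl_at0, mul_assoc, Fin.tail]
  | pow C i k hk h1 h2 ih1 ih2 =>
    intro M c U hA hU hU0
    have z : ∀ ε, pw i.succ ε (2*k) (0 : Fin (n+1) → ℝ) = 0 := fun ε => pw_zero _ _ _ (by omega)
    refine .pow _ i.succ k hk ?_ ?_
    · refine (ih1 (hA.comp (an_coord i 0) (an_pw i 1 _ 0) (pw_zero _ _ _ (by omega))) (an_comp0 hU (an_pw i.succ 1 (2*k) 0) (z 1)) (by rw [z]; exact hU0)).congr
        (Eventually.of_forall fun x => ?_)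
      simp only [Tg, tail_pw, pw_at0, mul_assoc, Fin.tail]
    · refine (ih2 (hA.comp (an_coord i 0) (an_pw i (-1) _ 0) (pw_zero _ _ _ (by omega))) (an_comp0 hU (an_pw i.succ (-1) (2*k) 0) (z (-1))) (by rw [z]; exact hU0)).congr
        (Eventually.of_forall fun x => ?_)
      simp only [Tg, tail_pw, pw_at0, mul_assoc, Fin.tail]
  | shear C i s hs hs0 hsi h ih =>
    intro M c U hA hU hU0
    have an' : AnalyticAt ℝ (fun x : Fin (n+1) → ℝ => s (Fin.tail x)) 0 := an_comp0 hs (an_tail 0) tail_zero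
    have z : sh i.succ (fun x : Fin (n+1) → ℝ => s (Fin.tail x)) 0 = 0 := sh_zero _ _ hs0
    refine .shear _ i.succ (fun x => s (Fin.tail x)) an' hs0 (fun x v => by rw [Fin.tail_update_succ, hsi]) ?_
    refine (ih (by simpa only [one_mul] using hA.comp (X := fun _ => 1) analyticAt_const (an_sh i hs) (sh_zero _ _ hs0)) (an_comp0 hU (an_sh i.succ an') z) (by rw [z]; exact hU0)).congr
      (Eventually.of_forall fun x => ?_)
    simp only [Tg, tail_sh, sh_at0, mul_assoc]

theorem prod_germ_ne {ι : Type*} (T : Finset ι) (f : ι → (Fin n → ℝ) → ℝ) (h1 : ∀ i ∈ T, AnalyticAt ℝ (f i) 0)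
    (h2 : ∀ i ∈ T, ¬ f i =ᶠ[𝓝 0] 0) : ¬ (fun x => ∏ i ∈ T, f i x) =ᶠ[𝓝 0] 0 := by
  classical
  induction T using Finset.induction_on with
  | empty => intro h; have := h.self_of_nhds; simp at this
  | insert i T hi ih =>
    intro h
    simp only [Finset.prod_insert hi] at h
    rcases germ_domain (h1 i (by simp)) (Finset.analyticAt_fun_prod T fun j hj => h1 j (by simp [hj])) h with h | h
    · exact h2 i (by simp) h
    · exact ih (fun j hj => h1 j (by simp [hj])) (fun j hj => h2 j (by simp [hj])) h

theorem Dv.of_prod {ι : Type*} (T : Finset ι) (f : ι → (Fin n → ℝ) → ℝ) (h1 : ∀ i ∈ T, AnalyticAt ℝ (f i) 0) {i : ι} (hi : i ∈ T)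
    : Dv (fun x => ∏ i ∈ T, f i x) (f i) := by
  classical
  refine Dv.of_mul (h1 i hi) (H := fun x => ∏ j ∈ T.erase i, f j x) (Finset.analyticAt_fun_prod _ fun j hj => h1 j (Finset.mem_of_mem_erase hj)) fun x => ?_
  exact Finset.mul_prod_erase T (fun j => f j x) hi

theorem Dv.mul_left {F L A : (Fin n → ℝ) → ℝ} (h : Dv F L) (hA : AnalyticAt ℝ A 0) : Dv (fun x => A x * F x) L := by
  obtain ⟨hL, k, H, hH, e⟩ := h
  refine ⟨hL, k, fun x => A x ^ k * H x, (hA.pow k).mul hH, ?_⟩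
  filter_upwards [e] with x hx
  rw [mul_pow, ← hx]; ring

theorem Dv.mul_right {F L A : (Fin n → ℝ) → ℝ} (h : Dv F L) (hA : AnalyticAt ℝ A 0) : Dv (fun x => F x * A x) L := by
  simpa only [mul_comm] using h.mul_left hA

def LM (n : ℕ) : Prop := ∀ F : (Fin n → ℝ) → ℝ, AnalyticAt ℝ F 0 → ¬ F =ᶠ[𝓝 0] 0 → Mon F

theorem Bd_all (hLM : LM n) (d : ℕ) : Bd n d := by
  classical
  induction d using Nat.strong_induction_on with
  | _ d ih =>
  intro M G hM hM0 hG hd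
  rcases Nat.eq_zero_or_pos d with rfl | hdpos
  · have := lift_mon (d := 0) (S := ∅) (fun e he => ih e he) (by simp) (hLM M hM hM0) (M := M) (c := fun _ _ => 0) (U := G) 
      ⟨hM, Dv.of_mul hM (H := fun _ => 1) analyticAt_const (by simp), by simp, by simp⟩ hG hd
    refine this.congr (Eventually.of_forall fun x => ?_)
    simp [Tg]
  by_cases hlow : ∃ e < d, DD^[e] G 0 ≠ 0
  · obtain ⟨e, he, h⟩ := hlow
    exact ih e he M G hM hM0 hG h
  push Not at hlow
  obtain ⟨m, rfl⟩ : ∃ m, d = m + 1 := ⟨d - 1, by omega⟩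
  obtain ⟨s, hs, hs0, hse⟩ := ift (an_DD_iter hG m) (hlow m (by omega)) (by have h := Function.iterate_succ_apply' DD m G; rw [← h]; exact hd)
  have an' : AnalyticAt ℝ (fun x : Fin (n+1) → ℝ => s (Fin.tail x)) 0 := an_comp0 hs (an_tail 0) tail_zero
  refine .shear _ 0 (fun x => s (Fin.tail x)) an' hs0 (fun x v => by rw [Fin.tail_update_zero]) ?_
  have tl : ∀ x : Fin (n+1) → ℝ, (Fin.tail (sh 0 (fun x => s (Fin.tail x)) x) : Fin n → ℝ) = Fin.tail x := fun x => by
    simp only [sh, Fin.tail_update_zero]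
  set G1 : (Fin (n+1) → ℝ) → ℝ := fun x => G (sh 0 (fun x => s (Fin.tail x)) x) with hG1
  have anG1 : AnalyticAt ℝ G1 0 := an_comp0 hG (an_sh 0 an') (sh_zero _ _ hs0)
  obtain ⟨c, U, hc, hU, e⟩ := expand anG1 (m+1)
  obtain ⟨k1, k2⟩ := expand_coeff hU e
  have hU0 : U 0 ≠ 0 := by
    intro h
    rw [h, mul_zero, ← cons_zero_zero, DD_sh, hs0, add_zero, cons_zero_zero] at k2
    exact hd k2
  have hcm : c m =ᶠ[𝓝 0] 0 := by
    filter_upwards [k1, hse] with x h1 h2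
    have := h1 m (by omega)
    rw [DD_sh, zero_add, h2] at this
    simpa [Nat.factorial_ne_zero] using this.symm
  set S : Finset ℕ := (Finset.range (m+1)).filter fun j => ¬ c j =ᶠ[𝓝 0] 0 with hSdef
  have hS : ∀ j ∈ S, j + 1 < m + 1 := by
    intro j hj
    simp only [S, Finset.mem_filter, Finset.mem_range] at hj
    have : j ≠ m := by rintro rfl; exact hj.2 hcm
    omega
  have hSne : ∀ j ∈ S, ¬ c j =ᶠ[𝓝 0] 0 := fun j hj => (Finset.mem_filter.1 hj).2
  let df : ℕ × ℕ → (Fin n → ℝ) → ℝ := fun p x => c p.1 x ^ ((m+1).factorial / (m + 1 - p.1)) - c p.2 x ^ ((m+1).factorial / (m + 1 - p.2))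
  have hdf : ∀ p, AnalyticAt ℝ (df p) 0 := fun p => ((hc _).pow _).sub ((hc _).pow _)
  let T := (S ×ˢ S).filter fun p => ¬ df p =ᶠ[𝓝 0] 0
  let C1 : (Fin n → ℝ) → ℝ := fun x => ∏ j ∈ S, c j x
  let C2 : (Fin n → ℝ) → ℝ := fun x => ∏ p ∈ T, df p x
  have hC1 : AnalyticAt ℝ C1 0 := Finset.analyticAt_fun_prod _ fun j _ => hc j
  have hC2 : AnalyticAt ℝ C2 0 := Finset.analyticAt_fun_prod _ fun j _ => hdf j
  have hC : ¬ (fun x => M x * (C1 x * C2 x)) =ᶠ[𝓝 0] 0 := by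
    intro h
    rcases germ_domain hM (hC1.mul hC2) h with h | h
    · exact hM0 h
    rcases germ_domain hC1 hC2 h with h | h
    · exact prod_germ_ne S c (fun j _ => hc j) hSne h
    · exact prod_germ_ne T df (fun j _ => hdf j) (fun p hp => (Finset.mem_filter.1 hp).2) h
  have hCan : AnalyticAt ℝ (fun x => M x * (C1 x * C2 x)) 0 := hM.mul (hC1.mul hC2)
  have := lift_mon (d := m+1) (S := S) ih hS (hLM _ hCan hC) (M := M) (c := c) (U := U) ⟨hCan, ?_, ?_, ?_⟩ hU hU0
  · refine this.congr ?_
    have hev : ∀ᶠ x in 𝓝 (0 : Fin n → ℝ), ∀ j ∈ Finset.range (m+1), c j x ≠ 0 → j ∈ S := by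
      rw [Filter.eventually_all_finset]
      intro j hj
      by_cases hjS : j ∈ S
      · exact Eventually.of_forall fun _ _ => hjS
      · have : c j =ᶠ[𝓝 0] 0 := by
          by_contra h
          exact hjS (Finset.mem_filter.2 ⟨hj, h⟩)
        filter_upwards [this] with x hx h using absurd hx h
    filter_upwards [e, (tendsto_zero_of_an (an_tail 0) tail_zero).eventually hev] with x hx hx2
    rw [tl]
    change _ * G1 x = _
    rw [hx, Tg]
    congr 2
    symm
    refine Finset.sum_subset (Finset.filter_subset _ _) fun j hj hjS => ?_
    have := hx2 j hj
    have : c j (Fin.tail x) = 0 := by by_contra h; exact hjS (this h)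
    rw [this, zero_mul]
  · exact Dv.of_mul hM (hC1.mul hC2) fun x => rfl
  · intro j hj
    exact ((Dv.of_prod S c (fun j _ => hc j) hj).mul_right hC2).mul_left hM
  · intro i hi j hj
    by_cases h : df (i, j) =ᶠ[𝓝 0] 0
    · exact Or.inl h
    · right
      exact ((Dv.of_prod T df (fun p _ => hdf p) (i := (i, j)) (Finset.mem_filter.2 ⟨by simp [hi, hj], h⟩)).mul_left hC1).mul_left hM

def Lsh (v : Fin n → ℝ) (T : Finset (Fin n)) (x : Fin (n+1) → ℝ) : Fin (n+1) → ℝ :=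
  Fin.cons (x 0) (fun i => if i ∈ T then x i.succ + v i * x 0 else x i.succ)

theorem Mon_Lsh (v : Fin n → ℝ) (T : Finset (Fin n)) (F : (Fin (n+1) → ℝ) → ℝ) (h : Mon (fun x => F (Lsh v T x))) : Mon F := by
  induction T using Finset.induction_on with
  | empty =>
    refine h.congr (Eventually.of_forall fun x => ?_)
    simp only [Lsh]
    congr 1
    simp
    exact (Fin.cons_self_tail x).symm
  | insert i T hi ih =>
    refine ih (.shear _ i.succ (fun x => v i * x 0) (analyticAt_const.mul (an_coord 0 0)) (by simp) ?_ ?_)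
    · intro x w
      simp [(Fin.succ_ne_zero i).symm]
    · refine h.congr (Eventually.of_forall fun x => ?_)
      simp only
      congr 1
      simp only [Lsh, sh_at0]
      congr 1
      funext j
      by_cases hj : j = i
      · subst hj; simp [hi, sh]
      · simp [hj, sh]

theorem LM_all (n : ℕ) : LM n := by
  induction n with
  | zero =>
    intro F hF hF0
    refine .nc _ (NC.unit hF fun h => hF0 (Eventually.of_forall fun x => ?_))
    rw [Subsingleton.elim x 0, h]; rfl
  | succ n ih =>
    intro F hF hF0
    obtain ⟨r, hr, hball⟩ := Metric.eventually_nhds_iff_ball.1 hF.eventually_analyticAt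
    -- a point with nonzero value and nonzero first coordinate
    obtain ⟨p, hp, hp0, hFp⟩ : ∃ p ∈ Metric.ball (0 : Fin (n+1) → ℝ) r, p 0 ≠ 0 ∧ F p ≠ 0 := by
      by_contra hcon
      push Not at hcon
      refine absurd (germ_domain (f := fun x : Fin (n+1) → ℝ => x 0) (an_coord 0 0) hF ?_) (not_or.2 ⟨coord_ne 0, hF0⟩)
      filter_upwards [Metric.ball_mem_nhds (0 : Fin (n+1) → ℝ) hr] with x hx
      by_cases h : x 0 = 0
      · simp [h]
      · rw [hcon x hx h, mul_zero]
    have hline : ¬ (fun t : ℝ => F (t • p)) =ᶠ[𝓝 0] 0 := by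
      intro h
      have hU : AnalyticOnNhd ℝ (fun t : ℝ => F (t • p)) (Set.Icc 0 1) := by
        intro t ht
        refine AnalyticAt.fun_comp (hball _ ?_) (analyticAt_id.smul analyticAt_const)
        rw [mem_ball_zero_iff] at hp ⊢
        rw [norm_smul, Real.norm_of_nonneg ht.1]
        calc t * ‖p‖ ≤ 1 * ‖p‖ := by gcongr; exact ht.2
          _ < r := by simpa using hp
      have := hU.eqOn_zero_of_preconnected_of_eventuallyEq_zero isPreconnected_Icc (Set.left_mem_Icc.2 zero_le_one) h
        (Set.right_mem_Icc.2 zero_le_one)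
      simp at this
      exact hFp this
    set v : Fin n → ℝ := fun i => p i.succ / p 0 with hv
    have hL : ∀ y : ℝ, Lsh v Finset.univ (Fin.cons y 0) = (y / p 0) • p := by
      intro y
      funext i
      refine Fin.cases ?_ (fun i => ?_) i
      · simp [Lsh, hp0]
      · simp [Lsh, hv]; ring
    have anL : AnalyticAt ℝ (Lsh v Finset.univ) 0 := by
      rw [analyticAt_pi_iff]
      intro i
      refine Fin.cases ?_ (fun i => ?_) i
      · simpa [Lsh] using an_coord 0 0
      · have : AnalyticAt ℝ (fun x : Fin (n+1) → ℝ => x i.succ + v i * x 0) 0 := (an_coord i.succ 0).add (analyticAt_const.mul (an_coord 0 0))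
        simpa [Lsh] using this
    have L0 : Lsh v Finset.univ 0 = 0 := by
      rw [← cons_zero_zero, hL]; simp [cons_zero_zero]
    refine Mon_Lsh v Finset.univ F ?_
    set G : (Fin (n+1) → ℝ) → ℝ := fun x => F (Lsh v Finset.univ x) with hGdef
    have hG : AnalyticAt ℝ G 0 := an_comp0 hF anL L0
    have anl : AnalyticAt ℝ (fun y : ℝ => G (Fin.cons y 0)) 0 := AnalyticAt.fun_comp (by rw [cons_zero_zero]; exact hG) (an_cons_line 0 0)
    obtain ⟨d, hd⟩ : ∃ d, DD^[d] G 0 ≠ 0 := by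
      by_contra hcon
      push Not at hcon
      apply hline
      have h1 : analyticOrderAt (fun y : ℝ => G (Fin.cons y 0)) 0 = ⊤ := by
        rw [ENat.eq_top_iff_forall_ge]
        intro m
        rw [natCast_le_analyticOrderAt_iff_iteratedDeriv_eq_zero anl]
        intro i _
        rw [← DD_iter_cons, cons_zero_zero, hcon]
      rw [analyticOrderAt_eq_top] at h1
      have t : Tendsto (fun t : ℝ => t * p 0) (𝓝 0) (𝓝 0) := by
        have : Continuous (fun t : ℝ => t * p 0) := by fun_prop
        simpa using this.tendsto 0
      filter_upwards [t.eventually h1] with t ht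
      rw [hGdef] at ht
      simp only [hL] at ht
      rw [mul_div_cancel_right₀ _ hp0] at ht
      exact ht
    have := Bd_all ih d (fun _ => 1) G analyticAt_const (fun h => by have := h.self_of_nhds; simp at this) hG hd
    simpa using this
end

section
open Filter Topology

def PP (n N M : ℕ) (s : ℂ) : ℂ := ∏ r ∈ Finset.range M, (s + ((r : ℂ) + 1) / N) ^ n

def MMN (n N : ℕ) (Z : ℂ → ℂ) : Prop := ∀ K : ℕ, ∃ (M : ℕ) (H : ℂ → ℂ),
  DifferentiableOn ℂ H {s | -(K : ℝ) < s.re} ∧ ∀ s : ℂ, 0 < s.re → Z s * PP n N M s = H s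

def MM (n : ℕ) (Z : ℂ → ℂ) : Prop := ∃ N : ℕ, 0 < N ∧ MMN n N Z

theorem PP_diff (n N M : ℕ) : Differentiable ℂ (PP n N M) := by
  unfold PP
  fun_prop

theorem PP_subset {n N M : ℕ} (T : Finset ℕ) (hT : T ⊆ Finset.range M) :
    ∃ Q : ℂ → ℂ, Differentiable ℂ Q ∧ ∀ s, PP n N M s = (∏ r ∈ T, (s + ((r : ℂ) + 1) / N) ^ n) * Q s := by
  refine ⟨fun s => ∏ r ∈ Finset.range M \ T, (s + ((r : ℂ) + 1) / N) ^ n, by fun_prop, fun s => ?_⟩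
  rw [mul_comm, Finset.prod_sdiff hT]; rfl

theorem PP_le {n N M M' : ℕ} (h : M ≤ M') : ∃ Q : ℂ → ℂ, Differentiable ℂ Q ∧ ∀ s, PP n N M' s = PP n N M s * Q s :=
  PP_subset (Finset.range M) (by simpa using h)

theorem PP_dvd {n N M D : ℕ} (hN : 0 < N) (hD : 0 < D) : ∃ (M' : ℕ) (Q : ℂ → ℂ), Differentiable ℂ Q ∧ ∀ s, PP n (N * D) M' s = PP n N M s * Q s := by
  obtain ⟨Q, hQ, e⟩ := PP_subset (n := n) (N := N * D) (M := M * D) ((Finset.range M).image fun r => (r + 1) * D - 1) (by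
    intro r hr
    simp only [Finset.mem_image, Finset.mem_range] at hr ⊢
    obtain ⟨k, hk, rfl⟩ := hr
    have : (k + 1) * D ≤ M * D := Nat.mul_le_mul_right _ hk
    have : 0 < (k + 1) * D := by positivity
    omega)
  refine ⟨M * D, Q, hQ, fun s => ?_⟩
  rw [e, Finset.prod_image]
  · congr 1
    refine Finset.prod_congr rfl fun r _ => ?_
    have h1 : (((r + 1) * D - 1 : ℕ) : ℂ) + 1 = (r + 1) * D := by
      have : 1 ≤ (r + 1) * D := Nat.succ_le_of_lt (by positivity)
      push_cast [Nat.cast_sub this]; ring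
    rw [h1]
    have hDc : (D : ℂ) ≠ 0 := by exact_mod_cast hD.ne'
    push_cast
    rw [mul_div_mul_right _ _ hDc]
  · intro a _ b _ h
    have h1 : 0 < (a + 1) * D := by positivity
    have h2 : 0 < (b + 1) * D := by positivity
    have : (a + 1) * D = (b + 1) * D := by simp only at h; omega
    have := Nat.eq_of_mul_eq_mul_right hD this
    omega

theorem MMN.mul {n N D : ℕ} {Z : ℂ → ℂ} (hN : 0 < N) (hD : 0 < D) (h : MMN n N Z) : MMN n (N * D) Z := by
  intro K
  obtain ⟨M, H, hH, e⟩ := h K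
  obtain ⟨M', Q, hQ, e2⟩ := PP_dvd (n := n) (M := M) hN hD
  refine ⟨M', fun s => H s * Q s, hH.mul hQ.differentiableOn, fun s hs => ?_⟩
  rw [e2, ← mul_assoc, e s hs]

theorem MMN.add {n N : ℕ} {Z W : ℂ → ℂ} (h : MMN n N Z) (h' : MMN n N W) : MMN n N (fun s => Z s + W s) := by
  intro K
  obtain ⟨M, H, hH, e⟩ := h K
  obtain ⟨M', H', hH', e'⟩ := h' K
  obtain ⟨Q, hQ, q⟩ := PP_le (n := n) (N := N) (le_max_left M M')
  obtain ⟨Q', hQ', q'⟩ := PP_le (n := n) (N := N) (le_max_right M M')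
  refine ⟨max M M', fun s => H s * Q s + H' s * Q' s, (hH.mul hQ.differentiableOn).add (hH'.mul hQ'.differentiableOn), fun s hs => ?_⟩
  rw [add_mul]
  nth_rewrite 1 [q]
  rw [q', ← mul_assoc, ← mul_assoc, e s hs, e' s hs]

theorem MM.add {n : ℕ} {Z W : ℂ → ℂ} (h : MM n Z) (h' : MM n W) : MM n (fun s => Z s + W s) := by
  obtain ⟨N, hN, h⟩ := h
  obtain ⟨N', hN', h'⟩ := h'
  refine ⟨N * N', by positivity, (h.mul hN hN').add ?_⟩
  rw [mul_comm]
  exact h'.mul hN' hN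

theorem MM.congr {n : ℕ} {Z W : ℂ → ℂ} (h : MM n Z) (e : ∀ s : ℂ, 0 < s.re → W s = Z s) : MM n W := by
  obtain ⟨N, hN, h⟩ := h
  refine ⟨N, hN, fun K => ?_⟩
  obtain ⟨M, H, hH, e'⟩ := h K
  exact ⟨M, H, hH, fun s hs => by rw [e s hs, e' s hs]⟩

theorem MM.zero {n : ℕ} : MM n (fun _ => 0) :=
  ⟨1, one_pos, fun K => ⟨0, fun _ => 0, differentiableOn_const _, by simp⟩⟩

theorem MM.sum {n : ℕ} {ι : Type*} (T : Finset ι) {Z : ι → ℂ → ℂ} (h : ∀ i ∈ T, MM n (Z i)) : MM n (fun s => ∑ i ∈ T, Z i s) := by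
  classical
  induction T using Finset.induction_on with
  | empty => simpa using MM.zero
  | insert i T hi ih =>
    simp only [Finset.sum_insert hi]
    exact (h i (by simp)).add (ih fun j hj => h j (by simp [hj]))

theorem pou {E : Type*} [NormedAddCommGroup E] [NormedSpace ℝ E] [FiniteDimensional ℝ E] {K : Set E} (hK : IsCompact K)
    (U : E → Set E) (hU : ∀ x ∈ K, U x ∈ 𝓝 x) :
    ∃ (t : Finset E) (ρ : E → E → ℝ), (∀ x ∈ t, x ∈ K) ∧ (∀ x, ContDiff ℝ (⊤ : ℕ∞) (ρ x)) ∧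
      (∀ x ∈ t, ∀ y, ρ x y ≠ 0 → y ∈ U x) ∧ ∀ y ∈ K, ∑ x ∈ t, ρ x y = 1 := by
  classical
  obtain ⟨f, hf⟩ := SmoothPartitionOfUnity.exists_isSubordinate (modelWithCornersSelf ℝ E) hK.isClosed (fun x : K => interior (U x)) (fun x => isOpen_interior)
    (fun x hx => Set.mem_iUnion.2 ⟨⟨x, hx⟩, mem_interior_iff_mem_nhds.2 (hU x hx)⟩)
  have hfin := f.locallyFinite.finite_nonempty_inter_compact hK
  refine ⟨hfin.toFinset.image Subtype.val, fun x => if hx : x ∈ K then f ⟨x, hx⟩ else 0, ?_, ?_, ?_, ?_⟩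
  · intro x hx
    simp only [Finset.mem_image] at hx
    obtain ⟨y, _, rfl⟩ := hx
    exact y.2
  · intro x

    by_cases hx : x ∈ K
    · simp only [hx, dif_pos]
      exact (f ⟨x, hx⟩).contMDiff.contDiff
    · simp only [hx, dif_neg, not_false_eq_true]; exact contDiff_const
  · intro x hx y hy
    by_cases hx : x ∈ K
    · simp only [hx, dif_pos] at hy
      exact interior_subset (hf ⟨x, hx⟩ (subset_tsupport _ hy))
    · simp [hx] at hy
  · intro y hy
    rw [Finset.sum_image (by intro a _ b _ h; exact Subtype.ext h)]
    have := f.sum_eq_one hy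
    rw [finsum_eq_sum_of_support_subset (s := hfin.toFinset)] at this
    · rw [← this]
      refine Finset.sum_congr rfl fun x _ => by simp
    · intro x hx
      simp only [Set.Finite.coe_toFinset, Set.mem_setOf_eq]
      exact ⟨y, hx, hy⟩

theorem smooth_ext {n : ℕ} {h : (Fin n → ℝ) → ℝ} (hh : AnalyticAt ℝ h 0) :
    ∃ k : (Fin n → ℝ) → ℝ, ContDiff ℝ (⊤ : ℕ∞) k ∧ k =ᶠ[𝓝 0] h := by
  obtain ⟨r, hr, hball⟩ := Metric.eventually_nhds_iff_ball.1 hh.eventually_analyticAt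
  let b : ContDiffBump (0 : Fin n → ℝ) := ⟨r/3, r/2, by positivity, by linarith⟩
  refine ⟨fun x => b x * h x, ?_, ?_⟩
  · rw [contDiff_iff_contDiffAt]
    intro x
    by_cases hx : x ∈ Metric.ball (0 : Fin n → ℝ) r
    · exact b.contDiffAt.mul (hball x hx).contDiffAt
    · have : (fun x => b x * h x) =ᶠ[𝓝 x] fun _ => 0 := by
        have hx' : x ∉ tsupport b := by
          rw [b.tsupport_eq]
          intro h
          apply hx
          exact Metric.closedBall_subset_ball (by show r/2 < r; linarith) h
        filter_upwards [(isClosed_tsupport b).isOpen_compl.mem_nhds hx'] with y hy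
        rw [image_eq_zero_of_notMem_tsupport hy, zero_mul]
      exact contDiffAt_const.congr_of_eventuallyEq this
  · filter_upwards [b.eventuallyEq_one] with x hx
    simp only [hx, Pi.one_apply, one_mul]
end

section
open Filter Topology

def pp (l : ℂ) (t : ℝ) : ℂ := if 0 < t then (t : ℂ) ^ l else 0

theorem pp_meas (l : ℂ) : Measurable (pp l) := by
  unfold pp
  refine Measurable.ite measurableSet_Ioi ?_ measurable_const
  exact (Complex.measurable_ofReal).pow_const l

theorem pp_norm {l : ℂ} {t : ℝ} (h : 0 < t) : ‖pp l t‖ = t ^ l.re := by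
  simp [pp, h, Complex.norm_cpow_eq_rpow_re_of_pos]

theorem pp_bound {l : ℂ} {t R : ℝ} (hl : 0 ≤ l.re) (hR : 0 ≤ R) (h : |t| ≤ R) : ‖pp l t‖ ≤ R ^ l.re := by
  by_cases ht : 0 < t
  · rw [pp_norm ht]
    exact Real.rpow_le_rpow ht.le ((le_abs_self t).trans h) hl
  · simp [pp, ht]; positivity

theorem pp_deriv {l : ℂ} (hl : 0 < l.re) (t : ℝ) : HasDerivAt (pp (l + 1)) ((l + 1) * pp l t) t := by
  have hne : l + 1 ≠ 0 := by
    intro h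
    have := congrArg Complex.re h
    simp at this; linarith
  rcases lt_trichotomy t 0 with h | h | h
  · have : pp (l + 1) =ᶠ[𝓝 t] fun _ => 0 := by
      filter_upwards [gt_mem_nhds h] with y hy
      simp [pp, hy.le]
    refine HasDerivAt.congr_of_eventuallyEq ?_ this
    simp only [pp, h.not_gt, if_false, mul_zero]
    exact hasDerivAt_const _ _
  · subst h
    rw [hasDerivAt_iff_isLittleO]
    simp only [pp, lt_irrefl, if_false, mul_zero, sub_zero, smul_zero]
    rw [Asymptotics.isLittleO_iff]
    intro c hc
    have : Tendsto (fun y : ℝ => |y| ^ l.re) (𝓝 0) (𝓝 0) := by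
      have := (continuous_abs (G := ℝ)).tendsto 0
      have h2 := (Real.continuousAt_rpow_const 0 l.re (Or.inr hl.le)).tendsto
      simp only [abs_zero] at this
      have h3 := h2.comp this
      simpa [Real.zero_rpow hl.ne', Function.comp_def] using h3
    filter_upwards [this.eventually_lt_const hc] with y hy
    by_cases h : 0 < y
    · simp only [h, if_true]
      rw [Complex.norm_cpow_eq_rpow_re_of_pos h]
      simp only [add_re, one_re]
      rw [Real.rpow_add h, Real.rpow_one, Real.norm_eq_abs, abs_of_pos h]
      rw [abs_of_pos h] at hy
      gcongr
    · simp only [h, if_false, norm_zero]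
      positivity
  · have : pp (l + 1) =ᶠ[𝓝 t] fun y => (y : ℂ) ^ (l + 1) := by
      filter_upwards [lt_mem_nhds h] with y hy
      simp [pp, hy]
    refine HasDerivAt.congr_of_eventuallyEq ?_ this
    have := hasDerivAt_ofReal_cpow_const h.ne' hne
    simpa [pp, h] using this

variable {n : ℕ}

def TT (l : Fin n → ℂ) (x : Fin n → ℝ) : ℂ := ∏ k, pp (l k) (x k)

theorem TT_meas (l : Fin n → ℂ) : Measurable (TT l) := by
  unfold TT
  exact Finset.measurable_prod _ fun k _ => (pp_meas (l k)).comp (measurable_pi_apply k)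

theorem TT_int {l : Fin n → ℂ} (hl : ∀ k, 0 ≤ (l k).re) {g : (Fin n → ℝ) → ℂ} (hg : Continuous g) (hc : HasCompactSupport g) :
    Integrable (fun x => TT l x * g x) := by
  obtain ⟨R, hR0, hR⟩ : ∃ R : ℝ, 0 < R ∧ ∀ x, g x ≠ 0 → ‖x‖ ≤ R := by
    obtain ⟨R, hR⟩ := hc.isCompact.isBounded.exists_norm_le
    exact ⟨max R 1, by positivity, fun x hx => (hR x (subset_tsupport _ hx)).trans (le_max_left _ _)⟩
  refine ((hg.integrable_of_hasCompactSupport hc).norm.const_mul (∏ k, R ^ (l k).re)).mono' ((TT_meas l).aestronglyMeasurable.mul hg.aestronglyMeasurable) (Eventually.of_forall fun x => ?_)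
  by_cases hx : g x = 0
  · simp [hx]
  · rw [norm_mul]
    gcongr
    rw [TT, norm_prod]
    refine Finset.prod_le_prod (fun _ _ => norm_nonneg _) fun k _ => pp_bound (hl k) hR0.le ?_
    exact (norm_le_pi_norm x k).trans (hR x hx)

theorem TT_deriv {l : Fin n → ℂ} (i : Fin n) (hl : 0 < (l i).re) (x : Fin n → ℝ) :
    HasLineDerivAt ℝ (TT (Function.update l i (l i + 1))) ((l i + 1) * TT l x) x (Pi.single i 1) := by
  unfold HasLineDerivAt
  have e : ∀ (m : Fin n → ℂ) y, TT m y = pp (m i) (y i) * ∏ k ∈ Finset.univ.erase i, pp (m k) (y k) := by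
    intro m y
    rw [TT, Finset.mul_prod_erase _ (fun k => pp (m k) (y k)) (Finset.mem_univ i)]
  have e2 : (fun t : ℝ => TT (Function.update l i (l i + 1)) (x + t • Pi.single i 1)) = fun t : ℝ => pp (l i + 1) (x i + t) * ∏ k ∈ Finset.univ.erase i, pp (l k) (x k) := by
    funext t
    rw [e]
    congr 1
    · simp
    · refine Finset.prod_congr rfl fun k hk => ?_
      have : k ≠ i := Finset.ne_of_mem_erase hk
      simp [this]
  rw [e2, e, ← mul_assoc]
  refine HasDerivAt.mul_const ?_ _
  have := pp_deriv hl (x i + 0)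
  simpa using this.comp_const_add (x i) 0

def EE (a b : Fin n → ℕ) (ℓ ψ : (Fin n → ℝ) → ℝ) (s : ℂ) : ℂ :=
  ∫ x, TT (fun k => a k * s + b k) x * (cexp (s * ℓ x) * ψ x)

theorem cont_exp {ℓ ψ : (Fin n → ℝ) → ℝ} (hℓ : Continuous ℓ) (hψ : Continuous ψ) (s : ℂ) : Continuous fun x => cexp (s * ℓ x) * ψ x := by
  fun_prop

theorem supp_exp {ℓ ψ : (Fin n → ℝ) → ℝ} (hψ : HasCompactSupport ψ) (s : ℂ) : HasCompactSupport fun x => cexp (s * ℓ x) * (ψ x : ℂ) := by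
  refine hψ.mono ?_
  intro x hx
  simp only [Function.mem_support] at hx ⊢
  intro h; apply hx; simp [h]

theorem EE_int (a b : Fin n → ℕ) {ℓ ψ : (Fin n → ℝ) → ℝ} (hℓ : Continuous ℓ) (hψ : Continuous ψ) (hc : HasCompactSupport ψ) {s : ℂ} (hs : 0 ≤ s.re) :
    Integrable fun x => TT (fun k => a k * s + b k) x * (cexp (s * ℓ x) * ψ x) := by
  refine TT_int (fun k => ?_) (cont_exp hℓ hψ s) (supp_exp hc s)
  simp only [add_re, mul_re, natCast_re, natCast_im, zero_mul, sub_zero]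
  positivity

def dd (i : Fin n) (ψ : (Fin n → ℝ) → ℝ) (x : Fin n → ℝ) : ℝ := fderiv ℝ ψ x (Pi.single i 1)

theorem dd_smooth (i : Fin n) {ψ : (Fin n → ℝ) → ℝ} (hψ : ContDiff ℝ (⊤ : ℕ∞) ψ) : ContDiff ℝ (⊤ : ℕ∞) (dd i ψ) := by
  unfold dd
  exact (hψ.fderiv_right (m := (⊤ : ℕ∞)) (by simp)).clm_apply contDiff_const

theorem dd_supp (i : Fin n) {ψ : (Fin n → ℝ) → ℝ} (hψ : HasCompactSupport ψ) : HasCompactSupport (dd i ψ) :=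
  (hψ.fderiv ℝ).comp_left (g := fun L : (Fin n → ℝ) →L[ℝ] ℝ => L (Pi.single i 1)) (by simp)

theorem dd_line (i : Fin n) {ψ : (Fin n → ℝ) → ℝ} (hψ : ContDiff ℝ (⊤ : ℕ∞) ψ) (x : Fin n → ℝ) : HasLineDerivAt ℝ ψ (dd i ψ x) x (Pi.single i 1) :=
  ((hψ.differentiable (by simp)) x).hasFDerivAt.hasLineDerivAt _

theorem EE_ibp (a b : Fin n → ℕ) {ℓ ψ : (Fin n → ℝ) → ℝ} (hℓ : ContDiff ℝ (⊤ : ℕ∞) ℓ) (hψ : ContDiff ℝ (⊤ : ℕ∞) ψ) (hc : HasCompactSupport ψ)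
    (i : Fin n) (hi : 0 < a i) {s : ℂ} (hs : 0 < s.re) :
    EE a b ℓ ψ s * (a i * s + b i + 1) = - (s * EE a (Function.update b i (b i + 1)) ℓ (fun x => dd i ℓ x * ψ x) s + EE a (Function.update b i (b i + 1)) ℓ (dd i ψ) s) := by
  set b' := Function.update b i (b i + 1) with hb'
  have hl : Function.update (fun k => (a k : ℂ) * s + b k) i (a i * s + b i + 1) = fun k => (a k : ℂ) * s + b' k := by
    funext k
    by_cases hk : k = i
    · subst hk; simp [hb', add_assoc]
    · simp [hb', hk]
  have hre : 0 < ((a i : ℂ) * s + b i).re := by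
    simp only [add_re, mul_re, natCast_re, natCast_im, zero_mul, sub_zero]
    positivity
  have hTd := fun x => TT_deriv (l := fun k => (a k : ℂ) * s + b k) i hre x
  rw [hl] at hTd
  have hc1 := hℓ.continuous
  have hc2 := hψ.continuous
  have hd1 := (dd_smooth i hψ).continuous
  have hd2 := (dd_smooth i hℓ).continuous
  have hs2 : HasCompactSupport fun x => dd i ℓ x * ψ x := hc.mul_left
  have I1 := EE_int a b hc1 hc2 hc hs.le
  have I2 := EE_int a b' hc1 hc2 hc hs.le
  have I3 := EE_int a b' hc1 hd1 (dd_supp i hc) hs.le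
  have I4 := EE_int (ψ := fun x => dd i ℓ x * ψ x) a b' hc1 (hd2.mul hc2) hs2 hs.le
  have key := integral_bilinear_hasLineDerivAt_right_eq_neg_left_of_integrable (μ := (volume : Measure (Fin n → ℝ)))
    (f := TT (fun k => (a k : ℂ) * s + b' k)) (f' := fun x => (a i * s + b i + 1) * TT (fun k => (a k : ℂ) * s + b k) x)
    (g := fun x => cexp (s * ℓ x) * ψ x) (g' := fun x => s * (cexp (s * ℓ x) * (dd i ℓ x * ψ x : ℝ)) + cexp (s * ℓ x) * dd i ψ x)
    (v := Pi.single i 1) (B := ContinuousLinearMap.mul ℝ ℂ) (by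
      simpa [mul_assoc] using I1.const_mul (a i * s + b i + 1 : ℂ)) (by
      refine ((I4.const_mul s).add I3).congr (Eventually.of_forall fun x => ?_)
      simp; ring) (by simpa using I2) (fun x _ => hTd x) (fun x _ => by
        have h1 : HasDerivAt (fun t : ℝ => ℓ (x + t • Pi.single i 1)) (dd i ℓ x) 0 := dd_line i hℓ x
        have h2 : HasDerivAt (fun t : ℝ => ψ (x + t • Pi.single i 1)) (dd i ψ x) 0 := dd_line i hψ x
        unfold HasLineDerivAt
        have h3 := ((h1.ofReal_comp.const_mul s).cexp).mul h2.ofReal_comp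
        refine h3.congr_deriv ?_
        simp; ring)
  simp only [ContinuousLinearMap.mul_apply'] at key
  have e1 : ∫ x, (a i * s + b i + 1) * TT (fun k => (a k : ℂ) * s + b k) x * (cexp (s * ℓ x) * ψ x) = EE a b ℓ ψ s * (a i * s + b i + 1) := by
    simp only [mul_assoc]
    rw [integral_const_mul, mul_comm]; rfl
  have e2 : ∫ x, TT (fun k => (a k : ℂ) * s + b' k) x * (s * (cexp (s * ℓ x) * (dd i ℓ x * ψ x : ℝ)) + cexp (s * ℓ x) * dd i ψ x) = s * EE a b' ℓ (fun x => dd i ℓ x * ψ x) s + EE a b' ℓ (dd i ψ) s := by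
    unfold EE
    rw [← integral_const_mul, ← integral_add (I4.const_mul s) I3]
    refine integral_congr_ae (Eventually.of_forall fun x => ?_)
    simp; ring
  rw [e1, e2] at key
  rw [key, neg_neg]
end

section
open Filter Topology
variable {n : ℕ}

theorem hol_nn {α : Type*} [MeasurableSpace α] {μ : Measure α} {X : α → ℝ} {w : α → NNReal} (hw : Measurable w) (hX : Measurable X) {K : ℝ}
    (h : ∀ t : ℝ, -K < t → Integrable (fun x => Real.exp (t * X x) * w x) μ) :
    DifferentiableOn ℂ (fun s : ℂ => ∫ x, cexp (s * X x) * (w x : ℝ) ∂μ) {s | -K < s.re} := by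
  have h1 := ProbabilityTheory.differentiableOn_complexMGF (X := X) (μ := μ.withDensity fun x => w x)
  have h2 : Set.Ioi (-K) ⊆ interior (ProbabilityTheory.integrableExpSet X (μ.withDensity fun x => w x)) := by
    refine interior_maximal ?_ isOpen_Ioi
    intro t ht
    rw [ProbabilityTheory.integrableExpSet, Set.mem_setOf_eq, integrable_withDensity_iff_integrable_smul hw]
    refine (h t ht).congr (Eventually.of_forall fun x => ?_)
    simp [NNReal.smul_def, mul_comm]
  refine (h1.mono fun s hs => h2 hs).congr fun s hs => ?_
  rw [ProbabilityTheory.complexMGF, integral_withDensity_eq_integral_smul hw]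
  refine integral_congr_ae (Eventually.of_forall fun x => ?_)
  simp [NNReal.smul_def, mul_comm]

theorem hol_re {α : Type*} [MeasurableSpace α] {μ : Measure α} {X w : α → ℝ} (hw : Measurable w) (hX : Measurable X) {K : ℝ}
    (h : ∀ t : ℝ, -K < t → Integrable (fun x => Real.exp (t * X x) * w x) μ) :
    DifferentiableOn ℂ (fun s : ℂ => ∫ x, cexp (s * X x) * w x ∂μ) {s | -K < s.re} := by
  have hm : ∀ v : α → ℝ, Measurable v → ∀ t : ℝ, -K < t → (∀ x, |v x| ≤ |w x|) → Integrable (fun x => Real.exp (t * X x) * v x) μ := by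
    intro v hv t ht hvw
    refine (h t ht).mono ((by fun_prop : Measurable fun x => Real.exp (t * X x) * v x).aestronglyMeasurable) (Eventually.of_forall fun x => ?_)
    rw [norm_mul, norm_mul]
    gcongr
    exact hvw x
  have hp : ∀ t : ℝ, -K < t → Integrable (fun x => Real.exp (t * X x) * (w x).toNNReal) μ := fun t ht =>
    hm _ (by fun_prop) t ht fun x => by
      rw [Real.coe_toNNReal', abs_of_nonneg (le_max_right _ _)]; exact max_le (le_abs_self _) (abs_nonneg _)
  have hn : ∀ t : ℝ, -K < t → Integrable (fun x => Real.exp (t * X x) * (-w x).toNNReal) μ := fun t ht =>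
    hm _ (by fun_prop) t ht fun x => by
      rw [Real.coe_toNNReal', abs_of_nonneg (le_max_right _ _)]; exact max_le (neg_le_abs _) (abs_nonneg _)
  have hcx : ∀ w : α → NNReal, Measurable w → ∀ s : ℂ, Integrable (fun x => Real.exp (s.re * X x) * w x) μ → Integrable (fun x => cexp (s * X x) * (w x : ℝ)) μ := by
    intro w hw s hi
    refine hi.mono ((by fun_prop : Measurable fun x => cexp (s * X x) * ((w x : ℝ) : ℂ)).aestronglyMeasurable) (Eventually.of_forall fun x => ?_)
    simp [Complex.norm_exp]
  refine ((hol_nn (by fun_prop) hX hp).sub (hol_nn (by fun_prop) hX hn)).congr fun s hs => ?_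
  simp only [Pi.sub_apply]
  rw [← integral_sub (hcx _ (by fun_prop) s (hp _ hs)) (hcx _ (by fun_prop) s (hn _ hs))]
  refine integral_congr_ae (Eventually.of_forall fun x => ?_)
  simp only [Real.coe_toNNReal']
  rw [← mul_sub, ← ofReal_sub]
  congr 2
  exact (max_zero_sub_max_neg_zero_eq_self (w x)).symm

theorem pp_exp {a b : ℕ} {s : ℂ} {t : ℝ} (ht : 0 < t) : pp (a * s + b) t = cexp (s * (a * Real.log t : ℝ)) * (t ^ b : ℝ) := by
  simp only [pp, ht, if_true]
  have : (t : ℂ) ≠ 0 := by exact_mod_cast ht.ne'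
  rw [cpow_add _ _ this, cpow_natCast, cpow_def_of_ne_zero this, ← ofReal_log ht.le]
  push_cast
  congr 2; ring

def pos (x : Fin n → ℝ) : Prop := ∀ k, 0 < x k

theorem TT_npos {l : Fin n → ℂ} {x : Fin n → ℝ} (h : ¬ pos x) : TT l x = 0 := by
  simp only [pos, not_forall] at h
  obtain ⟨k, hk⟩ := h
  exact Finset.prod_eq_zero (Finset.mem_univ k) (by simp [pp, hk])

theorem TT_pos {a b : Fin n → ℕ} {s : ℂ} {x : Fin n → ℝ} (h : pos x) :
    TT (fun k => a k * s + b k) x = cexp (s * (∑ k, a k * Real.log (x k) : ℝ)) * (mono b x : ℝ) := by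
  unfold TT mono
  rw [Finset.prod_congr rfl fun k _ => pp_exp (h k), Finset.prod_mul_distrib, ← Complex.exp_sum]
  push_cast
  rw [Finset.mul_sum]

theorem meas_pos : MeasurableSet {x : Fin n → ℝ | pos x} := by
  unfold pos
  rw [Set.setOf_forall]
  exact MeasurableSet.iInter fun k => measurableSet_lt measurable_const (measurable_pi_apply k)

theorem EE_hol (a b : Fin n → ℕ) {ℓ ψ : (Fin n → ℝ) → ℝ} (hℓ : ContDiff ℝ (⊤ : ℕ∞) ℓ) (hψ : ContDiff ℝ (⊤ : ℕ∞) ψ) (hc : HasCompactSupport ψ)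
    (K : ℕ) (hb : ∀ i, a i * K ≤ b i) : DifferentiableOn ℂ (EE a b ℓ ψ) {s | -(K:ℝ) < s.re} := by
  classical
  let X : (Fin n → ℝ) → ℝ := fun x => ∑ k, a k * Real.log (x k) + ℓ x
  let w : (Fin n → ℝ) → ℝ := Set.indicator {x | pos x} fun x => mono b x * ψ x
  have hmono : Continuous (mono b : (Fin n → ℝ) → ℝ) := by unfold mono; fun_prop
  have hψc := hψ.continuous
  have hℓc := hℓ.continuous
  have hX : Measurable X := by
    have : Measurable ℓ := hℓc.measurable
    fun_prop
  have hw : Measurable w := (hmono.mul hψc).measurable.indicator meas_pos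
  have e : ∀ (s : ℂ) x, TT (fun k => a k * s + b k) x * (cexp (s * ℓ x) * ψ x) = cexp (s * X x) * w x := by
    intro s x
    by_cases hx : pos x
    · simp only [TT_pos hx, X, w, Set.indicator_of_mem (show x ∈ {x | pos x} from hx)]
      push_cast
      rw [mul_add, Complex.exp_add]; ring
    · simp only [TT_npos hx, w, Set.indicator_of_notMem (show x ∉ {x | pos x} from hx)]
      simp
  have hE : EE a b ℓ ψ = fun s : ℂ => ∫ x, cexp (s * X x) * w x := by
    funext s
    exact integral_congr_ae (Eventually.of_forall fun x => e s x)
  rw [hE]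
  refine hol_re hw hX fun t ht => ?_
  have hi := TT_int (l := fun k => a k * (t:ℂ) + b k) (fun k => by
    simp only [add_re, mul_re, natCast_re, natCast_im, zero_mul, sub_zero, ofReal_re]
    have h1 : ((a k * K : ℕ) : ℝ) ≤ b k := by exact_mod_cast hb k
    push_cast at h1
    have : 0 ≤ (a k : ℝ) * (t + K) := mul_nonneg (by positivity) (by linarith)
    linarith) (cont_exp hℓc hψc t) (supp_exp hc t)
  have h2 : Integrable fun x => (cexp (t * X x) * w x) := hi.congr (Eventually.of_forall fun x => e t x)
  refine h2.re.congr (Eventually.of_forall fun x => ?_)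
  have : cexp (t * X x) * w x = ((Real.exp (t * X x) * w x : ℝ) : ℂ) := by push_cast; rfl
  simp only [this]
  exact ofReal_re _

def QQ (a b : Fin n → ℕ) (K : ℕ) (s : ℂ) : ℂ := ∏ i, ∏ m ∈ Finset.Ico (b i) (a i * K), (a i * s + m + 1)

theorem QQ_step (a b : Fin n → ℕ) (K : ℕ) (i : Fin n) (hi : b i < a i * K) (s : ℂ) :
    QQ a b K s = (a i * s + b i + 1) * QQ a (Function.update b i (b i + 1)) K s := by
  classical
  unfold QQ
  rw [← Finset.mul_prod_erase _ _ (Finset.mem_univ i), ← Finset.mul_prod_erase Finset.univ (fun j => ∏ m ∈ Finset.Ico (Function.update b i (b i + 1) j) (a j * K), (a j * s + m + 1)) (Finset.mem_univ i), ← mul_assoc]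
  congr 1
  · rw [Finset.prod_eq_prod_Ico_succ_bot hi]; simp
  · refine Finset.prod_congr rfl fun k hk => ?_
    rw [Function.update_of_ne (Finset.ne_of_mem_erase hk)]

theorem EE_mer (a : Fin n → ℕ) {ℓ : (Fin n → ℝ) → ℝ} (hℓ : ContDiff ℝ (⊤ : ℕ∞) ℓ) (K : ℕ) (D : ℕ) : ∀ (b : Fin n → ℕ) {ψ : (Fin n → ℝ) → ℝ} (hψ : ContDiff ℝ (⊤ : ℕ∞) ψ) (hc : HasCompactSupport ψ),
    ∑ i, (a i * K - b i) = D → ∃ H : ℂ → ℂ, DifferentiableOn ℂ H {s | -(K:ℝ) < s.re} ∧ ∀ s : ℂ, 0 < s.re → EE a b ℓ ψ s * QQ a b K s = H s := by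
  induction D with
  | zero =>
    intro b ψ hψ hc hD
    have hb : ∀ i, a i * K ≤ b i := by
      intro i
      have := (Finset.sum_eq_zero_iff.1 hD) i (Finset.mem_univ i)
      omega
    refine ⟨EE a b ℓ ψ, EE_hol a b hℓ hψ hc K hb, fun s _ => ?_⟩
    have : QQ a b K s = 1 := by
      unfold QQ
      refine Finset.prod_eq_one fun i _ => ?_
      rw [Finset.Ico_eq_empty (by have := hb i; omega), Finset.prod_empty]
    rw [this, mul_one]
  | succ D ih =>
    intro b ψ hψ hc hD
    obtain ⟨i, hi⟩ : ∃ i, b i < a i * K := by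
      by_contra! hcon
      have : ∑ i, (a i * K - b i) = 0 := Finset.sum_eq_zero fun i _ => by have := hcon i; omega
      omega
    have hD' : ∑ k, (a k * K - Function.update b i (b i + 1) k) = D := by
      rw [← Finset.add_sum_erase _ _ (Finset.mem_univ i)] at hD ⊢
      rw [Finset.sum_congr rfl fun k hk => by rw [Function.update_of_ne (Finset.ne_of_mem_erase hk)]]
      rw [Function.update_self]
      omega
    obtain ⟨H1, h1, e1⟩ := ih (Function.update b i (b i + 1)) (ψ := fun x => dd i ℓ x * ψ x) ((dd_smooth i hℓ).mul hψ) hc.mul_left hD'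
    obtain ⟨H2, h2, e2⟩ := ih (Function.update b i (b i + 1)) (dd_smooth i hψ) (dd_supp i hc) hD'
    refine ⟨fun s => -(s * H1 s + H2 s), ((differentiableOn_id.mul h1).add h2).neg, fun s hs => ?_⟩
    have ha : 0 < a i := by
      rcases Nat.eq_zero_or_pos (a i) with h | h
      · simp [h] at hi
      · exact h
    rw [QQ_step a b K i hi, ← mul_assoc, EE_ibp a b hℓ hψ hc i ha hs]
    simp only [← e1 s hs, ← e2 s hs]
    ring

theorem QQ_PP (a b : Fin n → ℕ) (K : ℕ) : ∃ R : ℂ → ℂ, Differentiable ℂ R ∧ ∀ s, PP n (∏ i, max (a i) 1) (K * ∏ i, max (a i) 1) s = QQ a b K s * R s := by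
  classical
  set N := ∏ i, max (a i) 1 with hN
  have hNpos : 0 < N := Finset.prod_pos fun i _ => by positivity
  have : ∀ i, ∃ R : ℂ → ℂ, Differentiable ℂ R ∧ ∀ s, PP 1 N (K * N) s = (∏ m ∈ Finset.Ico (b i) (a i * K), (a i * s + m + 1)) * R s := by
    intro i
    rcases Nat.eq_zero_or_pos (a i) with h0 | h0
    · refine ⟨PP 1 N (K * N), PP_diff _ _ _, fun s => by simp [h0]⟩
    obtain ⟨c, hc⟩ : a i ∣ N := by
      have := Finset.dvd_prod_of_mem (fun i => max (a i) 1) (Finset.mem_univ i)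
      rwa [max_eq_left h0] at this
    have hcpos : 0 < c := by
      rcases Nat.eq_zero_or_pos c with h | h
      · simp [h] at hc; omega
      · exact h
    obtain ⟨Q, hQ, e⟩ := PP_subset (n := 1) (N := N) (M := K * N) ((Finset.Ico (b i) (a i * K)).image fun m => (m + 1) * c - 1) (by
      intro r hr
      simp only [Finset.mem_image, Finset.mem_Ico, Finset.mem_range] at hr ⊢
      obtain ⟨m, hm, rfl⟩ := hr
      have h1 : (m + 1) * c ≤ a i * K * c := Nat.mul_le_mul_right _ hm.2
      have h2 : 0 < (m + 1) * c := by positivity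
      have h3 : a i * K * c = K * N := by rw [hc]; ring
      omega)
    refine ⟨fun s => ((a i : ℂ)⁻¹) ^ (Finset.Ico (b i) (a i * K)).card * Q s, hQ.const_mul _, fun s => ?_⟩
    rw [e, ← mul_assoc, ← Finset.prod_const, ← Finset.prod_mul_distrib, Finset.prod_image]
    · congr 1
      refine Finset.prod_congr rfl fun m _ => ?_
      have h1 : (((m + 1) * c - 1 : ℕ) : ℂ) + 1 = (m + 1) * c := by
        have : 1 ≤ (m + 1) * c := Nat.succ_le_of_lt (by positivity)
        push_cast [Nat.cast_sub this]; ring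
      have ha : (a i : ℂ) ≠ 0 := by exact_mod_cast h0.ne'
      have hcc : (c : ℂ) ≠ 0 := by exact_mod_cast hcpos.ne'
      rw [h1, hc, pow_one]
      push_cast
      field_simp
      ring
    · intro x _ y _ h
      have h1 : 0 < (x + 1) * c := by positivity
      have h2 : 0 < (y + 1) * c := by positivity
      have : (x + 1) * c = (y + 1) * c := by simp only at h; omega
      have := Nat.eq_of_mul_eq_mul_right hcpos this
      omega
  choose R hR e using this
  refine ⟨fun s => ∏ i, R i s, by fun_prop, fun s => ?_⟩
  have : PP n N (K * N) s = ∏ i : Fin n, PP 1 N (K * N) s := by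
    simp [PP, Finset.prod_pow]
  rw [this, QQ, ← Finset.prod_mul_distrib]
  exact Finset.prod_congr rfl fun i _ => e i s

theorem EE_MM (a b : Fin n → ℕ) {ℓ ψ : (Fin n → ℝ) → ℝ} (hℓ : ContDiff ℝ (⊤ : ℕ∞) ℓ) (hψ : ContDiff ℝ (⊤ : ℕ∞) ψ) (hc : HasCompactSupport ψ) :
    MM n (EE a b ℓ ψ) := by
  refine ⟨∏ i, max (a i) 1, Finset.prod_pos fun i _ => by positivity, fun K => ?_⟩
  obtain ⟨H, hH, e⟩ := EE_mer a hℓ K _ b hψ hc rfl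
  obtain ⟨R, hR, e2⟩ := QQ_PP a b K
  refine ⟨K * ∏ i, max (a i) 1, fun s => H s * R s, hH.mul hR.differentiableOn, fun s hs => ?_⟩
  rw [e2, ← mul_assoc, e s hs]
end

section
open Filter Topology
variable {n : ℕ}

open Classical in
def kern {ι : Type*} (f J : (Fin n → ℝ) → ℝ) (g : ι → (Fin n → ℝ) → ℝ) (A : Set (ι → SignType)) (s : ℂ) (x : Fin n → ℝ) : ℂ :=
  if (fun i => SignType.sign (g i x)) ∈ A then (|J x| : ℝ) * ((|f x| : ℝ) : ℂ) ^ s else 0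

def Good {ι : Type*} (f J : (Fin n → ℝ) → ℝ) (g : ι → (Fin n → ℝ) → ℝ) (A : Set (ι → SignType)) : Prop :=
  ∃ r : ℝ, 0 < r ∧ ∀ φ : (Fin n → ℝ) → ℝ, ContDiff ℝ (⊤ : ℕ∞) φ → (∀ x, r < ‖x‖ → φ x = 0) →
    (∀ s : ℂ, 0 < s.re → Integrable fun x => φ x * kern f J g A s x) ∧ MM n (fun s => ∫ x, φ x * kern f J g A s x)

def sg (b : Bool) : ℝ := if b then 1 else -1
def rf (σ : Fin n → Bool) (x : Fin n → ℝ) : Fin n → ℝ := fun i => sg (σ i) * x i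

theorem sg_mul (b : Bool) : sg b * sg b = 1 := by cases b <;> simp [sg]
theorem sg_abs (b : Bool) : |sg b| = 1 := by cases b <;> simp [sg]

theorem rf_rf (σ : Fin n → Bool) (x : Fin n → ℝ) : rf σ (rf σ x) = x := by
  funext i; simp only [rf]; rw [← mul_assoc, sg_mul, one_mul]

theorem rf_norm (σ : Fin n → Bool) (x : Fin n → ℝ) : ‖rf σ x‖ = ‖x‖ := by
  simp only [Pi.norm_def, rf, nnnorm_mul]
  have : ∀ b, ‖sg b‖₊ = 1 := fun b => by cases b <;> simp [sg]
  simp [this]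

theorem rf_smooth (σ : Fin n → Bool) : ContDiff ℝ (⊤ : ℕ∞) (rf σ) := by
  unfold rf; fun_prop

theorem rf_cont (σ : Fin n → Bool) : Continuous (rf σ) := by
  unfold rf; fun_prop

theorem rf_mp (σ : Fin n → Bool) : MeasurePreserving (rf σ) volume volume := by
  refine volume_preserving_pi (f := fun i (t : ℝ) => sg (σ i) * t) fun i => ?_
  cases σ i
  · simpa [sg] using Measure.measurePreserving_neg (volume : Measure ℝ)
  · simp only [sg, if_true, one_mul]; exact MeasurePreserving.id (volume : Measure ℝ)

theorem rf_emb (σ : Fin n → Bool) : MeasurableEmbedding (rf σ) :=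
  (Homeomorph.mk ⟨rf σ, rf σ, rf_rf σ, rf_rf σ⟩ (rf_cont σ) (rf_cont σ)).measurableEmbedding

theorem ae_coord_ne : ∀ᵐ x : Fin n → ℝ, ∀ i, x i ≠ 0 := by
  rw [ae_all_iff]
  intro i
  exact Measure.ae_eval_ne (fun _ : Fin n => (volume : Measure ℝ)) i 0

open Classical in
theorem refl_sum {Φ : (Fin n → ℝ) → ℂ} (h : ∀ σ, Integrable (fun x => if pos x then Φ (rf σ x) else 0)) :
    Integrable Φ ∧ ∫ x, Φ x = ∑ σ : Fin n → Bool, ∫ x, if pos x then Φ (rf σ x) else 0 := by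
  have e : ∀ σ, (fun x => if pos (rf σ x) then Φ x else 0) = (fun x => if pos x then Φ (rf σ x) else 0) ∘ rf σ := by
    intro σ; funext x; simp [rf_rf]
  have h1 : ∀ σ, Integrable (fun x => if pos (rf σ x) then Φ x else 0) := by
    intro σ
    rw [e, (rf_mp σ).integrable_comp_emb (rf_emb σ)]
    exact h σ
  have h2 : ∀ σ, ∫ x, (if pos (rf σ x) then Φ x else 0) = ∫ x, if pos x then Φ (rf σ x) else 0 := by
    intro σ
    rw [e]
    exact (rf_mp σ).integral_comp (rf_emb σ) (fun x => if pos x then Φ (rf σ x) else 0)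
  have h3 : Φ =ᵐ[volume] fun x => ∑ σ, if pos (rf σ x) then Φ x else 0 := by
    filter_upwards [ae_coord_ne] with x hx
    rw [Finset.sum_eq_single (fun i => decide (0 < x i))]
    · rw [if_pos]
      intro i
      simp only [rf, sg]
      by_cases hi : 0 < x i
      · simp [hi]
      · simp [hi]; exact lt_of_le_of_ne (not_lt.1 hi) (hx i)
    · intro σ _ hσ
      rw [if_neg]
      intro hp
      apply hσ
      funext i
      have := hp i
      simp only [rf, sg] at this
      cases hs : σ i
      · simp [hs] at this; simp [this.le]
      · simp [hs] at this; simp [this]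
    · simp
  refine ⟨(integrable_finsetSum _ fun σ _ => h1 σ).congr h3.symm, ?_⟩
  rw [integral_congr_ae h3, integral_finsetSum _ fun σ _ => h1 σ]
  exact Finset.sum_congr rfl fun σ _ => h2 σ

theorem mono_rf (a : Fin n → ℕ) (σ : Fin n → Bool) (x : Fin n → ℝ) : mono a (rf σ x) = mono a (fun i => sg (σ i)) * mono a x := by
  simp [mono, rf, mul_pow, Finset.prod_mul_distrib]

theorem mono_sg_abs (a : Fin n → ℕ) (σ : Fin n → Bool) : |mono a (fun i => sg (σ i))| = 1 := by
  simp [mono, Finset.abs_prod, abs_pow, sg_abs]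

theorem mono_pos (a : Fin n → ℕ) {x : Fin n → ℝ} (h : pos x) : 0 < mono a x :=
  Finset.prod_pos fun i _ => pow_pos (h i) _

theorem abs_ext {u : (Fin n → ℝ) → ℝ} (hu : AnalyticAt ℝ u 0) (h0 : u 0 ≠ 0) : AnalyticAt ℝ (fun x => |u x|) 0 ∧ ∀ᶠ x in 𝓝 0, SignType.sign (u x) = SignType.sign (u 0) := by
  rcases lt_or_gt_of_ne h0 with h | h
  · have := hu.continuousAt.eventually_lt_const h
    exact ⟨hu.neg.congr (by filter_upwards [this] with x hx; simp [abs_of_neg hx]), by filter_upwards [this] with x hx; rw [sign_neg hx, sign_neg h]⟩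
  · have := hu.continuousAt.eventually_const_lt h
    exact ⟨hu.congr (by filter_upwards [this] with x hx; simp [abs_of_pos hx]), by filter_upwards [this] with x hx; rw [sign_pos hx, sign_pos h]⟩

theorem leaf_good {ι : Type*} [Fintype ι] {f J : (Fin n → ℝ) → ℝ} {g : ι → (Fin n → ℝ) → ℝ} (A : Set (ι → SignType))
    (hf : NC f) (hJ : NC J) (hg : ∀ i, NC (g i)) : Good f J g A := by
  classical
  obtain ⟨a, u, hu, hu0, hf⟩ := hf
  obtain ⟨b, w, hw, hw0, hJ⟩ := hJ
  choose c v hv hv0 hg using hg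
  have hul := (abs_ext hu hu0).1
  have hlog : AnalyticAt ℝ (fun x => Real.log |u x|) 0 := AnalyticAt.comp (g := Real.log) (analyticAt_log (abs_pos.2 hu0)) hul
  obtain ⟨ℓ, hℓ, eℓ⟩ := smooth_ext hlog
  obtain ⟨ω, hω, eω⟩ := smooth_ext (abs_ext hw hw0).1
  have hev : ∀ᶠ x in 𝓝 0, (f x = mono a x * u x ∧ J x = mono b x * w x) ∧ (ℓ x = Real.log |u x| ∧ ω x = |w x|) ∧ u x ≠ 0 ∧ ∀ i, g i x = mono (c i) x * v i x ∧ SignType.sign (v i x) = SignType.sign (v i 0) := by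
    filter_upwards [hf.and hJ, eℓ.and eω, hu.continuousAt.eventually_ne hu0, eventually_all.2 fun i => (hg i).and (abs_ext (hv i) (hv0 i)).2] with x h1 h2 h3 h4
    exact ⟨h1, h2, h3, h4⟩
  obtain ⟨ε, hε, hball⟩ := Metric.eventually_nhds_iff_ball.1 hev
  refine ⟨ε / 2, by positivity, fun φ hφ hsupp => ?_⟩
  let S : (Fin n → Bool) → ι → SignType := fun σ i => SignType.sign (mono (c i) (fun k => sg (σ k))) * SignType.sign (v i 0)
  have key : ∀ (s : ℂ) σ x, (if pos x then (φ (rf σ x) : ℂ) * kern f J g A s (rf σ x) else 0) =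
      if S σ ∈ A then TT (fun k => a k * s + b k) x * (cexp (s * ℓ (rf σ x)) * (φ (rf σ x) * ω (rf σ x) : ℝ)) else 0 := by
    intro s σ x
    by_cases hx : pos x
    swap
    · simp [hx, TT_npos hx]
    by_cases hr : ε / 2 < ‖rf σ x‖
    · simp [hsupp _ hr]
    obtain ⟨⟨h1, h2⟩, ⟨h3, h4⟩, h5, h6⟩ := hball (rf σ x) (by rw [mem_ball_zero_iff]; linarith)
    have hs : (fun i => SignType.sign (g i (rf σ x))) = S σ := by
      funext i
      rw [(h6 i).1, sign_mul, (h6 i).2, mono_rf, sign_mul, sign_pos (mono_pos (c i) hx), mul_one]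
    rw [if_pos hx, kern, hs]
    by_cases hA : S σ ∈ A
    swap
    · simp [hA]
    rw [if_pos hA, if_pos hA, TT_pos hx, h1, h2, abs_mul, abs_mul, mono_rf, mono_rf, abs_mul, abs_mul, mono_sg_abs, mono_sg_abs, one_mul, one_mul,
      abs_of_pos (mono_pos a hx), abs_of_pos (mono_pos b hx), ← h4]
    have hpos : 0 < mono a x * |u (rf σ x)| := mul_pos (mono_pos a hx) (abs_pos.2 h5)
    have hlg : Real.log (mono a x * |u (rf σ x)|) = (∑ k, a k * Real.log (x k)) + ℓ (rf σ x) := by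
      rw [Real.log_mul (mono_pos a hx).ne' (abs_pos.2 h5).ne', h3, mono, Real.log_prod (fun i _ => (pow_pos (hx i) _).ne')]
      simp [Real.log_pow]
    rw [cpow_def_of_ne_zero (by exact_mod_cast hpos.ne'), ← ofReal_log hpos.le, hlg]
    push_cast
    rw [add_mul, Complex.exp_add, mul_comm _ s, mul_comm _ s]
    ring
  have hc1 : ∀ σ, ContDiff ℝ (⊤ : ℕ∞) fun x => ℓ (rf σ x) := fun σ => hℓ.comp (rf_smooth σ)
  have hc2 : ∀ σ, ContDiff ℝ (⊤ : ℕ∞) fun x => φ (rf σ x) * ω (rf σ x) := fun σ => (hφ.mul hω).comp (rf_smooth σ)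
  have hc3 : ∀ σ, HasCompactSupport fun x => φ (rf σ x) * ω (rf σ x) := fun σ => by
    refine HasCompactSupport.of_support_subset_isCompact (isCompact_closedBall 0 (ε / 2)) ?_
    intro x hx
    rw [mem_closedBall_zero_iff]
    by_contra hcon
    apply hx
    simp only [hsupp (rf σ x) (by rw [rf_norm]; linarith), zero_mul]
  have hint : ∀ (s : ℂ), 0 < s.re → ∀ σ, Integrable fun x => if pos x then (φ (rf σ x) : ℂ) * kern f J g A s (rf σ x) else 0 := by
    intro s hs σ
    simp only [key]
    by_cases hA : S σ ∈ A
    · simp only [hA, if_true]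
      exact EE_int a b (hc1 σ).continuous (hc2 σ).continuous (hc3 σ) hs.le
    · simp only [hA, if_false]; exact integrable_zero _ _ _
  refine ⟨fun s hs => (refl_sum (Φ := fun x => φ x * kern f J g A s x) (hint s hs)).1, ?_⟩
  refine MM.congr (Z := fun s => ∑ σ : Fin n → Bool, if S σ ∈ A then EE a b (fun x => ℓ (rf σ x)) (fun x => φ (rf σ x) * ω (rf σ x)) s else 0) ?_ fun s hs => ?_
  · refine MM.sum _ fun σ _ => ?_
    by_cases hA : S σ ∈ A
    · simp only [hA, if_true]
      exact EE_MM a b (hc1 σ) (hc2 σ) (hc3 σ)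
    · simp only [hA, if_false]; exact MM.zero
  · rw [(refl_sum (Φ := fun x => φ x * kern f J g A s x) (hint s hs)).2]
    refine Finset.sum_congr rfl fun σ _ => ?_
    simp only [key]
    by_cases hA : S σ ∈ A
    · simp only [hA, if_true]; rfl
    · simp only [hA, if_false]; simp
end

section
open Filter Topology
variable {n : ℕ}

def updL (i : Fin n) (L : (Fin n → ℝ) →L[ℝ] ℝ) : (Fin n → ℝ) →L[ℝ] (Fin n → ℝ) :=
  ContinuousLinearMap.pi fun j => if j = i then L else ContinuousLinearMap.proj j

theorem updL_det (i : Fin n) (L : (Fin n → ℝ) →L[ℝ] ℝ) : (updL i L).det = L (Pi.single i 1) := by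
  classical
  rw [ContinuousLinearMap.det, ← LinearMap.det_toMatrix']
  have : LinearMap.toMatrix' (updL i L : (Fin n → ℝ) →ₗ[ℝ] (Fin n → ℝ)) = ((1 : Matrix (Fin n) (Fin n) ℝ).updateCol i (fun k => L (Pi.single k 1))).transpose := by
    ext j k
    rw [LinearMap.toMatrix'_apply, Matrix.transpose_apply]
    by_cases h : j = i
    · subst h; simp [updL]
    · simp [updL, h, Matrix.updateCol_ne, Matrix.one_apply, Pi.single_apply, eq_comm, Ne.symm h]
  rw [this, Matrix.det_transpose, ← Matrix.cramer_apply, Matrix.cramer_one]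
  rfl

theorem cov_update {u : (Fin n → ℝ) → ℝ} {u' : (Fin n → ℝ) → (Fin n → ℝ) →L[ℝ] ℝ} {W : Set (Fin n → ℝ)} (i : Fin n) (hW : MeasurableSet W)
    (hu : ∀ x ∈ W, HasFDerivAt u (u' x) x) (hinj : Set.InjOn (fun x => Function.update x i (u x)) W) (H : (Fin n → ℝ) → ℂ) :
    (IntegrableOn H ((fun x => Function.update x i (u x)) '' W) ↔ IntegrableOn (fun x => |u' x (Pi.single i 1)| • H (Function.update x i (u x))) W) ∧
    ∫ x in (fun x => Function.update x i (u x)) '' W, H x = ∫ x in W, |u' x (Pi.single i 1)| • H (Function.update x i (u x)) := by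
  have hd : ∀ x ∈ W, HasFDerivWithinAt (fun x => Function.update x i (u x)) (updL i (u' x)) W x := by
    intro x hx
    refine HasFDerivAt.hasFDerivWithinAt ?_
    rw [hasFDerivAt_pi']
    intro j
    by_cases h : j = i
    · subst h
      simp only [Function.update_self]
      exact (hu x hx).congr_fderiv (by ext y; simp [updL])
    · simp only [Function.update_of_ne h]
      exact HasFDerivAt.congr_fderiv (ContinuousLinearMap.proj (R := ℝ) (φ := fun _ : Fin n => ℝ) j).hasFDerivAt (by ext y; simp [updL, h])
  have h1 := integrableOn_image_iff_integrableOn_abs_det_fderiv_smul volume hW hd hinj H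
  have h2 := integral_image_eq_integral_abs_det_fderiv_smul volume hW hd hinj H
  simp only [updL_det] at h1 h2
  exact ⟨h1, h2⟩

theorem blow_cov (i j : Fin n) (hij : i ≠ j) (t : ℝ) (G : (Fin n → ℝ) → ℂ) (h : Integrable fun x => ((|x j| : ℝ) : ℂ) * G (bl i j t x)) :
    Integrable G ∧ ∫ x, G x = ∫ x, ((|x j| : ℝ) : ℂ) * G (bl i j t x) := by
  let W : Set (Fin n → ℝ) := {x | x j ≠ 0}
  have hW : MeasurableSet W := measurableSet_preimage (f := fun x : Fin n → ℝ => x j) (by fun_prop) (measurableSet_singleton (0:ℝ)).compl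
  have hWae : W =ᵐ[volume] Set.univ := by
    rw [ae_eq_univ]
    exact (measure_eq_zero_iff_ae_notMem.2 (by filter_upwards [ae_coord_ne (n := n)] with x hx; simpa [W] using hx j))
  have himg : (fun x => Function.update x i ((x i + t) * x j)) '' W = W := by
    ext y
    constructor
    · rintro ⟨x, hx, rfl⟩
      simpa [W, hij.symm] using hx
    · intro hy
      have hy' : y j ≠ 0 := hy
      refine ⟨Function.update y i (y i / y j - t), by simpa [W, hij.symm] using hy, ?_⟩
      funext k
      by_cases hk : k = i
      · subst hk; simp [hij.symm]; field_simp
      · simp [hk]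
  have hinj : Set.InjOn (fun x : Fin n → ℝ => Function.update x i ((x i + t) * x j)) W := by
    intro x hx y hy hxy
    have hk : ∀ k, k ≠ i → x k = y k := fun k hk => by simpa [hk] using congrFun hxy k
    funext k
    by_cases h : k = i
    · subst h
      have := congrFun hxy k
      simp only [Function.update_self] at this
      rw [hk j hij.symm] at this
      have := mul_right_cancel₀ (show y j ≠ 0 from hy) this
      linarith
    · exact hk k h
  have hu : ∀ x ∈ W, HasFDerivAt (fun x : Fin n → ℝ => (x i + t) * x j) ((x i + t) • (ContinuousLinearMap.proj (R := ℝ) (φ := fun _ : Fin n => ℝ) j) + x j • (ContinuousLinearMap.proj (R := ℝ) (φ := fun _ : Fin n => ℝ) i)) x := fun x _ =>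
    ((ContinuousLinearMap.proj (R := ℝ) (φ := fun _ : Fin n => ℝ) i).hasFDerivAt.add_const t).mul (ContinuousLinearMap.proj (R := ℝ) (φ := fun _ : Fin n => ℝ) j).hasFDerivAt
  obtain ⟨h1, h2⟩ := cov_update i hW hu hinj G
  rw [himg] at h1 h2
  have e : (fun x : Fin n → ℝ => |((x i + t) • (ContinuousLinearMap.proj (R := ℝ) (φ := fun _ : Fin n => ℝ) j) + x j • (ContinuousLinearMap.proj (R := ℝ) (φ := fun _ : Fin n => ℝ) i)) (Pi.single i 1)| • G (Function.update x i ((x i + t) * x j))) = fun x => ((|x j| : ℝ) : ℂ) * G (bl i j t x) := by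
    funext x
    simp [hij, hij.symm, bl]
  rw [e] at h1 h2
  rw [setIntegral_congr_set hWae, setIntegral_congr_set hWae, setIntegral_univ, setIntegral_univ] at h2
  refine ⟨?_, h2⟩
  have := h1.2 h.integrableOn
  rwa [integrableOn_congr_set_ae hWae, integrableOn_univ] at this

theorem shear_cov (i : Fin n) {c : (Fin n → ℝ) → ℝ} (hc : ContDiff ℝ (⊤ : ℕ∞) c) (hci : ∀ x t, c (Function.update x i t) = c x) (G : (Fin n → ℝ) → ℂ)
    (h : Integrable fun x => G (sh i c x)) :
    Integrable G ∧ ∫ x, G x = ∫ x, G (sh i c x) := by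
  have himg : (fun x => Function.update x i (x i + c x)) '' Set.univ = Set.univ := by
    rw [Set.image_univ, Set.range_eq_univ]
    intro y
    refine ⟨Function.update y i (y i - c y), ?_⟩
    simp [hci]
  have hinj : Set.InjOn (fun x : Fin n → ℝ => Function.update x i (x i + c x)) Set.univ := by
    intro x hx y hy hxy
    have hk : ∀ k, k ≠ i → x k = y k := fun k hk => by simpa [hk] using congrFun hxy k
    have hxy' : x = Function.update y i (x i) := by
      funext k
      by_cases h : k = i
      · subst h; simp
      · simp [h, hk k h]
    have hcc : c x = c y := by rw [hxy', hci]
    have := congrFun hxy i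
    simp only [Function.update_self, hcc] at this
    rw [hxy', show x i = y i by linarith, Function.update_eq_self]
  have hu : ∀ x ∈ Set.univ, HasFDerivAt (fun x : Fin n → ℝ => x i + c x) ((ContinuousLinearMap.proj (R := ℝ) (φ := fun _ : Fin n => ℝ) i) + fderiv ℝ c x) x := fun x _ =>
    ((ContinuousLinearMap.proj (R := ℝ) (φ := fun _ : Fin n => ℝ) i).hasFDerivAt.add ((hc.differentiable (by simp)) x).hasFDerivAt)
  obtain ⟨h1, h2⟩ := cov_update i MeasurableSet.univ hu hinj G
  rw [himg] at h1 h2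
  have hz : ∀ x, fderiv ℝ c x (Pi.single i 1) = 0 := by
    intro x
    have h3 : HasDerivAt (fun t : ℝ => c (x + t • Pi.single i 1)) (dd i c x) 0 := dd_line i hc x
    have h4 : (fun t : ℝ => c (x + t • Pi.single i 1)) = fun _ => c x := by
      funext t
      rw [← hci x (x i + t)]
      congr 1
      funext k
      by_cases h : k = i
      · subst h; simp
      · simp [h]
    rw [h4] at h3
    exact h3.unique (hasDerivAt_const _ _)
  simp only [integrableOn_univ, setIntegral_univ, ContinuousLinearMap.add_apply, hz] at h1 h2
  simp only [ContinuousLinearMap.proj_apply, Pi.single_eq_same, add_zero, abs_one, one_smul] at h1 h2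
  exact ⟨h1.2 h, h2⟩

theorem pow_cov (i : Fin n) (ε : ℝ) (hε : ε = 1 ∨ ε = -1) (k : ℕ) (hk : 0 < k) (G : (Fin n → ℝ) → ℂ)
    (h : IntegrableOn (fun x => ((k * |x i| ^ (k - 1) : ℝ) : ℂ) * G (pw i ε k x)) {x | 0 < x i}) :
    IntegrableOn G {x | 0 < ε * x i} ∧ ∫ x in {x : Fin n → ℝ | 0 < ε * x i}, G x = ∫ x in {x | 0 < x i}, ((k * |x i| ^ (k - 1) : ℝ) : ℂ) * G (pw i ε k x) := by
  have hεε : ε * ε = 1 := by rcases hε with rfl | rfl <;> norm_num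
  have hεa : |ε| = 1 := by rcases hε with rfl | rfl <;> norm_num
  let W : Set (Fin n → ℝ) := {x | 0 < x i}
  have hW : MeasurableSet W := measurableSet_lt measurable_const (measurable_pi_apply i)
  have himg : (fun x => Function.update x i (ε * x i ^ k)) '' W = {x | 0 < ε * x i} := by
    ext y
    constructor
    · rintro ⟨x, hx, rfl⟩
      simp only [Set.mem_setOf_eq, Function.update_self]
      rw [← mul_assoc, hεε, one_mul]
      exact pow_pos hx k
    · intro hy
      have hy' : 0 < ε * y i := hy
      refine ⟨Function.update y i ((ε * y i) ^ ((k : ℝ)⁻¹)), ?_, ?_⟩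
      · simp only [W, Set.mem_setOf_eq, Function.update_self]
        positivity
      · simp only [Function.update_self, Function.update_idem]
        rw [Real.rpow_inv_natCast_pow hy'.le hk.ne', ← mul_assoc, hεε, one_mul, Function.update_eq_self]
  have hinj : Set.InjOn (fun x : Fin n → ℝ => Function.update x i (ε * x i ^ k)) W := by
    intro x hx y hy hxy
    funext l
    by_cases h : l = i
    · subst h
      have := congrFun hxy l
      simp only [Function.update_self] at this
      have := mul_left_cancel₀ (show ε ≠ 0 by rintro rfl; simp at hεε) this
      exact (pow_left_inj₀ (le_of_lt hx) (le_of_lt hy) hk.ne').1 this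
    · simpa [h] using congrFun hxy l
  have hu : ∀ x ∈ W, HasFDerivAt (fun x : Fin n → ℝ => ε * x i ^ k) (ε • ((k * x i ^ (k - 1)) • (ContinuousLinearMap.proj (R := ℝ) (φ := fun _ : Fin n => ℝ) i))) x := fun x _ => by
    have := ((ContinuousLinearMap.proj (R := ℝ) (φ := fun _ : Fin n => ℝ) i).hasFDerivAt (x := x)).pow k
    have := this.const_mul ε
    simpa using this
  obtain ⟨h1, h2⟩ := cov_update i hW hu hinj G
  rw [himg] at h1 h2
  have e : (fun x : Fin n → ℝ => |(ε • ((k * x i ^ (k - 1)) • (ContinuousLinearMap.proj (R := ℝ) (φ := fun _ : Fin n => ℝ) i))) (Pi.single i 1)| • G (Function.update x i (ε * x i ^ k))) = fun x => ((k * |x i| ^ (k - 1) : ℝ) : ℂ) * G (pw i ε k x) := by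
    funext x
    simp [pw, abs_mul, hεa, abs_pow]
  rw [e] at h1 h2
  exact ⟨h1.2 h, h2⟩
end

section
open Filter Topology
variable {n : ℕ}

theorem bump_exists (r : ℝ) (hr : 0 < r) : ∃ χ : ℝ → ℝ, ContDiff ℝ (⊤ : ℕ∞) χ ∧ (∀ t, χ t ≠ 0 → |t| < r) ∧ (∀ t, |t| ≤ r / 2 → χ t = 1) := by
  let b : ContDiffBump (0 : ℝ) := ⟨r / 2, r, by positivity, by linarith⟩
  refine ⟨b, b.contDiff, fun t ht => ?_, fun t ht => ?_⟩
  · have : t ∈ Function.support b := ht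
    rw [b.support_eq] at this
    simpa using this
  · exact b.one_of_mem_closedBall (by simpa using ht)

theorem eta_exists {χ : ℝ → ℝ} (hχ : ContDiff ℝ (⊤ : ℕ∞) χ) {r : ℝ} (hr : 0 < r) (h1 : ∀ t, χ t ≠ 0 → |t| < r) (h2 : ∀ t, |t| ≤ r / 2 → χ t = 1) :
    ∃ η : ℝ → ℝ, ContDiff ℝ (⊤ : ℕ∞) η ∧ (∀ t, t ≠ 0 → η t + χ (t⁻¹) = 1) ∧ ∀ t, 2 / r ≤ |t| → η t = 0 := by
  refine ⟨fun t => if t = 0 then 1 else 1 - χ t⁻¹, ?_, fun t ht => by simp [ht], fun t ht => ?_⟩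
  · rw [contDiff_iff_contDiffAt]
    intro t
    by_cases ht : t = 0
    · subst ht
      refine (contDiffAt_const (c := (1 : ℝ))).congr_of_eventuallyEq ?_
      filter_upwards [Metric.ball_mem_nhds (0:ℝ) (inv_pos.2 hr)] with y hy
      by_cases h0 : y = 0
      · simp [h0]
      · simp only [h0, if_false]
        have : χ y⁻¹ = 0 := by
          by_contra hc
          have := h1 _ hc
          rw [mem_ball_zero_iff, Real.norm_eq_abs] at hy
          rw [abs_inv, inv_lt_comm₀ (abs_pos.2 h0) hr] at this
          linarith
        rw [this, sub_zero]
    · have : ContDiffAt ℝ (⊤ : ℕ∞) (fun t => 1 - χ t⁻¹) t := contDiffAt_const.sub (hχ.contDiffAt.comp t (contDiffAt_inv ℝ ht))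
      refine this.congr_of_eventuallyEq ?_
      filter_upwards [isOpen_ne.mem_nhds ht] with y hy
      simp only [show y ≠ 0 from hy, if_false]
  · have h0 : t ≠ 0 := by
      rintro rfl
      simp at ht
      have : 0 < 2 / r := by positivity
      linarith
    simp only [h0, if_false]
    rw [h2, sub_self]
    rw [abs_inv, inv_le_comm₀ (abs_pos.2 h0) (by positivity), inv_div]
    exact ht

theorem Dv.comp_bare {F L X : (Fin n → ℝ) → ℝ} {Ψ : (Fin n → ℝ) → (Fin n → ℝ)} (h : Dv F L)
    (hF : AnalyticAt ℝ F 0)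
    (hX : AnalyticAt ℝ X 0) (hΨ : AnalyticAt ℝ Ψ 0) (h0 : Ψ 0 = 0) :
    Dv (fun x => X x * F (Ψ x)) (fun x => L (Ψ x)) := by
  simpa using h.comp hF hX hΨ h0 0

theorem bl_norm {i j : Fin n} {t : ℝ} {x : Fin n → ℝ} {r R : ℝ} (hi : |x i| ≤ R) (h : ‖bl i j t x‖ ≤ r) (hr : r ≤ R) (hR : 0 ≤ R) : ‖x‖ ≤ R := by
  rw [pi_norm_le_iff_of_nonneg hR]
  intro k
  by_cases hk : k = i
  · subst hk; exact hi
  · have := (norm_le_pi_norm (bl i j t x) k).trans h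
    simp only [bl, Function.update_of_ne hk] at this
    exact this.trans hr

theorem bl_smooth (i j : Fin n) (t : ℝ) : ContDiff ℝ (⊤ : ℕ∞) (bl i j t) := by
  rw [contDiff_pi]
  intro k
  by_cases hk : k = i
  · subst hk; simp only [bl, Function.update_self]; fun_prop
  · simp only [bl, Function.update_of_ne hk]; fun_prop

theorem pw_smooth (i : Fin n) (ε : ℝ) (m : ℕ) : ContDiff ℝ (⊤ : ℕ∞) (pw i ε m) := by
  rw [contDiff_pi]
  intro k
  by_cases hk : k = i
  · subst hk; simp only [pw, Function.update_self]; fun_prop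
  · simp only [pw, Function.update_of_ne hk]; fun_prop

theorem kern_bl {ι : Type} (f J : (Fin n → ℝ) → ℝ) (g : ι → (Fin n → ℝ) → ℝ) (A : Set (ι → SignType)) (i j : Fin n) (t : ℝ) (s : ℂ) (x : Fin n → ℝ) :
    kern (fun x => f (bl i j t x)) (fun x => x j * J (bl i j t x)) (fun l x => g l (bl i j t x)) A s x = ((|x j| : ℝ) : ℂ) * kern f J g A s (bl i j t x) := by
  unfold kern
  split_ifs
  · rw [abs_mul]; push_cast; ring
  · simp

theorem good_blow {ι : Type} [Fintype ι] {f J : (Fin n → ℝ) → ℝ} {g : ι → (Fin n → ℝ) → ℝ} {A : Set (ι → SignType)} {i j : Fin n} (hij : i ≠ j)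
    (h1 : ∀ t, Good (fun x => f (bl i j t x)) (fun x => x j * J (bl i j t x)) (fun l x => g l (bl i j t x)) A)
    (h2 : Good (fun x => f (bl j i 0 x)) (fun x => x i * J (bl j i 0 x)) (fun l x => g l (bl j i 0 x)) A) : Good f J g A := by
  classical
  choose R hR0 hR using h1
  obtain ⟨q, hq0, hq⟩ := h2
  obtain ⟨χ, hχ, hχ1, hχ2⟩ := bump_exists q hq0
  obtain ⟨η, hη, hη1, hη2⟩ := eta_exists hχ hq0 hχ1 hχ2
  obtain ⟨T, ρ, hT, hρ, hρ1, hρ2⟩ := pou (isCompact_closedBall (0:ℝ) (2 / q)) (fun t => Metric.ball t (R t)) (fun t _ => Metric.ball_mem_nhds t (hR0 t))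
  obtain ⟨r, hr0, hrq, hrT⟩ : ∃ r : ℝ, 0 < r ∧ r ≤ q ∧ ∀ t ∈ T, r ≤ R t := by
    clear hρ1 hρ2 hT
    induction T using Finset.induction_on with
    | empty => exact ⟨q, hq0, le_rfl, by simp⟩
    | insert a T ha ih =>
      obtain ⟨r, h1, h2, h3⟩ := ih
      refine ⟨min r (R a), lt_min h1 (hR0 a), (min_le_left _ _).trans h2, fun t ht => ?_⟩
      rcases Finset.mem_insert.1 ht with rfl | ht
      · exact min_le_right _ _
      · exact (min_le_left _ _).trans (h3 t ht)
  refine ⟨r, hr0, fun φ hφ hsupp => ?_⟩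
  -- pieces
  let G : ℝ → ℂ → (Fin n → ℝ) → ℂ := fun t s x => (φ x * (ρ t (x i / x j) * η (x i / x j)) : ℝ) * kern f J g A s x
  let G' : ℂ → (Fin n → ℝ) → ℂ := fun s x => (φ x * χ (x j / x i) : ℝ) * kern f J g A s x
  have P1 : ∀ t ∈ T, (∀ s : ℂ, 0 < s.re → Integrable (G t s)) ∧ MM n fun s => ∫ x, G t s x := by
    intro t ht
    obtain ⟨k1, k2⟩ := hR t (fun x => φ (bl i j t x) * (ρ t (x i + t) * η (x i + t)))
      ((hφ.comp (bl_smooth i j t)).mul (((hρ t).comp (by fun_prop)).mul (hη.comp (by fun_prop)))) (by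
        intro x hx
        by_contra hne
        have a1 : φ (bl i j t x) ≠ 0 := fun h => hne (by simp [h])
        have a2 : ρ t (x i + t) ≠ 0 := fun h => hne (by simp [h])
        have a3 := hρ1 t ht _ a2
        simp only [Metric.mem_ball, dist_add_self_left, Real.norm_eq_abs] at a3
        have a4 : ‖bl i j t x‖ ≤ r := by
          by_contra hc; exact a1 (hsupp _ (not_le.1 hc))
        have := bl_norm a3.le a4 (hrT t ht) (hR0 t).le
        linarith)
    have e : ∀ s, (fun x => ((φ (bl i j t x) * (ρ t (x i + t) * η (x i + t)) : ℝ) : ℂ) * kern (fun x => f (bl i j t x)) (fun x => x j * J (bl i j t x)) (fun l x => g l (bl i j t x)) A s x) = fun x => ((|x j| : ℝ) : ℂ) * G t s (bl i j t x) := by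
      intro s; funext x
      rw [kern_bl]
      by_cases hx : x j = 0
      · simp [hx]
      · have : bl i j t x i / bl i j t x j = x i + t := by
          simp [bl, hij.symm]; field_simp
        simp only [G, this]
        ring
    simp only [e] at k1 k2
    exact ⟨fun s hs => (blow_cov i j hij t (G t s) (k1 s hs)).1, k2.congr fun s hs => (blow_cov i j hij t (G t s) (k1 s hs)).2⟩
  have P2 : (∀ s : ℂ, 0 < s.re → Integrable (G' s)) ∧ MM n fun s => ∫ x, G' s x := by
    obtain ⟨k1, k2⟩ := hq (fun x => φ (bl j i 0 x) * χ (x j))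
      ((hφ.comp (bl_smooth j i 0)).mul (hχ.comp (by fun_prop))) (by
        intro x hx
        by_contra hne
        have a1 : φ (bl j i 0 x) ≠ 0 := fun h => hne (by simp [h])
        have a2 : χ (x j) ≠ 0 := fun h => hne (by simp [h])
        have a3 := hχ1 _ a2
        have a4 : ‖bl j i 0 x‖ ≤ r := by
          by_contra hc; exact a1 (hsupp _ (not_le.1 hc))
        have := bl_norm a3.le a4 hrq hq0.le
        linarith)
    have e : ∀ s, (fun x => ((φ (bl j i 0 x) * χ (x j) : ℝ) : ℂ) * kern (fun x => f (bl j i 0 x)) (fun x => x i * J (bl j i 0 x)) (fun l x => g l (bl j i 0 x)) A s x) = fun x => ((|x i| : ℝ) : ℂ) * G' s (bl j i 0 x) := by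
      intro s; funext x
      rw [kern_bl]
      by_cases hx : x i = 0
      · simp [hx]
      · have : bl j i 0 x j / bl j i 0 x i = x j := by
          simp [bl, hij]; field_simp
        simp only [G', this]
        ring
    simp only [e] at k1 k2
    exact ⟨fun s hs => (blow_cov j i hij.symm 0 (G' s) (k1 s hs)).1, k2.congr fun s hs => (blow_cov j i hij.symm 0 (G' s) (k1 s hs)).2⟩
  have hsum : ∀ s, (fun x => (φ x : ℂ) * kern f J g A s x) =ᵐ[volume] fun x => ∑ t ∈ T, G t s x + G' s x := by
    intro s
    filter_upwards [ae_coord_ne (n := n)] with x hx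
    have h0 : x i / x j ≠ 0 := div_ne_zero (hx i) (hx j)
    have e1 : ∑ t ∈ T, ρ t (x i / x j) * η (x i / x j) = η (x i / x j) := by
      rw [← Finset.sum_mul]
      by_cases hb : x i / x j ∈ Metric.closedBall (0:ℝ) (2 / q)
      · rw [hρ2 _ hb, one_mul]
      · rw [hη2, mul_zero]
        rw [mem_closedBall_zero_iff, Real.norm_eq_abs] at hb
        linarith
    have e2 := hη1 _ h0
    rw [inv_div] at e2
    simp only [G, G']
    rw [← Finset.sum_mul, ← add_mul, ← ofReal_sum, ← Finset.mul_sum, e1, ← ofReal_add, ← mul_add, e2, mul_one]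
  refine ⟨fun s hs => ?_, ?_⟩
  · exact ((integrable_finsetSum _ fun t ht => (P1 t ht).1 s hs).add (P2.1 s hs)).congr (hsum s).symm
  · refine ((MM.sum T fun t ht => (P1 t ht).2).add P2.2).congr fun s hs => ?_
    rw [integral_congr_ae (hsum s), integral_add (integrable_finsetSum _ fun t ht => (P1 t ht).1 s hs) (P2.1 s hs), integral_finsetSum _ fun t ht => (P1 t ht).1 s hs]
end

section
open Filter Topology
variable {n : ℕ}

def gopt {ι : Type} (i : Fin n) (ε : ℝ) (m : ℕ) (g : ι → (Fin n → ℝ) → ℝ) : Option ι → (Fin n → ℝ) → ℝ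
  | none => fun x => x i
  | some l => fun x => g l (pw i ε m x)

def Aopt {ι : Type} (A : Set (ι → SignType)) : Set (Option ι → SignType) := {σ | σ none = 1 ∧ (fun l => σ (some l)) ∈ A}

theorem good_pow1 {ι : Type} [Fintype ι] {f J : (Fin n → ℝ) → ℝ} {g : ι → (Fin n → ℝ) → ℝ} {A : Set (ι → SignType)} (i : Fin n) (ε : ℝ) (hε : ε = 1 ∨ ε = -1) (m : ℕ) (hm : 0 < m)
    (h : Good (fun x => f (pw i ε m x)) (fun x => x i ^ (m - 1) * J (pw i ε m x)) (gopt i ε m g) (Aopt A)) :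
    ∃ r : ℝ, 0 < r ∧ ∀ φ : (Fin n → ℝ) → ℝ, ContDiff ℝ (⊤ : ℕ∞) φ → (∀ x, r < ‖x‖ → φ x = 0) →
    (∀ s : ℂ, 0 < s.re → IntegrableOn (fun x => φ x * kern f J g A s x) {x | 0 < ε * x i}) ∧ MM n (fun s => ∫ x in {x : Fin n → ℝ | 0 < ε * x i}, φ x * kern f J g A s x) := by
  classical
  obtain ⟨q, hq0, hq⟩ := h
  refine ⟨min q (q ^ m), by positivity, fun φ hφ hsupp => ?_⟩
  have hεa : |ε| = 1 := by rcases hε with rfl | rfl <;> norm_num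
  obtain ⟨k1, k2⟩ := hq (fun x => m * φ (pw i ε m x)) (contDiff_const.mul (hφ.comp (pw_smooth i ε m))) (by
    intro x hx
    by_contra hne
    have a1 : φ (pw i ε m x) ≠ 0 := fun h => hne (by simp [h])
    have a4 : ‖pw i ε m x‖ ≤ min q (q ^ m) := by
      by_contra hc; exact a1 (hsupp _ (not_le.1 hc))
    have : ‖x‖ ≤ q := by
      rw [pi_norm_le_iff_of_nonneg hq0.le]
      intro k
      have a5 := (norm_le_pi_norm (pw i ε m x) k).trans a4
      by_cases hk : k = i
      · subst hk
        simp only [pw, Function.update_self, norm_mul, Real.norm_eq_abs, hεa, one_mul, abs_pow] at a5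
        exact (pow_le_pow_iff_left₀ (abs_nonneg _) hq0.le hm.ne').1 (a5.trans (min_le_right _ _))
      · simp only [pw, Function.update_of_ne hk] at a5
        exact a5.trans (min_le_left _ _)
    linarith)
  have e : ∀ s, (fun x => ((m * φ (pw i ε m x) : ℝ) : ℂ) * kern (fun x => f (pw i ε m x)) (fun x => x i ^ (m - 1) * J (pw i ε m x)) (gopt i ε m g) (Aopt A) s x) =
      Set.indicator {x | 0 < x i} fun x => ((m * |x i| ^ (m - 1) : ℝ) : ℂ) * (φ (pw i ε m x) * kern f J g A s (pw i ε m x)) := by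
    intro s; funext x
    by_cases hx : 0 < x i
    · rw [Set.indicator_of_mem (show x ∈ {x : Fin n → ℝ | 0 < x i} from hx)]
      have : ((fun l => SignType.sign (gopt i ε m g l x)) ∈ Aopt A) ↔ (fun l => SignType.sign (g l (pw i ε m x))) ∈ A := by
        simp [Aopt, gopt, sign_pos hx]
      unfold kern
      simp only [this]
      split_ifs
      · rw [abs_mul, abs_pow]; push_cast; ring
      · simp
    · rw [Set.indicator_of_notMem (show x ∉ {x : Fin n → ℝ | 0 < x i} from hx)]
      have : ¬ ((fun l => SignType.sign (gopt i ε m g l x)) ∈ Aopt A) := by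
        simp only [Aopt, gopt, Set.mem_setOf_eq, not_and]
        intro h
        rw [sign_eq_one_iff] at h
        exact absurd h hx
      unfold kern
      rw [if_neg this, mul_zero]
  have hmeas : MeasurableSet {x : Fin n → ℝ | 0 < x i} := measurableSet_lt measurable_const (measurable_pi_apply i)
  simp only [e] at k1 k2
  simp only [integrable_indicator_iff hmeas, integral_indicator hmeas] at k1 k2
  have cov := fun s hs => pow_cov i ε hε m hm (fun x => φ x * kern f J g A s x) (k1 s hs)
  exact ⟨fun s hs => (cov s hs).1, k2.congr fun s hs => (cov s hs).2⟩

theorem good_pow {ι : Type} [Fintype ι] {f J : (Fin n → ℝ) → ℝ} {g : ι → (Fin n → ℝ) → ℝ} {A : Set (ι → SignType)} (i : Fin n) (m : ℕ) (hm : 0 < m)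
    (h1 : Good (fun x => f (pw i 1 m x)) (fun x => x i ^ (m - 1) * J (pw i 1 m x)) (gopt i 1 m g) (Aopt A))
    (h2 : Good (fun x => f (pw i (-1) m x)) (fun x => x i ^ (m - 1) * J (pw i (-1) m x)) (gopt i (-1) m g) (Aopt A)) : Good f J g A := by
  obtain ⟨r1, hr1, H1⟩ := good_pow1 i 1 (Or.inl rfl) m hm h1
  obtain ⟨r2, hr2, H2⟩ := good_pow1 i (-1) (Or.inr rfl) m hm h2
  refine ⟨min r1 r2, by positivity, fun φ hφ hs => ?_⟩
  obtain ⟨a1, a2⟩ := H1 φ hφ (fun x hx => hs x ((min_le_left _ _).trans_lt hx))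
  obtain ⟨b1, b2⟩ := H2 φ hφ (fun x hx => hs x ((min_le_right _ _).trans_lt hx))
  simp only [one_mul, neg_mul] at a1 a2 b1 b2
  have hae : (({x : Fin n → ℝ | 0 < x i} ∪ {x | 0 < -x i} : Set (Fin n → ℝ))) =ᵐ[volume] Set.univ := by
    rw [ae_eq_univ]
    refine measure_eq_zero_iff_ae_notMem.2 ?_
    filter_upwards [ae_coord_ne (n := n)] with x hx
    have := hx i
    simp only [Set.mem_compl_iff, not_not, Set.mem_union, Set.mem_setOf_eq, Left.neg_pos_iff]
    exact (lt_or_gt_of_ne this).symm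
  have hdisj : Disjoint {x : Fin n → ℝ | 0 < x i} {x | 0 < -x i} := by
    rw [Set.disjoint_left]
    intro x hx hx'
    simp only [Set.mem_setOf_eq] at hx hx'
    linarith
  have hmeas : MeasurableSet {x : Fin n → ℝ | 0 < -x i} := measurableSet_lt measurable_const (measurable_pi_apply i).neg
  refine ⟨fun s h => ?_, ?_⟩
  · have := (a1 s h).union (b1 s h)
    rwa [integrableOn_congr_set_ae hae, integrableOn_univ] at this
  · refine (a2.add b2).congr fun s h => ?_
    rw [← setIntegral_union hdisj hmeas (a1 s h) (b1 s h), setIntegral_congr_set hae, setIntegral_univ]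

theorem good_shear {ι : Type} [Fintype ι] {f J : (Fin n → ℝ) → ℝ} {g : ι → (Fin n → ℝ) → ℝ} {A : Set (ι → SignType)} (i : Fin n) {c : (Fin n → ℝ) → ℝ} (hc : AnalyticAt ℝ c 0)
    (hc0 : c 0 = 0) (hci : ∀ x v, c (Function.update x i v) = c x)
    (h : Good (fun x => f (sh i c x)) (fun x => J (sh i c x)) (fun l x => g l (sh i c x)) A) : Good f J g A := by
  classical
  obtain ⟨q, hq0, hq⟩ := h
  obtain ⟨k, hk, ek⟩ := smooth_ext hc
  let d : (Fin n → ℝ) → ℝ := fun x => k (Function.update x i 0)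
  have hupd : ContDiff ℝ (⊤ : ℕ∞) fun x : Fin n → ℝ => Function.update x i (0:ℝ) := by
    rw [contDiff_pi]
    intro l
    by_cases hl : l = i
    · subst hl; simp only [Function.update_self]; fun_prop
    · simp only [Function.update_of_ne hl]; fun_prop
  have hd : ContDiff ℝ (⊤ : ℕ∞) d := hk.comp hupd
  have hdi : ∀ x v, d (Function.update x i v) = d x := fun x v => by simp [d]
  have hed : ∀ᶠ x in 𝓝 0, d x = c x := by
    filter_upwards [(tendsto_upd0 i).eventually ek] with x hx
    simp only [d, hx, hci]
  have hd0 : d 0 = 0 := by rw [hed.self_of_nhds, hc0]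
  have hsm : ∀ {d : (Fin n → ℝ) → ℝ}, ContDiff ℝ (⊤ : ℕ∞) d → ContDiff ℝ (⊤ : ℕ∞) (sh i d) := by
    intro d hd
    rw [contDiff_pi]
    intro l
    by_cases hl : l = i
    · subst hl; simp only [sh, Function.update_self]; fun_prop
    · simp only [sh, Function.update_of_ne hl]; fun_prop
  have hinv : ∀ x, sh i (fun x => - d x) (sh i d x) = x := by
    intro x
    simp [sh, hdi]
  have htend : Tendsto (sh i fun x => - d x) (𝓝 0) (𝓝 0) := by
    have := (hsm (d := fun x => - d x) hd.neg).continuous.tendsto 0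
    rwa [sh_zero i _ (by simp [hd0])] at this
  have hev : ∀ᶠ y in 𝓝 0, d (sh i (fun x => - d x) y) = c (sh i (fun x => - d x) y) ∧ ‖sh i (fun x => - d x) y‖ < q := by
    refine (htend.eventually hed).and ?_
    filter_upwards [htend.eventually (Metric.ball_mem_nhds 0 hq0)] with y hy
    simpa using hy
  obtain ⟨ε, hε, hball⟩ := Metric.eventually_nhds_iff_ball.1 hev
  refine ⟨ε / 2, by positivity, fun φ hφ hsupp => ?_⟩
  have hx : ∀ x, φ (sh i d x) ≠ 0 → d x = c x ∧ ‖x‖ < q := by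
    intro x hx
    have : ‖sh i d x‖ ≤ ε / 2 := by
      by_contra hc; exact hx (hsupp _ (not_le.1 hc))
    have := hball (sh i d x) (by rw [mem_ball_zero_iff]; linarith)
    rwa [hinv] at this
  obtain ⟨k1, k2⟩ := hq (fun x => φ (sh i d x)) (hφ.comp (hsm hd)) (by
    intro x h
    by_contra hne
    have := (hx x hne).2
    linarith)
  have e : ∀ s, (fun x => (φ (sh i d x) : ℂ) * kern (fun x => f (sh i c x)) (fun x => J (sh i c x)) (fun l x => g l (sh i c x)) A s x) = fun x => φ (sh i d x) * kern f J g A s (sh i d x) := by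
    intro s; funext x
    by_cases h : φ (sh i d x) = 0
    · simp [h]
    · have : sh i c x = sh i d x := by simp only [sh, (hx x h).1]
      simp only [kern, this]
  simp only [e] at k1 k2
  have cov := fun s hs => shear_cov i hd hdi (fun x => φ x * kern f J g A s x) (k1 s hs)
  exact ⟨fun s hs => (cov s hs).1, k2.congr fun s hs => (cov s hs).2⟩

theorem good_of_mon {F : (Fin n → ℝ) → ℝ} (hM : Mon F) : AnalyticAt ℝ F 0 → ∀ {ι : Type} [Fintype ι] {f J : (Fin n → ℝ) → ℝ} {g : ι → (Fin n → ℝ) → ℝ} (A : Set (ι → SignType)),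
    Dv F f → Dv F J → (∀ l, Dv F (g l)) → Good f J g A := by
  induction hM with
  | nc F h =>
    intro hF ι _ f J g A hf hJ hg
    exact leaf_good A (hf.nc h) (hJ.nc h) (fun l => (hg l).nc h)
  | blow F i j hij h1 h2 ih1 ih2 =>
    intro hF ι _ f J g A hf hJ hg
    refine good_blow hij (fun t => ?_) ?_
    · have z := bl_zero i j t
      have hb := an_bl i j t 0
      have hX := an_coord j (0 : Fin n → ℝ)
      refine ih1 t (hX.mul (an_comp0 hF hb z)) A (hf.comp_bare hF hX hb z) ?_ (fun l => (hg l).comp_bare hF hX hb z)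
      simpa using hJ.comp hF hX hb z 1
    · have z := bl_zero j i 0
      have hb := an_bl j i 0 0
      have hX := an_coord i (0 : Fin n → ℝ)
      refine ih2 (hX.mul (an_comp0 hF hb z)) A (hf.comp_bare hF hX hb z) ?_ (fun l => (hg l).comp_bare hF hX hb z)
      simpa using hJ.comp hF hX hb z 1
  | pow F i k hk h1 h2 ih1 ih2 =>
    intro hF ι _ f J g A hf hJ hg
    have hX := an_coord i (0 : Fin n → ℝ)
    have step : ∀ ε : ℝ, (∀ l, Dv (fun x => x i * F (pw i ε (2 * k) x)) (gopt i ε (2 * k) g l)) := by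
      intro ε l
      have z := pw_zero i ε (2 * k) (by omega)
      have hb := an_pw i ε (2 * k) 0
      cases l with
      | none => exact Dv.of_mul hX (an_comp0 hF hb z) fun x => rfl
      | some l => exact (hg l).comp_bare hF hX hb z
    refine good_pow i (2 * k) (by omega) ?_ ?_
    · have z := pw_zero i 1 (2 * k) (by omega)
      have hb := an_pw i 1 (2 * k) 0
      exact ih1 (hX.mul (an_comp0 hF hb z)) _ (hf.comp_bare hF hX hb z) (hJ.comp hF hX hb z (2 * k - 1)) (step 1)
    · have z := pw_zero i (-1) (2 * k) (by omega)
      have hb := an_pw i (-1) (2 * k) 0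
      exact ih2 (hX.mul (an_comp0 hF hb z)) _ (hf.comp_bare hF hX hb z) (hJ.comp hF hX hb z (2 * k - 1)) (step (-1))
  | shear F i c hc hc0 hci h ih =>
    intro hF ι _ f J g A hf hJ hg
    have z := sh_zero i c hc0
    have hb := an_sh i hc
    have cmp : ∀ {L}, Dv F L → Dv (fun x => F (sh i c x)) (fun x => L (sh i c x)) := by
      intro L hL
      simpa using hL.comp_bare hF (analyticAt_const (v := (1:ℝ))) hb z
    exact good_shear i hc hc0 hci (ih (an_comp0 hF hb z) A (cmp hf) (cmp hJ) (fun l => cmp (hg l)))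
end

section
open Filter Topology

theorem poly_null : ∀ {n : ℕ} (p : MvPolynomial (Fin n) ℝ), p ≠ 0 → ∀ᵐ x : Fin n → ℝ, MvPolynomial.eval x p ≠ 0
  | 0, p, hp => by
    refine Eventually.of_forall fun x hx => hp ?_
    refine MvPolynomial.funext fun y => ?_
    rw [Subsingleton.elim y x, hx, map_zero]
  | n+1, p, hp => by
    set P := MvPolynomial.finSuccEquiv ℝ n p with hP
    have hP0 : P ≠ 0 := by simpa [hP] using hp
    have ih := poly_null P.leadingCoeff (by simpa using hP0)
    have mp := volume_preserving_piFinSuccAbove (fun _ : Fin (n+1) => ℝ) 0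
    have hm : MeasurableSet {z : ℝ × (Fin n → ℝ) | MvPolynomial.eval (Fin.cons z.1 z.2 : Fin (n+1) → ℝ) p ≠ 0} := by
      have hc : Continuous fun z : ℝ × (Fin n → ℝ) => MvPolynomial.eval (Fin.cons z.1 z.2 : Fin (n+1) → ℝ) p := by
        refine (MvPolynomial.continuous_eval p).comp ?_
        exact Continuous.finCons continuous_fst continuous_snd
      exact (isOpen_ne.preimage hc).measurableSet
    have key : ∀ᵐ z : ℝ × (Fin n → ℝ), MvPolynomial.eval (Fin.cons z.1 z.2 : Fin (n+1) → ℝ) p ≠ 0 := by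
      have : ∀ᵐ z : (Fin n → ℝ) × ℝ, MvPolynomial.eval (Fin.cons z.2 z.1 : Fin (n+1) → ℝ) p ≠ 0 := by
        refine (Measure.ae_prod_iff_ae_ae (μ := volume) (ν := volume) (p := fun z : (Fin n → ℝ) × ℝ => MvPolynomial.eval (Fin.cons z.2 z.1 : Fin (n+1) → ℝ) p ≠ 0) (measurable_swap hm)).2 ?_
        filter_upwards [ih] with x hx
        have hne : P.map (MvPolynomial.eval x) ≠ 0 := by
          intro h0
          apply hx
          have := congrArg (fun q => q.coeff P.natDegree) h0
          simpa using this
        have hf : (((P.map (MvPolynomial.eval x)).roots.toFinset : Finset ℝ) : Set ℝ).Finite := Finset.finite_toSet _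
        filter_upwards [compl_mem_ae_iff.2 (hf.measure_zero volume)] with y hy h0
        apply hy
        rw [MvPolynomial.eval_eq_eval_mv_eval'] at h0
        simpa [hne] using h0
      have sw := (Measure.measurePreserving_swap (μ := (volume : Measure ℝ)) (ν := (volume : Measure (Fin n → ℝ)))).quasiMeasurePreserving.ae this
      exact sw
    have := mp.quasiMeasurePreserving.ae key
    filter_upwards [this] with x hx
    have e : (Fin.cons (x 0) (fun j => x (Fin.succ j)) : Fin (n+1) → ℝ) = x := by
      ext j; refine Fin.cases ?_ (fun j => ?_) j <;> simp
    have hx' : MvPolynomial.eval (Fin.cons (x 0) (fun j => x (Fin.succ j)) : Fin (n+1) → ℝ) p ≠ 0 := hx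
    rwa [e] at hx'

variable {n : ℕ}

def shp (c : Fin n → ℝ) (p : MvPolynomial (Fin n) ℝ) : (Fin n → ℝ) → ℝ := fun x => MvPolynomial.eval (x + c) p

theorem shp_an (c : Fin n → ℝ) (p : MvPolynomial (Fin n) ℝ) (y) : AnalyticAt ℝ (shp c p) y := by
  have h := AnalyticOnNhd.eval_mvPolynomial (𝕜 := ℝ) p
  exact AnalyticAt.fun_comp (g := fun x => MvPolynomial.eval x p) (f := fun x => x + c) (h (y + c) trivial) (analyticAt_id.add analyticAt_const)

theorem shp_ne (c : Fin n → ℝ) {p : MvPolynomial (Fin n) ℝ} (hp : p ≠ 0) : ¬ shp c p =ᶠ[𝓝 0] 0 := by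
  intro h
  have h2 : ∀ᶠ x in 𝓝 c, MvPolynomial.eval x p = 0 := by
    have : Tendsto (fun x => x - c) (𝓝 c) (𝓝 0) := by
      have : Continuous fun x : Fin n → ℝ => x - c := by fun_prop
      simpa using this.tendsto c
    filter_upwards [this.eventually h] with x hx
    simpa [shp] using hx
  have h3 := poly_null p hp
  obtain ⟨U, hU, ho, hc⟩ := eventually_nhds_iff.1 h2
  have : volume U = 0 := measure_mono_null (fun x hx => by simpa using hU x hx) (ae_iff.1 h3)
  exact (ho.measure_pos volume ⟨c, hc⟩).ne' this

theorem PP_ne {n N M : ℕ} {s : ℂ} (h : ∀ r : ℕ, 0 < r → s ≠ -(r : ℂ) / (N : ℂ)) : PP n N M s ≠ 0 := by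
  refine Finset.prod_ne_zero_iff.2 fun r _ => pow_ne_zero _ fun h0 => h (r+1) (Nat.succ_pos _) ?_
  rw [eq_neg_of_add_eq_zero_left h0]; push_cast; ring

theorem ev_np {N : ℕ} (hN : 0 < N) (s0 : ℂ) : ∀ᶠ s in 𝓝[≠] s0, ∀ r : ℕ, 0 < r → s ≠ -(r : ℂ) / (N : ℂ) := by
  have hN' : (N : ℂ) ≠ 0 := by exact_mod_cast hN.ne'
  have hd : HasDerivAt (fun s : ℂ => cexp (2 * Real.pi * I * N * s)) (cexp (2 * Real.pi * I * N * s0) * (2 * Real.pi * I * N * 1)) s0 :=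
    ((hasDerivAt_id s0).const_mul _).cexp
  have hne : cexp (2 * Real.pi * I * N * s0) * (2 * Real.pi * I * N * 1) ≠ 0 := by
    simp [Complex.exp_ne_zero, Real.pi_ne_zero, hN', hN.ne']
  filter_upwards [hd.eventually_ne (c := 1) hne] with s hs r hr e
  apply hs
  rw [Complex.exp_eq_one_iff]
  refine ⟨-(r : ℤ), ?_⟩
  rw [e]; push_cast; field_simp

theorem glue {n N : ℕ} {Z : ℂ → ℂ} (hN : 0 < N) (h : MMN n N Z) :
    ∃ I : ℂ → ℂ, (∀ s : ℂ, 0 < s.re → I s = Z s) ∧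
      (∀ s : ℂ, (∀ r : ℕ, 0 < r → s ≠ -(r : ℂ) / (N : ℂ)) → AnalyticAt ℂ I s) ∧
      (∀ r : ℕ, 0 < r →
        ∃ g : ℂ → ℂ, AnalyticAt ℂ g (-(r : ℂ) / (N : ℂ)) ∧
          ∀ᶠ s in nhdsWithin (-(r : ℂ) / (N : ℂ)) {(-(r : ℂ) / (N : ℂ))}ᶜ,
            I s = g s / (s - (-(r : ℂ) / (N : ℂ))) ^ n) := by
  have hN' : (N : ℂ) ≠ 0 := by exact_mod_cast hN.ne'
  have h' : ∀ K : ℕ, ∃ (M : ℕ) (H : ℂ → ℂ), K ≤ M ∧ DifferentiableOn ℂ H {s | -(K : ℝ) < s.re} ∧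
      ∀ s : ℂ, 0 < s.re → Z s * PP n N M s = H s := by
    intro K
    obtain ⟨M, H, hH, e⟩ := h K
    obtain ⟨Q, hQ, q⟩ := PP_le (n := n) (N := N) (le_max_left M K)
    exact ⟨max M K, fun s => H s * Q s, le_max_right _ _, hH.mul hQ.differentiableOn, fun s hs => by
      rw [q, ← mul_assoc, e s hs]⟩
  choose M H hKM hH e using h'
  have op : ∀ K : ℕ, IsOpen {s : ℂ | -(K : ℝ) < s.re} := fun K => isOpen_lt continuous_const continuous_re
  have cons0 : ∀ K K' : ℕ, K ≤ K' → ∀ s : ℂ, -(K : ℝ) < s.re → H K s * PP n N (M K') s = H K' s * PP n N (M K) s := by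
    intro K K' hK
    have sub : {s : ℂ | -(K : ℝ) < s.re} ⊆ {s : ℂ | -(K' : ℝ) < s.re} := fun s hs => by
      have : (K : ℝ) ≤ K' := by exact_mod_cast hK
      simp only [Set.mem_setOf_eq] at hs ⊢; linarith
    have a1 : AnalyticOnNhd ℂ (fun s => H K s * PP n N (M K') s) {s : ℂ | -(K : ℝ) < s.re} :=
      ((hH K).mul (PP_diff n N (M K')).differentiableOn).analyticOnNhd (op K)
    have a2 : AnalyticOnNhd ℂ (fun s => H K' s * PP n N (M K) s) {s : ℂ | -(K : ℝ) < s.re} :=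
      (((hH K').mono sub).mul (PP_diff n N (M K)).differentiableOn).analyticOnNhd (op K)
    have pc : IsPreconnected {s : ℂ | -(K : ℝ) < s.re} := (convex_halfSpace_re_gt _).isPreconnected
    have h1 : (1 : ℂ) ∈ {s : ℂ | -(K : ℝ) < s.re} := by
      have : (0:ℝ) ≤ K := Nat.cast_nonneg K
      simp only [Set.mem_setOf_eq, one_re]; linarith
    refine a1.eqOn_of_preconnected_of_eventuallyEq a2 pc h1 ?_
    have : ∀ᶠ s : ℂ in 𝓝 1, 0 < s.re := (isOpen_lt continuous_const continuous_re).mem_nhds (by simp)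
    filter_upwards [this] with s hs
    rw [← e K s hs, ← e K' s hs]; ring
  have cons : ∀ K K' : ℕ, ∀ s : ℂ, -(K : ℝ) < s.re → -(K' : ℝ) < s.re → H K s * PP n N (M K') s = H K' s * PP n N (M K) s := by
    intro K K' s h1 h2
    rcases le_total K K' with h | h
    · exact cons0 K K' h s h1
    · exact (cons0 K' K h s h2).symm
  let kk : ℂ → ℕ := fun s => ⌈|s.re|⌉₊ + 1
  have hkk : ∀ s, -(kk s : ℝ) < s.re := by
    intro s
    have := Nat.le_ceil |s.re|
    have := neg_abs_le s.re
    simp only [kk]; push_cast; linarith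
  have hI : ∀ (K : ℕ) (s : ℂ), -(K : ℝ) < s.re → (∀ r : ℕ, 0 < r → s ≠ -(r : ℂ) / (N : ℂ)) →
      H (kk s) s / PP n N (M (kk s)) s = H K s / PP n N (M K) s := by
    intro K s hs hp
    rw [div_eq_div_iff (PP_ne hp) (PP_ne hp)]
    exact cons _ _ s (hkk s) hs
  refine ⟨fun s => H (kk s) s / PP n N (M (kk s)) s, ?_, ?_, ?_⟩
  · intro s hs
    have hp : ∀ r : ℕ, 0 < r → s ≠ -(r : ℂ) / (N : ℂ) := by
      rintro r hr rfl
      have : (-(r : ℂ) / (N : ℂ)).re = -(r : ℝ) / N := by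
        rw [← ofReal_natCast, ← ofReal_natCast, ← ofReal_neg, ← ofReal_div, ofReal_re]
      rw [this] at hs
      have : -(r : ℝ) / N ≤ 0 := div_nonpos_of_nonpos_of_nonneg (by simp) (by positivity)
      linarith
    simp only
    rw [div_eq_iff (PP_ne hp), e _ s hs]
  · intro s hs
    have ev : ∀ᶠ z in 𝓝 s, ∀ r : ℕ, 0 < r → z ≠ -(r : ℂ) / (N : ℂ) := by
      have := ev_np hN s
      rw [eventually_nhdsWithin_iff] at this
      filter_upwards [this] with z hz
      by_cases hzs : z = s
      · rw [hzs]; exact hs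
      · exact hz hzs
    have an : AnalyticAt ℂ (fun z => H (kk s) z / PP n N (M (kk s)) z) s :=
      (((hH (kk s)).analyticAt ((op _).mem_nhds (hkk s)))).div ((PP_diff _ _ _).analyticAt s) (PP_ne hs)
    refine an.congr ?_
    filter_upwards [ev, (op (kk s)).mem_nhds (hkk s)] with z hz hz2
    exact (hI (kk s) z hz2 hz).symm
  · intro r hr
    have hre : -((r+1 : ℕ) : ℝ) < (-(r : ℂ) / (N : ℂ)).re := by
      have : (-(r : ℂ) / (N : ℂ)).re = -(r : ℝ) / N := by
        rw [← ofReal_natCast, ← ofReal_natCast, ← ofReal_neg, ← ofReal_div, ofReal_re]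
      rw [this, neg_div]
      have : (r : ℝ) / N ≤ r := div_le_self (by positivity) (by exact_mod_cast hN)
      push_cast; linarith
    have hmem : r - 1 ∈ Finset.range (M (r+1)) := by
      have := hKM (r+1); rw [Finset.mem_range]; omega
    let Q : ℂ → ℂ := fun s => ∏ j ∈ (Finset.range (M (r+1))).erase (r-1), (s + ((j : ℂ) + 1) / N) ^ n
    have hQd : Differentiable ℂ Q := by
      simp only [Q]
      fun_prop
    have hPQ : ∀ s, PP n N (M (r+1)) s = (s - (-(r : ℂ) / (N : ℂ))) ^ n * Q s := by
      intro s
      rw [PP, ← Finset.mul_prod_erase _ _ hmem]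
      congr 2
      rw [Nat.cast_sub hr]; push_cast; ring
    have hQ0 : Q (-(r : ℂ) / (N : ℂ)) ≠ 0 := by
      refine Finset.prod_ne_zero_iff.2 fun j hj => pow_ne_zero _ fun h0 => ?_
      rw [← add_div, div_eq_zero_iff] at h0
      rcases h0 with h0 | h0
      · have : (r : ℂ) = ((j + 1 : ℕ) : ℂ) := by push_cast; linear_combination -h0
        have : r = j + 1 := by exact_mod_cast this
        have h3 := (Finset.mem_erase.1 hj).1
        omega
      · exact hN' h0
    refine ⟨fun s => H (r+1) s / Q s, ((hH (r+1)).analyticAt ((op _).mem_nhds hre)).div (hQd.analyticAt _) hQ0, ?_⟩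
    filter_upwards [ev_np hN _, mem_nhdsWithin_of_mem_nhds ((op (r+1)).mem_nhds hre)] with s hs hs2
    rw [hI (r+1) s hs2 hs, hPQ, div_div, mul_comm]
end

section
open Filter Topology
variable {n : ℕ}

theorem sa_sign {C : Set (Fin n → ℝ)} (h : IsSemialgebraic C) :
    ∃ (ι : Type) (_ : Fintype ι) (P : ι → MvPolynomial (Fin n) ℝ) (A : Set (ι → SignType)),
      (∀ q, P q ≠ 0) ∧ ∀ x, x ∈ C ↔ (fun q => SignType.sign (MvPolynomial.eval x (P q))) ∈ A := by
  classical
  obtain ⟨k, l, p, b, rfl⟩ := h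
  refine ⟨Σ i : Fin k, Fin (l i), inferInstance, fun q => if p q.1 q.2 = 0 then 1 else p q.1 q.2,
    {σ | ∃ i, ∀ j, if b i j then (p i j = 0 ∨ σ ⟨i, j⟩ = 0) else (p i j ≠ 0 ∧ σ ⟨i, j⟩ = 1)}, ?_, ?_⟩
  · intro q
    show (if p q.1 q.2 = 0 then 1 else p q.1 q.2) ≠ 0
    split_ifs with h
    · exact one_ne_zero
    · exact h
  · intro x
    simp only [Set.mem_iUnion, Set.mem_iInter, Set.mem_setOf_eq]
    refine exists_congr fun i => forall_congr' fun j => ?_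
    by_cases hb : b i j = true
    · by_cases hp : p i j = 0
      · simp [hb, hp]
      · simp [hb, hp, sign_eq_zero_iff]
    · by_cases hp : p i j = 0
      · simp [hb, hp]
      · simp [hb, hp, sign_eq_one_iff]

theorem good_poly {ι : Type} [Fintype ι] {f : MvPolynomial (Fin n) ℝ} (hf : f ≠ 0) {P : ι → MvPolynomial (Fin n) ℝ}
    (hP : ∀ q, P q ≠ 0) (A : Set (ι → SignType)) (c : Fin n → ℝ) :
    Good (shp c f) (fun _ => 1) (fun q => shp c (P q)) A := by
  have aP : AnalyticAt ℝ (fun x => ∏ q ∈ Finset.univ, shp c (P q) x) 0 :=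
    Finset.analyticAt_fun_prod _ fun j hj => shp_an c (P j) 0
  have aF : AnalyticAt ℝ (fun x => shp c f x * ∏ q ∈ Finset.univ, shp c (P q) x) 0 := (shp_an c f 0).mul aP
  have nF : ¬ (fun x => shp c f x * ∏ q ∈ Finset.univ, shp c (P q) x) =ᶠ[𝓝 0] 0 := by
    intro h
    rcases germ_domain (shp_an c f 0) aP h with h | h
    · exact shp_ne c hf h
    · exact prod_germ_ne Finset.univ _ (fun q _ => shp_an c (P q) 0) (fun q _ => shp_ne c (hP q)) h
  refine good_of_mon (LM_all n _ aF nF) aF A ?_ ?_ ?_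
  · exact Dv.of_mul (shp_an c f 0) aP fun x => rfl
  · exact Dv.of_mul analyticAt_const aF fun x => one_mul _
  · exact fun q => (Dv.of_prod Finset.univ (fun q => shp c (P q)) (fun q _ => shp_an c (P q) 0) (Finset.mem_univ q)).mul_left (shp_an c f 0)

theorem global_MM {C : Set (Fin n → ℝ)} (hCsa : IsSemialgebraic C) (hC : IsCompact C)
    {f : MvPolynomial (Fin n) ℝ} (hf : f ≠ 0)
    (hnonneg : ∀ x ∈ C, 0 ≤ MvPolynomial.eval x f) :
    (∀ s : ℂ, 0 < s.re → IntegrableOn (fun x => ((MvPolynomial.eval x f : ℝ) : ℂ) ^ s) C volume) ∧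
    MM n (fun s => ∫ x in C, ((MvPolynomial.eval x f : ℝ) : ℂ) ^ s) := by
  classical
  obtain ⟨ι, _, P, A, hP, hA⟩ := sa_sign hCsa
  choose r hr hG using fun c => good_poly hf hP A c
  obtain ⟨t, ρ, ht, hρ, hsub, hsum⟩ := pou hC (fun c => Metric.ball c (r c)) (fun c _ => Metric.ball_mem_nhds c (hr c))
  let k : ℂ → (Fin n → ℝ) → ℂ := fun s => C.indicator fun x => ((MvPolynomial.eval x f : ℝ) : ℂ) ^ s
  have hk : ∀ c s x, kern (shp c f) (fun _ => 1) (fun q => shp c (P q)) A s x = k s (x + c) := by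
    intro c s x
    unfold kern
    by_cases hx : x + c ∈ C
    · rw [if_pos (show (fun i => SignType.sign ((fun q => shp c (P q)) i x)) ∈ A from (hA _).1 hx)]
      simp only [k, Set.indicator_of_mem hx, shp, abs_of_nonneg (hnonneg _ hx)]
      simp
    · rw [if_neg (show ¬ (fun i => SignType.sign ((fun q => shp c (P q)) i x)) ∈ A from fun h => hx ((hA _).2 h))]
      simp only [k, Set.indicator_of_notMem hx]
  have loc : ∀ c ∈ t, (∀ s : ℂ, 0 < s.re → Integrable fun x => (ρ c x : ℂ) * k s x) ∧
      MM n (fun s => ∫ x, (ρ c x : ℂ) * k s x) := by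
    intro c hc
    obtain ⟨h1, h2⟩ := hG c (fun x => ρ c (x + c)) ((hρ c).comp (contDiff_id.add contDiff_const)) (by
      intro x hx
      by_contra h0
      have := hsub c hc _ h0
      rw [Metric.mem_ball, dist_eq_norm, add_sub_cancel_right] at this
      linarith)
    simp only [hk] at h1 h2
    refine ⟨fun s hs => ?_, h2.congr fun s hs => ?_⟩
    · simpa using (h1 s hs).comp_sub_right c
    · exact (integral_add_right_eq_self (fun x => (ρ c x : ℂ) * k s x) c).symm
  have hks : ∀ s x, k s x = ∑ c ∈ t, (ρ c x : ℂ) * k s x := by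
    intro s x
    rw [← Finset.sum_mul]
    by_cases hx : x ∈ C
    · rw [← ofReal_sum, hsum x hx]; simp
    · simp only [k, Set.indicator_of_notMem hx, mul_zero]
  have mC := hC.isClosed.measurableSet
  have hint : ∀ s : ℂ, 0 < s.re → Integrable (k s) := by
    intro s hs
    have : k s = fun x => ∑ c ∈ t, (ρ c x : ℂ) * k s x := funext (hks s)
    rw [this]
    exact integrable_finset_sum t fun c hc => (loc c hc).1 s hs
  refine ⟨fun s hs => (integrable_indicator_iff mC).1 (hint s hs), ?_⟩
  refine (MM.sum t fun c hc => (loc c hc).2).congr fun s hs => ?_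
  rw [← integral_indicator mC, ← integral_finset_sum t fun c hc => (loc c hc).1 s hs]
  exact integral_congr_ae (Eventually.of_forall fun x => hks s x)

theorem val_zero {C : Set (Fin n → ℝ)} (hC : IsCompact C)
    {f : MvPolynomial (Fin n) ℝ} (hf : f ≠ 0)
    (hnonneg : ∀ x ∈ C, 0 ≤ MvPolynomial.eval x f) :
    Tendsto (fun m : ℕ => ∫ x in C, ((MvPolynomial.eval x f : ℝ) : ℂ) ^ ((1 / ((m : ℝ) + 1) : ℝ) : ℂ)) atTop (𝓝 ((volume C).toReal : ℂ)) := by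
  have mC := hC.isClosed.measurableSet
  obtain ⟨B, hB⟩ := hC.exists_bound_of_continuousOn (MvPolynomial.continuous_eval f).continuousOn
  haveI : IsFiniteMeasure (volume.restrict C) := ⟨by simpa using hC.measure_lt_top⟩
  have lim : Tendsto (fun m : ℕ => (1 / ((m : ℝ) + 1))) atTop (𝓝 0) := tendsto_one_div_add_atTop_nhds_zero_nat
  have e : ((volume C).toReal : ℂ) = ∫ x in C, (1 : ℂ) := by simp [Measure.real]
  rw [e]
  refine tendsto_integral_of_dominated_convergence (fun _ => max 1 B) ?_ (integrable_const _) ?_ ?_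
  · intro m
    refine Measurable.aestronglyMeasurable ?_
    have : Measurable fun x => MvPolynomial.eval x f := (MvPolynomial.continuous_eval f).measurable
    fun_prop
  · intro m
    filter_upwards [ae_restrict_mem mC] with x hx
    have hpos : (0:ℝ) < 1 / ((m : ℝ) + 1) := by positivity
    have h0 := hnonneg x hx
    have hle : MvPolynomial.eval x f ≤ max 1 B := by
      have := hB x hx
      rw [Real.norm_of_nonneg h0] at this
      exact this.trans (le_max_right _ _)
    rw [← ofReal_cpow h0, norm_real, Real.norm_of_nonneg (Real.rpow_nonneg h0 _)]
    calc _ ≤ (max 1 B) ^ (1 / ((m : ℝ) + 1)) := Real.rpow_le_rpow h0 hle hpos.le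
      _ ≤ (max 1 B) ^ (1:ℝ) := Real.rpow_le_rpow_of_exponent_le (le_max_left _ _) (by
          rw [div_le_one (by positivity)]; have : (0:ℝ) ≤ m := Nat.cast_nonneg m; linarith)
      _ = _ := Real.rpow_one _
  · filter_upwards [ae_restrict_of_ae (poly_null f hf)] with x hx
    have : Tendsto (fun m : ℕ => ((MvPolynomial.eval x f : ℝ) : ℂ) ^ ((1 / ((m : ℝ) + 1) : ℝ) : ℂ)) atTop (𝓝 (((MvPolynomial.eval x f : ℝ) : ℂ) ^ ((0:ℝ):ℂ))) := by
      refine Tendsto.const_cpow ?_ (Or.inl (by exact_mod_cast hx))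
      exact (continuous_ofReal.tendsto 0).comp lim
    simpa using this
end

/-- Atiyah's theorem (integral form): for a compact semialgebraic `C ⊆ ℝ^n` and a polynomial
`f` non-negative and not identically zero on `C`, the function `I(s) = ∫_C f^s dμ` is
holomorphic on `Re s > 0` and extends meromorphically to `ℂ` with poles contained in
`{-r/N : r = 1, 2, …}` for some fixed positive integer `N`, each pole of order at most `n`;
moreover the value of the extension at `s = 0` is `μ(C)`. -/
theorem atiyah_meromorphic_continuation
    (n : ℕ) (C : Set (Fin n → ℝ)) (hCsa : IsSemialgebraic C) (hCcomp : IsCompact C)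
    (f : MvPolynomial (Fin n) ℝ)
    (hnonneg : ∀ x ∈ C, 0 ≤ MvPolynomial.eval x f)
    (hnz : ∃ x ∈ C, MvPolynomial.eval x f ≠ 0) :
    ∃ (I : ℂ → ℂ) (N : ℕ), 0 < N ∧
      (∀ s : ℂ, 0 < s.re →
        IntegrableOn (fun x => ((MvPolynomial.eval x f : ℝ) : ℂ) ^ s) C volume ∧
        I s = ∫ x in C, ((MvPolynomial.eval x f : ℝ) : ℂ) ^ s) ∧
      (∀ s : ℂ, (∀ r : ℕ, 0 < r → s ≠ -(r : ℂ) / (N : ℂ)) → AnalyticAt ℂ I s) ∧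
      (∀ r : ℕ, 0 < r →
        ∃ g : ℂ → ℂ, AnalyticAt ℂ g (-(r : ℂ) / (N : ℂ)) ∧
          ∀ᶠ s in nhdsWithin (-(r : ℂ) / (N : ℂ)) {(-(r : ℂ) / (N : ℂ))}ᶜ,
            I s = g s / (s - (-(r : ℂ) / (N : ℂ))) ^ n) ∧
      I 0 = ((volume C).toReal : ℂ) := by
  obtain ⟨x0, hx0, hne⟩ := hnz
  have hf : f ≠ 0 := by rintro rfl; simp at hne
  obtain ⟨hint, N, hN, hM⟩ := global_MM hCsa hCcomp hf hnonneg
  obtain ⟨I, hIZ, hIa, hIp⟩ := glue hN hM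
  refine ⟨I, N, hN, fun s hs => ⟨hint s hs, hIZ s hs⟩, hIa, hIp, ?_⟩
  have ha : AnalyticAt ℂ I 0 := hIa 0 fun r hr h => by
    have h1 : (r : ℂ) ≠ 0 := by exact_mod_cast hr.ne'
    have h2 : (N : ℂ) ≠ 0 := by exact_mod_cast hN.ne'
    exact (div_ne_zero (neg_ne_zero.2 h1) h2) h.symm
  have lim : Filter.Tendsto (fun m : ℕ => ((1 / ((m : ℝ) + 1) : ℝ) : ℂ)) Filter.atTop (nhds 0) := by
    have := (continuous_ofReal.tendsto 0).comp (tendsto_one_div_add_atTop_nhds_zero_nat (𝕜 := ℝ))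
    rw [ofReal_zero] at this
    exact this
  have t1 := ha.continuousAt.tendsto.comp lim
  refine tendsto_nhds_unique t1 ((val_zero hCcomp hf hnonneg).congr fun m => ?_)
  have hp : (0:ℝ) < 1 / ((m : ℝ) + 1) := by positivity
  exact (hIZ _ (by rw [ofReal_re]; exact hp)).symm
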